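/- arXiv:1412.8159 — 3 statements merged into one kernel-verified Lean document; each statement's English description precedes it below -/
import Mathlib

section
/- Let 0<s<1, let N be an integer with N>2s, let 0 < γ < (N-2s)/2, and let Ω ⊂ ℝ^N be a bounded open set with smooth (C^{1,1}) boundary. There exists a constant C = C(N,s,Ω,γ) > 0 such that for every measurable w : Ω → ℝ with ‖w‖_{Y^{s,γ}(Ω)} < ∞ there exists a measurable w̃ : ℝ^N → ℝ with w̃ = w on Ω and ‖w̃‖_{Y^{s,γ}(ℝ^N)} ≤ C ‖w‖_{Y^{s,γ}(Ω)}. -/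
open MeasureTheory Real Filter

noncomputable section

/-- A bounded `C^{1,1}` domain: an open bounded set whose boundary is locally the zero level set
of a `C^1` defining function with (locally) Lipschitz derivative and nonvanishing gradient. -/
def IsC11Domain {N : ℕ} (Ω : Set (EuclideanSpace ℝ (Fin N))) : Prop :=
  IsOpen Ω ∧ Bornology.IsBounded Ω ∧
    ∀ p ∈ frontier Ω, ∃ r : ℝ, 0 < r ∧ ∃ φ : EuclideanSpace ℝ (Fin N) → ℝ, ∃ L : NNReal,
      ContDiff ℝ 1 φ ∧ LipschitzOnWith L (fderiv ℝ φ) (Metric.ball p r) ∧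
      (∀ x ∈ Metric.ball p r, φ x = 0 → fderiv ℝ φ x ≠ 0) ∧
      Ω ∩ Metric.ball p r = {x ∈ Metric.ball p r | φ x < 0}

/-- The square of the weighted Sobolev norm `‖φ‖_{Y^{s,γ}(O)}²
  = ∫_O φ² dμ + ∫_O ∫_O (φ(x)-φ(y))² dν`,
where `dμ = |x|^{-2γ} dx` and `dν = |x|^{-γ}|y|^{-γ}|x-y|^{-(N+2s)} dx dy`. -/
def YnormSq (N : ℕ) (s γ : ℝ) (O : Set (EuclideanSpace ℝ (Fin N)))
    (φ : EuclideanSpace ℝ (Fin N) → ℝ) : ℝ :=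
  (∫ x in O, φ x ^ 2 * ‖x‖ ^ (-(2 * γ))) +
    ∫ x in O, ∫ y in O,
      (φ x - φ y) ^ 2 * (‖x‖ ^ (-γ) * ‖y‖ ^ (-γ) * ‖x - y‖ ^ (-((N : ℝ) + 2 * s)))

/-- Finiteness of the weighted Sobolev norm `‖φ‖_{Y^{s,γ}(O)} < ∞`, expressed as integrability
of both (nonnegative) integrands. -/
def YnormFinite (N : ℕ) (s γ : ℝ) (O : Set (EuclideanSpace ℝ (Fin N)))
    (φ : EuclideanSpace ℝ (Fin N) → ℝ) : Prop :=
  Integrable (fun x => φ x ^ 2 * ‖x‖ ^ (-(2 * γ))) (volume.restrict O) ∧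
    Integrable
      (fun p : EuclideanSpace ℝ (Fin N) × EuclideanSpace ℝ (Fin N) =>
        (φ p.1 - φ p.2) ^ 2 *
          (‖p.1‖ ^ (-γ) * ‖p.2‖ ^ (-γ) * ‖p.1 - p.2‖ ^ (-((N : ℝ) + 2 * s))))
      ((volume.restrict O).prod (volume.restrict O))

section

open scoped ENNReal Topology

set_option linter.unusedSectionVars false

section Potential

variable {E : Type*} [NormedAddCommGroup E] [NormedSpace ℝ E] [FiniteDimensional ℝ E]
  [MeasureSpace E] [BorelSpace E] [(volume : Measure E).IsAddHaarMeasure]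

lemma enorm_rpow_eq_ofReal {x : E} (hx : x ≠ 0) (a : ℝ) :
    ‖x‖ₑ ^ a = ENNReal.ofReal (‖x‖ ^ a) := by
  rw [← ofReal_norm, ENNReal.ofReal_rpow_of_pos (norm_pos_iff.2 hx)]

lemma ae_ne_of_finrank_pos (hd : 0 < Module.finrank ℝ E) (y : E) : ∀ᵐ x : E, x ≠ y := by
  have : Nontrivial E := Module.nontrivial_of_finrank_pos (R := ℝ) hd
  simp [ae_iff]

lemma lintegral_unit_ball_enorm_rpow_ne_top {a : ℝ} (hd : 0 < Module.finrank ℝ E)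
    (ha : -(Module.finrank ℝ E : ℝ) < a) :
    ∫⁻ x in Metric.ball (0 : E) 1, ‖x‖ₑ ^ a ≠ ∞ := by
  have h : IntegrableOn (fun x : E => ‖x‖ ^ a) (Metric.ball 0 1) := by
    refine integrableOn_ball_of_norm_le_rpow (C := 1) (α := -a) hd (by linarith) ?_ ?_
    · refine Eventually.of_forall fun x => ?_
      rw [neg_neg, one_mul, Real.norm_of_nonneg (by positivity)]
    · exact (measurable_norm.pow_const a).aestronglyMeasurable
  have h2 := h.lintegral_lt_top
  have h3 : ∀ᵐ x : E ∂(volume.restrict (Metric.ball (0 : E) 1)),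
      ‖x‖ₑ ^ a = ENNReal.ofReal (‖x‖ ^ a) := by
    filter_upwards [ae_restrict_of_ae (ae_ne_of_finrank_pos hd 0)] with x hx
      using enorm_rpow_eq_ofReal hx a
  rw [lintegral_congr_ae h3]
  exact h2.ne

/-- The integral of `‖x - y‖ ^ a` over a ball centred at `y` scales like `R ^ (d + a)`. -/
lemma exists_lintegral_ball_enorm_rpow_le {a : ℝ} (hd : 0 < Module.finrank ℝ E)
    (ha : -(Module.finrank ℝ E : ℝ) < a) :
    ∃ C : ℝ≥0∞, C ≠ ∞ ∧ ∀ (y : E) (R : ℝ), 0 < R →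
      ∫⁻ x in Metric.ball y R, ‖x - y‖ₑ ^ a ≤
        C * ENNReal.ofReal R ^ ((Module.finrank ℝ E : ℝ) + a) := by
  refine ⟨_, lintegral_unit_ball_enorm_rpow_ne_top hd ha, fun y R hR => le_of_eq ?_⟩
  have h1 : ∫⁻ x in Metric.ball y R, ‖x - y‖ₑ ^ a =
      ∫⁻ x : E, (Metric.ball 0 R).indicator (fun x => ‖x‖ₑ ^ a) x := by
    rw [← lintegral_indicator Metric.isOpen_ball.measurableSet,
      ← lintegral_sub_right_eq_self ((Metric.ball 0 R).indicator (fun x : E => ‖x‖ₑ ^ a)) y]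
    refine lintegral_congr fun x => ?_
    simp only [Set.indicator, Metric.mem_ball, dist_eq_norm, sub_zero]
  have h2 : ∫⁻ x : E, (Metric.ball 0 R).indicator (fun x => ‖x‖ₑ ^ a) (R • x) =
      ENNReal.ofReal R ^ a * ∫⁻ x in Metric.ball (0 : E) 1, ‖x‖ₑ ^ a := by
    rw [← lintegral_const_mul _ (by fun_prop),
      ← lintegral_indicator Metric.isOpen_ball.measurableSet]
    refine lintegral_congr fun x => ?_
    simp only [Set.indicator, Metric.mem_ball, dist_eq_norm, sub_zero, norm_smul,
      Real.norm_of_nonneg hR.le, enorm_smul]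
    have : R * ‖x‖ < R ↔ ‖x‖ < 1 := by
      constructor <;> intro h <;> nlinarith
    simp only [this]
    split_ifs
    · rw [ENNReal.mul_rpow_of_ne_top (by simp) (by simp), Real.enorm_of_nonneg hR.le]
    · rfl
  have h3 := Measure.map_addHaar_smul (volume : Measure E) hR.ne'
  have h4 : ∫⁻ x : E, (Metric.ball 0 R).indicator (fun x => ‖x‖ₑ ^ a) (R • x) =
      ENNReal.ofReal (R ^ Module.finrank ℝ E)⁻¹ *
        ∫⁻ x : E, (Metric.ball 0 R).indicator (fun x => ‖x‖ₑ ^ a) x := by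
    rw [← lintegral_map (f := (Metric.ball 0 R).indicator (fun x : E => ‖x‖ₑ ^ a))
      (by exact (measurable_enorm.pow_const a).indicator Metric.isOpen_ball.measurableSet)
      (measurable_const_smul R), h3, lintegral_smul_measure, abs_of_pos (by positivity)]
    rfl
  have hR0 : ENNReal.ofReal R ≠ 0 := by simpa using hR
  rw [h1, mul_comm, ENNReal.rpow_add _ _ hR0 ENNReal.ofReal_ne_top, mul_assoc, ← h2, h4,
    ← mul_assoc, ENNReal.ofReal_inv_of_pos (by positivity), ENNReal.rpow_natCast,
    ENNReal.ofReal_pow hR.le, ENNReal.mul_inv_cancel (by simpa using fun h => absurd h hR.not_ge)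
      (by simp), one_mul]

lemma enorm_rpow_neg_le {F G : Type*} [SeminormedAddCommGroup F] [SeminormedAddCommGroup G]
    {x : F} {z : G} {c a : ℝ} (hc : 0 < c) (ha : 0 ≤ a)
    (h : ‖z‖ ≤ c * ‖x‖) : ‖x‖ₑ ^ (-a) ≤ ENNReal.ofReal c ^ a * ‖z‖ₑ ^ (-a) := by
  have h1 : ‖z‖ₑ ≤ ENNReal.ofReal c * ‖x‖ₑ := by
    rw [← ofReal_norm, ← ofReal_norm, ← ENNReal.ofReal_mul hc.le]
    exact ENNReal.ofReal_le_ofReal h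
  have hc0 : ENNReal.ofReal c ≠ 0 := by simpa using hc
  have h2 : (ENNReal.ofReal c * ‖x‖ₑ) ^ (-a) ≤ ‖z‖ₑ ^ (-a) := by
    rw [ENNReal.rpow_neg, ENNReal.rpow_neg]
    exact ENNReal.inv_le_inv.2 (ENNReal.rpow_le_rpow h1 ha)
  rw [ENNReal.mul_rpow_of_ne_top (by simp) (by simp)] at h2
  calc ‖x‖ₑ ^ (-a) = ENNReal.ofReal c ^ a * (ENNReal.ofReal c ^ (-a) * ‖x‖ₑ ^ (-a)) := by
        rw [← mul_assoc, ← ENNReal.rpow_add _ _ hc0 (by simp), add_neg_cancel, ENNReal.rpow_zero,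
          one_mul]
    _ ≤ _ := by gcongr

lemma exists_lintegral_compl_ball_enorm_rpow_le {a : ℝ}
    (ha : (Module.finrank ℝ E : ℝ) < a) :
    ∃ C : ℝ≥0∞, C ≠ ∞ ∧ ∀ y : E,
      ∫⁻ x in (Metric.ball y 1)ᶜ, ‖x - y‖ₑ ^ (-a) ≤ C := by
  have h := finite_integral_one_add_norm (E := E) (μ := volume) ha
  have ha0 : 0 ≤ a := (Nat.cast_nonneg _).trans ha.le
  refine ⟨ENNReal.ofReal 2 ^ a * _, ENNReal.mul_ne_top (by simp) h.ne, fun y => ?_⟩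
  calc ∫⁻ x in (Metric.ball y 1)ᶜ, ‖x - y‖ₑ ^ (-a)
      ≤ ∫⁻ x in (Metric.ball y 1)ᶜ, ENNReal.ofReal 2 ^ a *
          ENNReal.ofReal ((1 + ‖x - y‖) ^ (-a)) := by
        refine setLIntegral_mono_ae' Metric.isOpen_ball.measurableSet.compl
          (Eventually.of_forall fun x hx => ?_)
        have hx1 : 1 ≤ ‖x - y‖ := by simpa [dist_eq_norm] using hx
        have h1 : 0 < 1 + ‖x - y‖ := by positivity
        have h2 : ‖1 + ‖x - y‖‖ ≤ 2 * ‖x - y‖ := by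
          rw [Real.norm_of_nonneg h1.le]; linarith
        have := enorm_rpow_neg_le two_pos ha0 h2
        rwa [Real.enorm_of_nonneg h1.le, ENNReal.ofReal_rpow_of_pos h1] at this
    _ ≤ ∫⁻ x, ENNReal.ofReal 2 ^ a * ENNReal.ofReal ((1 + ‖x - y‖) ^ (-a)) :=
        setLIntegral_le_lintegral _ _
    _ = _ := by
        rw [lintegral_const_mul _ (by fun_prop),
          lintegral_sub_right_eq_self (fun x => ENNReal.ofReal ((1 + ‖x‖) ^ (-a)))]


lemma min_one_sq_mul_rpow_le {t : ℝ≥0∞} {b c : ℝ} (hb0 : 0 < b) (hb : b ≤ 2) (ht : t ≠ ∞) :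
    (min 1 t) ^ 2 * t ^ (-(c + b)) ≤ t ^ (-c) := by
  rcases eq_or_ne t 0 with rfl | h0
  · simp
  have h1 : (min 1 t) ^ 2 ≤ t ^ b := by
    rw [← ENNReal.rpow_two]
    rcases le_total t 1 with h | h
    · rw [min_eq_right h]
      exact ENNReal.rpow_le_rpow_of_exponent_ge h hb
    · rw [min_eq_left h, ENNReal.one_rpow]
      exact ENNReal.one_le_rpow h hb0
  calc (min 1 t) ^ 2 * t ^ (-(c + b)) ≤ t ^ b * t ^ (-(c + b)) := by gcongr
    _ = t ^ (-c) := by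
      rw [← ENNReal.rpow_add _ _ h0 ht]; congr 1; ring

/-- The weight `‖x‖ ^ (-γ)` is, up to a constant, a supersolution for the truncated fractional
kernel. -/
lemma exists_lintegral_min_sq_mul_kernel_le {s γ : ℝ} (hs0 : 0 < s) (hs1 : s < 1) (hγ0 : 0 < γ)
    (hγ : γ < Module.finrank ℝ E) :
    ∃ C : ℝ≥0∞, C ≠ ∞ ∧ ∀ y : E,
      ∫⁻ x, (min 1 ‖x - y‖ₑ) ^ 2 * ‖x - y‖ₑ ^ (-((Module.finrank ℝ E : ℝ) + 2 * s)) *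
        ‖x‖ₑ ^ (-γ) ≤ C * ‖y‖ₑ ^ (-γ) := by
  have hd : 0 < Module.finrank ℝ E := by exact_mod_cast hγ0.trans hγ
  set d : ℝ := (Module.finrank ℝ E : ℝ) with hd_def
  obtain ⟨C₁, hC₁, h₁⟩ := exists_lintegral_ball_enorm_rpow_le (E := E) (a := 2 - d - 2 * s) hd
    (by linarith)
  obtain ⟨C₂, hC₂, h₂⟩ := exists_lintegral_compl_ball_enorm_rpow_le (E := E) (a := d + 2 * s)
    (by linarith)
  obtain ⟨C₃, hC₃, h₃⟩ := exists_lintegral_ball_enorm_rpow_le (E := E) (a := -γ) hd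
    (by linarith)
  have htot : ∀ y : E, ∫⁻ x, (min 1 ‖x - y‖ₑ) ^ 2 * ‖x - y‖ₑ ^ (-(d + 2 * s)) ≤ C₁ + C₂ := by
    intro y
    rw [← lintegral_add_compl _ (Metric.isOpen_ball (x := y) (ε := 1)).measurableSet]
    refine add_le_add ?_ ?_
    · refine le_trans (lintegral_mono fun x => ?_) ((h₁ y 1 one_pos).trans (by simp))
      rcases eq_or_ne ‖x - y‖ₑ 0 with h0 | h0
      · simp [h0]
      calc (min 1 ‖x - y‖ₑ) ^ 2 * ‖x - y‖ₑ ^ (-(d + 2 * s))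
          ≤ ‖x - y‖ₑ ^ 2 * ‖x - y‖ₑ ^ (-(d + 2 * s)) := by gcongr; exact min_le_right _ _
        _ = ‖x - y‖ₑ ^ (2 - d - 2 * s) := by
          rw [← ENNReal.rpow_two, ← ENNReal.rpow_add _ _ h0 (by simp)]; congr 1; ring
    · refine le_trans (lintegral_mono fun x => ?_) (h₂ y)
      refine mul_le_of_le_one_left' (pow_le_one₀ zero_le (min_le_left _ _))
  refine ⟨ENNReal.ofReal 2 ^ γ * (C₁ + C₂) + ENNReal.ofReal 2 ^ d * C₃ *
    ENNReal.ofReal (1 / 2) ^ (d - γ), ?_, fun y => ?_⟩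
  · have : 0 ≤ d - γ := by linarith
    finiteness
  have hmeas : MeasurableSet {x : E | ‖y‖ ≤ 2 * ‖x‖} :=
    measurableSet_le measurable_const (by fun_prop)
  rw [← lintegral_add_compl _ hmeas, add_mul]
  refine add_le_add ?_ ?_
  · calc _ ≤ ∫⁻ x in {x : E | ‖y‖ ≤ 2 * ‖x‖}, (ENNReal.ofReal 2 ^ γ * ‖y‖ₑ ^ (-γ)) *
          ((min 1 ‖x - y‖ₑ) ^ 2 * ‖x - y‖ₑ ^ (-(d + 2 * s))) := by
          refine setLIntegral_mono_ae' hmeas (Eventually.of_forall fun x hx => ?_)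
          rw [mul_comm]
          gcongr
          exact enorm_rpow_neg_le two_pos hγ0.le hx
      _ ≤ _ := setLIntegral_le_lintegral _ _
      _ ≤ (ENNReal.ofReal 2 ^ γ * ‖y‖ₑ ^ (-γ)) * (C₁ + C₂) := by
          rw [lintegral_const_mul _ (by fun_prop)]
          gcongr
          exact htot y
      _ = _ := by ring
  · rcases eq_or_ne y 0 with rfl | hy
    · simp
    have hy0 : 0 < ‖y‖ := norm_pos_iff.2 hy
    have hye : ‖y‖ₑ ≠ 0 := by simpa using hy
    calc _ ≤ ∫⁻ x in {x : E | ‖y‖ ≤ 2 * ‖x‖}ᶜ,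
          (ENNReal.ofReal 2 ^ d * ‖y‖ₑ ^ (-d)) * ‖x‖ₑ ^ (-γ) := by
          refine setLIntegral_mono_ae' hmeas.compl (Eventually.of_forall fun x hx => ?_)
          refine mul_le_mul' ?_ le_rfl
          refine (min_one_sq_mul_rpow_le (b := 2 * s) (c := d) (t := ‖x - y‖ₑ) (by linarith)
            (by linarith) (by simp)).trans ?_
          refine enorm_rpow_neg_le two_pos (by positivity) ?_
          have hx' : 2 * ‖x‖ < ‖y‖ := by simpa using hx
          have := norm_sub_norm_le y x
          rw [norm_sub_rev] at this
          linarith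
      _ ≤ ∫⁻ x in Metric.ball (0 : E) (‖y‖ * (1 / 2)),
          (ENNReal.ofReal 2 ^ d * ‖y‖ₑ ^ (-d)) * ‖x - 0‖ₑ ^ (-γ) := by
          simp only [sub_zero]
          refine lintegral_mono_set fun x hx => ?_
          have hx' : 2 * ‖x‖ < ‖y‖ := by simpa using hx
          simp only [Metric.mem_ball, dist_zero_right]
          linarith
      _ ≤ (ENNReal.ofReal 2 ^ d * ‖y‖ₑ ^ (-d)) *
          (C₃ * ENNReal.ofReal (‖y‖ * (1 / 2)) ^ (d + -γ)) := by
          rw [lintegral_const_mul _ (by fun_prop)]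
          gcongr
          exact h₃ 0 _ (by positivity)
      _ = _ := by
          rw [ENNReal.ofReal_mul hy0.le, ENNReal.mul_rpow_of_ne_top (by simp) (by simp),
            ofReal_norm, ← sub_eq_add_neg]
          have : ‖y‖ₑ ^ (-γ) = ‖y‖ₑ ^ (-d) * ‖y‖ₑ ^ (d - γ) := by
            rw [← ENNReal.rpow_add _ _ hye (by simp)]; congr 1; ring
          rw [this]
          ring

end Potential

section Corkscrew

/-- The interior corkscrew condition at scale `ρ` with ratio `κ`, for the boundary points of `Ω`
lying in `S`. -/
def InteriorCorkscrew {E : Type*} [PseudoMetricSpace E] (Ω S : Set E) (κ ρ : ℝ) : Prop :=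
  ∀ q ∈ frontier Ω ∩ S, ∀ t : ℝ, 0 < t → t < ρ →
    ∃ z, dist z q ≤ t ∧ Metric.ball z (κ * t) ⊆ Ω

lemma InteriorCorkscrew.mono {E : Type*} [PseudoMetricSpace E] {Ω S S' : Set E} {κ κ' ρ ρ' : ℝ}
    (h : InteriorCorkscrew Ω S κ ρ) (hS : S' ⊆ S) (hκ : κ' ≤ κ) (hρ : ρ' ≤ ρ) :
    InteriorCorkscrew Ω S' κ' ρ' := by
  intro q hq t ht htρ
  obtain ⟨z, hz, hzΩ⟩ := h q ⟨hq.1, hS hq.2⟩ t ht (htρ.trans_le hρ)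
  exact ⟨z, hz, (Metric.ball_subset_ball (by gcongr)).trans hzΩ⟩

lemma exists_interiorCorkscrew_of_defining_function {E : Type*} [NormedAddCommGroup E]
    [NormedSpace ℝ E] {Ω : Set E} {p : E} {r : ℝ} (hΩ : IsOpen Ω) (hp : p ∈ frontier Ω)
    (hr : 0 < r) {φ : E → ℝ} (hφ : ContDiff ℝ 1 φ)
    (hne : ∀ x ∈ Metric.ball p r, φ x = 0 → fderiv ℝ φ x ≠ 0)
    (heq : Ω ∩ Metric.ball p r = {x ∈ Metric.ball p r | φ x < 0}) :
    ∃ κ ρ : ℝ, 0 < κ ∧ κ ≤ 1 ∧ 0 < ρ ∧ ∃ U ∈ 𝓝 p, InteriorCorkscrew Ω U κ ρ := by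
  have hmem : ∀ x ∈ Metric.ball p r, (x ∈ Ω ↔ φ x < 0) := fun x hx => by
    have : x ∈ Ω ∩ Metric.ball p r ↔ x ∈ {x ∈ Metric.ball p r | φ x < 0} := by rw [heq]
    simpa [Metric.mem_ball.1 hx] using this
  have hfr : ∀ q ∈ frontier Ω ∩ Metric.ball p r, φ q ≤ 0 := by
    rintro q ⟨hq, hqb⟩
    by_contra! hpos
    have h1 : ∀ᶠ x in 𝓝 q, 0 < φ x ∧ x ∈ Metric.ball p r :=
      (hφ.continuous.continuousAt.eventually (lt_mem_nhds hpos)).and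
        (Metric.isOpen_ball.mem_nhds hqb)
    have h2 := (mem_closure_iff_frequently.1 (frontier_subset_closure hq))
    obtain ⟨x, hxΩ, hx, hxb⟩ := (h2.and_eventually h1).exists
    exact absurd ((hmem x hxb).1 hxΩ) hx.not_gt
  have hpb : p ∈ Metric.ball p r := Metric.mem_ball_self hr
  have hp0 : φ p = 0 := by
    refine le_antisymm (hfr p ⟨hp, hpb⟩) ?_
    by_contra! hneg
    exact (hΩ.frontier_eq ▸ hp).2 ((hmem p hpb).2 hneg)
  set v := fderiv ℝ φ p with hv
  obtain ⟨e, he, hve⟩ : ∃ e : E, ‖e‖ = 1 ∧ v e < 0 := by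
    obtain ⟨e₀, he₀⟩ : ∃ e₀, v e₀ < 0 := by
      obtain ⟨e₀, he₀⟩ := DFunLike.ne_iff.1 (hne p hpb hp0)
      rcases lt_or_gt_of_ne he₀ with h | h
      · exact ⟨e₀, h⟩
      · exact ⟨-e₀, by simpa using h⟩
    have hne₀ : e₀ ≠ 0 := by rintro rfl; simp at he₀
    have hn : 0 < ‖e₀‖ := norm_pos_iff.2 hne₀
    refine ⟨‖e₀‖⁻¹ • e₀, by simp [norm_smul, hn.ne'], ?_⟩
    rw [map_smul, smul_eq_mul]
    exact mul_neg_of_pos_of_neg (inv_pos.2 hn) he₀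
  set a := -(v e) with ha_def
  have ha : 0 < a := neg_pos.2 hve
  have hstrict : HasStrictFDerivAt φ v p := hφ.contDiffAt.hasStrictFDerivAt (by simp)
  have hev := hstrict.isLittleO.def (show 0 < a / 4 by positivity)
  obtain ⟨ε, hε, hεb⟩ := Metric.eventually_nhds_iff.1 hev
  have hvpos : 0 ≤ ‖v‖ := norm_nonneg _
  set κ := min 1 (a / (4 * (‖v‖ + 1))) with hκ
  have hκ0 : 0 < κ := lt_min one_pos (by positivity)
  have hκ1 : κ ≤ 1 := min_le_left _ _
  have hκv : ‖v‖ * κ ≤ a / 4 := by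
    have h1 : κ ≤ a / (4 * (‖v‖ + 1)) := min_le_right _ _
    rw [le_div_iff₀ (by positivity)] at h1
    nlinarith
  set r' := min ε r with hr'
  have hr'0 : 0 < r' := lt_min hε hr
  refine ⟨κ, r' / 4, hκ0, hκ1, by positivity, Metric.ball p (r' / 2),
    Metric.ball_mem_nhds _ (by positivity), ?_⟩
  rintro q ⟨hq, hqb⟩ t ht htr
  rw [Metric.mem_ball] at hqb
  refine ⟨q + t • e, by simp [norm_smul, he, abs_of_pos ht], fun y hy => ?_⟩
  rw [Metric.mem_ball] at hy
  have hzq : dist (q + t • e) q = t := by simp [norm_smul, he, abs_of_pos ht]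
  have hyq : dist y q ≤ (1 + κ) * t := by
    have := dist_triangle y (q + t • e) q
    linarith
  have hyq2 : dist y q ≤ 2 * t := hyq.trans (by nlinarith)
  have hyp : dist y p < r' := by
    have := dist_triangle y q p
    linarith
  have hφq : φ q ≤ 0 :=
    hfr q ⟨hq, Metric.mem_ball.2 (by linarith [min_le_right ε r])⟩
  have hmain := @hεb (y, q) (by
    rw [Prod.dist_eq]
    exact max_lt (hyp.trans_le (min_le_left _ _)) (by simp only; linarith [min_le_left ε r]))
  simp only [Real.norm_eq_abs] at hmain
  have h3 := (abs_le.1 hmain).2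
  have h4 : v (y - q) ≤ -(a * t) + a / 4 * t := by
    have h5 : v (y - q) = v (y - (q + t • e)) + t * v e := by
      rw [← smul_eq_mul, ← map_smul, ← map_add]; congr 1; abel
    have h6 : v (y - (q + t • e)) ≤ ‖v‖ * (κ * t) := by
      refine (le_abs_self _).trans ((v.le_opNorm _).trans ?_)
      rw [← dist_eq_norm]
      gcongr
    nlinarith
  rw [← dist_eq_norm] at h3
  refine (hmem y (Metric.mem_ball.2 (hyp.trans_le (min_le_right _ _)))).2 ?_
  nlinarith

lemma IsC11Domain.exists_interiorCorkscrew {N : ℕ} {Ω : Set (EuclideanSpace ℝ (Fin N))}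
    (h : IsC11Domain Ω) :
    ∃ κ ρ : ℝ, 0 < κ ∧ κ ≤ 1 ∧ 0 < ρ ∧ InteriorCorkscrew Ω Set.univ κ ρ := by
  obtain ⟨hΩ, hb, hloc⟩ := h
  have hcomp : IsCompact (frontier Ω) :=
    Metric.isCompact_of_isClosed_isBounded isClosed_frontier
      (hb.closure.subset frontier_subset_closure)
  obtain ⟨κ, ρ, h0, h1, h2, h3⟩ : ∃ κ ρ : ℝ, 0 < κ ∧ κ ≤ 1 ∧ 0 < ρ ∧
      InteriorCorkscrew Ω (frontier Ω) κ ρ := by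
    refine hcomp.induction_on (p := fun S => ∃ κ ρ : ℝ, 0 < κ ∧ κ ≤ 1 ∧ 0 < ρ ∧
      InteriorCorkscrew Ω S κ ρ) ⟨1, 1, one_pos, le_rfl, one_pos, fun q hq => hq.2.elim⟩ ?_ ?_ ?_
    · rintro S T hST ⟨κ, ρ, h0, h1, h2, h3⟩
      exact ⟨κ, ρ, h0, h1, h2, h3.mono hST le_rfl le_rfl⟩
    · rintro S T ⟨κ, ρ, h0, h1, h2, h3⟩ ⟨κ', ρ', h0', h1', h2', h3'⟩
      refine ⟨min κ κ', min ρ ρ', lt_min h0 h0', (min_le_left _ _).trans h1, lt_min h2 h2', ?_⟩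
      rintro q ⟨hq, hqS | hqT⟩
      · exact h3.mono subset_rfl (min_le_left _ _) (min_le_left _ _) q ⟨hq, hqS⟩
      · exact h3'.mono subset_rfl (min_le_right _ _) (min_le_right _ _) q ⟨hq, hqT⟩
    · intro p hp
      obtain ⟨r, hr, φ, L, hφ, -, hne, heq⟩ := hloc p hp
      obtain ⟨κ, ρ, h0, h1, h2, U, hU, h3⟩ :=
        exists_interiorCorkscrew_of_defining_function hΩ hp hr hφ hne heq
      exact ⟨U, mem_nhdsWithin_of_mem_nhds hU, κ, ρ, h0, h1, h2, h3⟩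
  exact ⟨κ, ρ, h0, h1, h2, fun q hq => h3 q ⟨hq.1, hq.1⟩⟩

lemma InteriorCorkscrew.volume_frontier_eq_zero {E : Type*} [NormedAddCommGroup E]
    [NormedSpace ℝ E] [FiniteDimensional ℝ E] [MeasureSpace E] [BorelSpace E]
    [(volume : Measure E).IsAddHaarMeasure] {Ω : Set E} {κ ρ : ℝ}
    (hΩ : IsOpen Ω) (hκ : 0 < κ) (hκ1 : κ ≤ 1) (hρ : 0 < ρ)
    (h : InteriorCorkscrew Ω Set.univ κ ρ) : volume (frontier Ω) = 0 := by
  have hae := IsUnifLocDoublingMeasure.ae_tendsto_measure_inter_div (volume : Measure E)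
    (frontier Ω) 1
  have hfalse : ∀ᵐ x ∂(volume.restrict (frontier Ω)), False := by
    filter_upwards [hae, ae_restrict_mem isClosed_frontier.measurableSet] with x hx hxf
    have hlim : Tendsto (fun t : ℝ => 2 * t) (𝓝[>] 0) (𝓝[>] 0) := by
      refine tendsto_nhdsWithin_iff.2 ⟨?_, ?_⟩
      · have : Tendsto (fun t : ℝ => 2 * t) (𝓝 0) (𝓝 (2 * 0)) := tendsto_id.const_mul 2
        simpa using this.mono_left nhdsWithin_le_nhds
      · filter_upwards [self_mem_nhdsWithin] with t ht
        simpa using ht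
    have hten := hx (fun _ => x) (fun t : ℝ => 2 * t) hlim (by
      filter_upwards [self_mem_nhdsWithin] with t ht
      exact Metric.mem_closedBall_self (by simpa using (le_of_lt ht)))
    set θ : ℝ≥0∞ := ENNReal.ofReal ((κ / 2) ^ Module.finrank ℝ E) with hθ
    have hθ0 : θ ≠ 0 := by
      simp only [hθ, ne_eq, ENNReal.ofReal_eq_zero, not_le]; positivity
    have hbound : ∀ᶠ t : ℝ in 𝓝[>] 0, volume (frontier Ω ∩ Metric.closedBall x (2 * t)) /
        volume (Metric.closedBall x (2 * t)) ≤ 1 - θ := by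
      filter_upwards [self_mem_nhdsWithin, nhdsWithin_le_nhds (gt_mem_nhds hρ)] with t ht htρ
      have ht : 0 < t := ht
      obtain ⟨z, hz, hzΩ⟩ := h x ⟨hxf, trivial⟩ t ht htρ
      set B := Metric.closedBall x (2 * t) with hB
      have hsub : Metric.ball z (κ * t) ⊆ B := by
        intro y hy
        rw [Metric.mem_ball] at hy
        have := dist_triangle y z x
        exact Metric.mem_closedBall.2 (by nlinarith)
      have hBpos : volume B ≠ 0 := (Metric.measure_closedBall_pos volume x (by positivity)).ne'
      have hBtop : volume B ≠ ∞ := measure_closedBall_lt_top.ne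
      have hball : volume (Metric.ball z (κ * t)) = θ * volume B := by
        rw [hB, Measure.addHaar_closedBall _ _ (by positivity),
          Measure.addHaar_ball_of_pos _ _ (by positivity), hθ, ← mul_assoc,
          ← ENNReal.ofReal_mul (by positivity), ← mul_pow]
        congr 3; ring
      have hle : volume (frontier Ω ∩ B) ≤ volume B - θ * volume B := by
        rw [← hball, ← measure_sdiff hsub measurableSet_ball.nullMeasurableSet
          measure_ball_lt_top.ne]
        refine measure_mono fun y hy => ⟨hy.2, fun hyz => ?_⟩
        exact (hΩ.frontier_eq ▸ hy.1).2 (hzΩ hyz)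
      calc volume (frontier Ω ∩ B) / volume B ≤ (volume B - θ * volume B) / volume B := by
            gcongr
        _ = 1 - θ := by
            rw [ENNReal.sub_div (fun _ _ => hBpos), ENNReal.div_self hBpos hBtop,
              ENNReal.mul_div_cancel_right hBpos hBtop]
    have := le_of_tendsto hten hbound
    exact absurd this (not_le.2 (ENNReal.sub_lt_self ENNReal.one_ne_top one_ne_zero hθ0))
  simpa [ae_iff] using hfalse

end Corkscrew

section WhitneyAverage

open Metric

/-- A nonnegative bump in `z`, of size comparable to the distance from `x` to `Ω`, concentrated on
those points of `Ω` whose distances to `x` and to `Ωᶜ` are comparable to that distance. -/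
def whitneyBump {E : Type*} [PseudoMetricSpace E] (Ω : Set E) (M : ℝ) (x z : E) : ℝ :=
  max 0 (min (M * infDist x Ω - dist x z) (M * infDist z Ωᶜ - infDist x Ω))

/-- The points of `Ω` whose distances to `x` and to `Ωᶜ` are comparable to the distance from `x`
to `Ω`, with ratio `L`. -/
def whitneyRegion {E : Type*} [PseudoMetricSpace E] (Ω : Set E) (L : ℝ) (x : E) : Set E :=
  {z | dist x z < L * infDist x Ω ∧ infDist x Ω < L * infDist z Ωᶜ}

/-- The points outside `Ω` at positive distance less than `ρ` from it. -/
def outerCollar {E : Type*} [PseudoMetricSpace E] (Ω : Set E) (ρ : ℝ) : Set E :=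
  {x | 0 < infDist x Ω ∧ infDist x Ω < ρ}

section Metric

variable {E : Type*} [PseudoMetricSpace E] {Ω : Set E} {M L ρ : ℝ} {x x' z : E}

lemma whitneyBump_nonneg : 0 ≤ whitneyBump Ω M x z := le_max_left _ _

lemma whitneyBump_le (hM : 0 ≤ M) : whitneyBump Ω M x z ≤ M * infDist x Ω :=
  max_le (mul_nonneg hM infDist_nonneg)
    ((min_le_left _ _).trans (sub_le_self _ dist_nonneg))

lemma whitneyBump_eq_zero (h : z ∉ whitneyRegion Ω M x) : whitneyBump Ω M x z = 0 := by
  refine max_eq_left ?_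
  by_contra! hpos
  have := lt_min_iff.1 hpos
  exact h ⟨by linarith [this.1], by linarith [this.2]⟩

lemma abs_whitneyBump_sub_le (hM : 0 ≤ M) :
    |whitneyBump Ω M x z - whitneyBump Ω M x' z| ≤ (M + 1) * dist x x' := by
  have hd : |infDist x Ω - infDist x' Ω| ≤ dist x x' := by
    have := (lipschitz_infDist_pt Ω).dist_le_mul x x'
    simpa [Real.dist_eq] using this
  have hd0 : 0 ≤ dist x x' := dist_nonneg
  refine (abs_max_sub_max_le_max _ _ _ _).trans (max_le (by simp; positivity) ?_)
  refine (abs_min_sub_min_le_max _ _ _ _).trans (max_le ?_ ?_)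
  · have h1 : |dist x z - dist x' z| ≤ dist x x' := abs_dist_sub_le _ _ _
    calc |M * infDist x Ω - dist x z - (M * infDist x' Ω - dist x' z)|
        = |M * (infDist x Ω - infDist x' Ω) - (dist x z - dist x' z)| := by congr 1; ring
      _ ≤ |M * (infDist x Ω - infDist x' Ω)| + |dist x z - dist x' z| := abs_sub _ _
      _ ≤ M * dist x x' + dist x x' := by
        rw [abs_mul, abs_of_nonneg hM]; gcongr
      _ = _ := by ring
  · calc |M * infDist z Ωᶜ - infDist x Ω - (M * infDist z Ωᶜ - infDist x' Ω)|
        = |infDist x Ω - infDist x' Ω| := by rw [← abs_neg]; congr 1; ring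
      _ ≤ dist x x' := hd
      _ ≤ _ := by nlinarith

lemma continuous_whitneyBump : Continuous fun p : E × E => whitneyBump Ω M p.1 p.2 := by
  have h1 : Continuous fun p : E × E => infDist p.1 Ω := (continuous_infDist_pt Ω).comp continuous_fst
  have h2 : Continuous fun p : E × E => infDist p.2 Ωᶜ :=
    (continuous_infDist_pt Ωᶜ).comp continuous_snd
  unfold whitneyBump
  fun_prop

lemma whitneyRegion_mono (hML : M ≤ L) : whitneyRegion Ω M x ⊆ whitneyRegion Ω L x :=
  fun _ hz => ⟨hz.1.trans_le (by gcongr; exact infDist_nonneg),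
    hz.2.trans_le (by gcongr; exact infDist_nonneg)⟩

lemma whitneyRegion_subset_of_dist_lt (hM : 1 ≤ M) (h : dist x x' < infDist x Ω / 2) :
    whitneyRegion Ω M x' ⊆ whitneyRegion Ω (2 * M) x := by
  have hd : |infDist x Ω - infDist x' Ω| ≤ dist x x' := by
    have := (lipschitz_infDist_pt Ω).dist_le_mul x x'
    simpa [Real.dist_eq] using this
  obtain ⟨h1, h2⟩ := abs_le.1 hd
  rintro z ⟨hz1, hz2⟩
  have := dist_triangle x x' z
  refine ⟨?_, by linarith⟩
  have h3 : M * infDist x' Ω ≤ M * (3 / 2 * infDist x Ω) := by gcongr; linarith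
  have h4 : infDist x Ω ≤ M * infDist x Ω := le_mul_of_one_le_left infDist_nonneg hM
  linarith

lemma whitneyRegion_subset : whitneyRegion Ω L x ⊆ Ω := by
  rintro z ⟨-, hz⟩
  by_contra hzΩ
  rw [infDist_zero_of_mem (s := Ωᶜ) hzΩ, mul_zero] at hz
  exact absurd infDist_nonneg hz.not_ge

lemma isOpen_prod_whitneyRegion : IsOpen {p : E × E | p.2 ∈ whitneyRegion Ω L p.1} := by
  have h1 : Continuous fun p : E × E => infDist p.1 Ω := (continuous_infDist_pt Ω).comp continuous_fst
  have h2 : Continuous fun p : E × E => infDist p.2 Ωᶜ :=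
    (continuous_infDist_pt Ωᶜ).comp continuous_snd
  have e : {p : E × E | p.2 ∈ whitneyRegion Ω L p.1} =
      {p | dist p.1 p.2 < L * infDist p.1 Ω} ∩ {p | infDist p.1 Ω < L * infDist p.2 Ωᶜ} := rfl
  rw [e]
  exact (isOpen_lt (by fun_prop) (by fun_prop)).inter (isOpen_lt (by fun_prop) (by fun_prop))

lemma isOpen_whitneyRegion : IsOpen (whitneyRegion Ω L x) :=
  isOpen_prod_whitneyRegion.preimage (f := fun z => (x, z)) (by fun_prop)

lemma isOpen_outerCollar : IsOpen (outerCollar Ω ρ) :=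
  (isOpen_lt continuous_const (continuous_infDist_pt Ω)).inter
    (isOpen_lt (continuous_infDist_pt Ω) continuous_const)

lemma disjoint_outerCollar : Disjoint Ω (outerCollar Ω ρ) :=
  Set.disjoint_left.2 fun _ hx hx' => hx'.1.ne' (infDist_zero_of_mem hx)

end Metric

variable {E : Type*} [NormedAddCommGroup E] [NormedSpace ℝ E] [FiniteDimensional ℝ E]
  [MeasureSpace E] [BorelSpace E] [(volume : Measure E).IsAddHaarMeasure]

/-- The normalised indicator of the Whitney region. -/
def whitneyKernel (Ω : Set E) (L : ℝ) (x z : E) : ℝ≥0∞ :=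
  (whitneyRegion Ω L x).indicator
    (fun _ => (ENNReal.ofReal (infDist x Ω) ^ Module.finrank ℝ E)⁻¹) z

/-- The weighted average of `w` over the Whitney region of `x`. -/
def whitneyAverage (Ω : Set E) (M : ℝ) (w : E → ℝ) (x : E) : ℝ :=
  (∫ z in Ω, w z * whitneyBump Ω M x z) / ∫ z in Ω, whitneyBump Ω M x z

variable {Ω : Set E} {M L ρ c κ : ℝ} {w : E → ℝ}

lemma measurable_whitneyKernel :
    Measurable fun p : E × E => whitneyKernel Ω L p.1 p.2 := by
  have : (fun p : E × E => whitneyKernel Ω L p.1 p.2) =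
      {p : E × E | p.2 ∈ whitneyRegion Ω L p.1}.indicator
        (fun p => (ENNReal.ofReal (infDist p.1 Ω) ^ Module.finrank ℝ E)⁻¹) := by
    ext p; simp [whitneyKernel, Set.indicator]
  rw [this]
  refine Measurable.indicator ?_ isOpen_prod_whitneyRegion.measurableSet
  have h1 : Measurable fun p : E × E => infDist p.1 Ω :=
    ((continuous_infDist_pt Ω).comp continuous_fst).measurable
  fun_prop

lemma measurable_whitneyAverage (hw : Measurable w) : Measurable (whitneyAverage Ω M w) := by
  have h : StronglyMeasurable fun p : E × E => whitneyBump Ω M p.1 p.2 :=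
    continuous_whitneyBump.stronglyMeasurable
  have h' : StronglyMeasurable fun p : E × E => w p.2 * whitneyBump Ω M p.1 p.2 :=
    (hw.comp measurable_snd).stronglyMeasurable.mul h
  exact (h'.integral_prod_right (ν := volume.restrict Ω)).measurable.div
    (h.integral_prod_right (ν := volume.restrict Ω)).measurable

lemma sq_lintegral_le_measure_mul {α : Type*} [MeasurableSpace α] {μ : Measure α}
    {f : α → ℝ≥0∞} (hf : AEMeasurable f μ) :
    (∫⁻ a, f a ∂μ) ^ 2 ≤ μ Set.univ * ∫⁻ a, f a ^ 2 ∂μ := by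
  have h := ENNReal.lintegral_mul_le_Lp_mul_Lq μ Real.HolderConjugate.two_two
    (aemeasurable_const (b := (1 : ℝ≥0∞))) hf
  simp only [Pi.mul_apply, one_mul, ENNReal.one_rpow, lintegral_const] at h
  calc (∫⁻ a, f a ∂μ) ^ 2 ≤ (μ Set.univ ^ (1 / 2 : ℝ) * (∫⁻ a, f a ^ (2 : ℝ) ∂μ) ^ (1 / 2 : ℝ)) ^ 2 := by
        gcongr
    _ = _ := by
        rw [mul_pow, ← ENNReal.rpow_natCast, ← ENNReal.rpow_natCast, ← ENNReal.rpow_mul,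
          ← ENNReal.rpow_mul]
        simp

lemma volume_whitneyRegion_le (hL : 0 < L) {x : E} (hx : 0 < infDist x Ω) :
    volume (whitneyRegion Ω L x) ≤ ENNReal.ofReal (L ^ Module.finrank ℝ E) * volume (ball (0 : E) 1) *
      ENNReal.ofReal (infDist x Ω) ^ Module.finrank ℝ E := by
  calc volume (whitneyRegion Ω L x) ≤ volume (ball x (L * infDist x Ω)) :=
        measure_mono fun z hz => by rw [mem_ball, dist_comm]; exact hz.1
    _ = _ := by
      rw [Measure.addHaar_ball_of_pos _ _ (by positivity), mul_pow,
        ENNReal.ofReal_mul (by positivity), ENNReal.ofReal_pow (p := infDist x Ω) hx.le]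
      ring

/-- Cauchy-Schwarz estimate for averages against a density supported in a Whitney region. -/
lemma sq_enorm_integral_mul_le (hL : 0 < L) (hw : Measurable w) {x : E} (hx : 0 < infDist x Ω)
    {h : E → ℝ} {B m : ℝ} (hB : 0 ≤ B) (hm : 0 ≤ m) (a : ℝ)
    (hh : ∀ z, |h z| ≤ B * m * (infDist x Ω ^ Module.finrank ℝ E)⁻¹)
    (hh0 : ∀ z ∉ whitneyRegion Ω L x, h z = 0) :
    ‖∫ z in Ω, (w z - a) * h z‖ₑ ^ 2 ≤
      ENNReal.ofReal B ^ 2 * (ENNReal.ofReal (L ^ Module.finrank ℝ E) * volume (ball (0 : E) 1)) *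
        ENNReal.ofReal m ^ 2 * ∫⁻ z in Ω, whitneyKernel Ω L x z * ‖w z - a‖ₑ ^ 2 := by
  set n := Module.finrank ℝ E
  set A := whitneyRegion Ω L x with hA
  set D := ENNReal.ofReal (infDist x Ω) ^ n with hD
  have hD0 : D ≠ 0 := by
    simpa [hD] using fun h => absurd h hx.not_ge
  have hDt : D ≠ ∞ := by simp [hD]
  have hAm : MeasurableSet A := isOpen_whitneyRegion.measurableSet
  have hAΩ : A ⊆ Ω := whitneyRegion_subset
  set H : ℝ≥0∞ := ENNReal.ofReal B * ENNReal.ofReal m * D⁻¹ with hH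
  have hHle : ∀ z, ‖h z‖ₑ ≤ H := fun z => by
    rw [← ofReal_norm, Real.norm_eq_abs]
    refine (ENNReal.ofReal_le_ofReal (hh z)).trans (le_of_eq ?_)
    rw [ENNReal.ofReal_mul (by positivity), ENNReal.ofReal_mul hB,
      ENNReal.ofReal_inv_of_pos (by positivity), ENNReal.ofReal_pow hx.le]
  have h1 : ‖∫ z in Ω, (w z - a) * h z‖ₑ ≤ H * ∫⁻ z in A, ‖w z - a‖ₑ := by
    calc ‖∫ z in Ω, (w z - a) * h z‖ₑ ≤ ∫⁻ z in Ω, ‖(w z - a) * h z‖ₑ :=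
          enorm_integral_le_lintegral_enorm _
      _ ≤ ∫⁻ z in Ω, A.indicator (fun z => H * ‖w z - a‖ₑ) z := by
          refine lintegral_mono fun z => ?_
          by_cases hz : z ∈ A
          · rw [Set.indicator_of_mem hz, enorm_mul, mul_comm]
            gcongr
            exact hHle z
          · simp [hh0 z hz]
      _ = ∫⁻ z in A, H * ‖w z - a‖ₑ := by
          rw [lintegral_indicator hAm, Measure.restrict_restrict hAm,
            Set.inter_eq_left.2 hAΩ]
      _ = _ := lintegral_const_mul _ (by fun_prop)
  have h2 : (∫⁻ z in A, ‖w z - a‖ₑ) ^ 2 ≤ volume A * ∫⁻ z in A, ‖w z - a‖ₑ ^ 2 := by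
    simpa using sq_lintegral_le_measure_mul (μ := volume.restrict A)
      (f := fun z => ‖w z - a‖ₑ) (by fun_prop)
  have h3 : ∫⁻ z in Ω, whitneyKernel Ω L x z * ‖w z - a‖ₑ ^ 2 =
      D⁻¹ * ∫⁻ z in A, ‖w z - a‖ₑ ^ 2 := by
    rw [← lintegral_const_mul _ (by fun_prop)]
    have : ∀ z, whitneyKernel Ω L x z * ‖w z - a‖ₑ ^ 2 =
        A.indicator (fun z => D⁻¹ * ‖w z - a‖ₑ ^ 2) z := fun z => by
      by_cases hz : z ∈ A
      · rw [Set.indicator_of_mem hz, whitneyKernel, Set.indicator_of_mem hz]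
      · rw [Set.indicator_of_notMem hz, whitneyKernel, Set.indicator_of_notMem hz, zero_mul]
    simp only [this]
    rw [lintegral_indicator hAm, Measure.restrict_restrict hAm, Set.inter_eq_left.2 hAΩ]
  rw [h3]
  calc ‖∫ z in Ω, (w z - a) * h z‖ₑ ^ 2 ≤ (H * ∫⁻ z in A, ‖w z - a‖ₑ) ^ 2 := by gcongr
    _ = H ^ 2 * (∫⁻ z in A, ‖w z - a‖ₑ) ^ 2 := by rw [mul_pow]
    _ ≤ H ^ 2 * ((ENNReal.ofReal (L ^ n) * volume (ball (0 : E) 1) * D) *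
          ∫⁻ z in A, ‖w z - a‖ₑ ^ 2) := by
        gcongr
        refine h2.trans ?_
        gcongr
        exact volume_whitneyRegion_le hL hx
    _ = ENNReal.ofReal B ^ 2 * (ENNReal.ofReal (L ^ n) * volume (ball (0 : E) 1)) *
          ENNReal.ofReal m ^ 2 * (D⁻¹ * ∫⁻ z in A, ‖w z - a‖ₑ ^ 2) * (D⁻¹ * D) := by
        rw [hH]; ring
    _ = _ := by rw [ENNReal.inv_mul_cancel hD0 hDt, mul_one]

lemma integrable_mul_whitneyBump {x : E} (hM : 0 ≤ M) {f : E → ℝ} (hf : IntegrableOn f Ω) :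
    IntegrableOn (fun z => f z * whitneyBump Ω M x z) Ω := by
  refine Integrable.mul_bdd (c := M * infDist x Ω) hf ?_ ?_
  · exact (continuous_whitneyBump.comp (by fun_prop : Continuous fun z : E => (x, z))).aestronglyMeasurable
  · exact Eventually.of_forall fun z => by
      rw [Real.norm_of_nonneg whitneyBump_nonneg]; exact whitneyBump_le hM

lemma integral_sub_mul_whitneyBump {x : E} (hM : 0 ≤ M) (hΩ : volume Ω ≠ ∞)
    (hw : IntegrableOn w Ω) (a : ℝ) :
    ∫ z in Ω, (w z - a) * whitneyBump Ω M x z =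
      (∫ z in Ω, w z * whitneyBump Ω M x z) - a * ∫ z in Ω, whitneyBump Ω M x z := by
  rw [← integral_const_mul, ← integral_sub (integrable_mul_whitneyBump hM hw)
    (integrable_mul_whitneyBump hM (integrableOn_const hΩ))]
  simp only [sub_mul]

lemma sq_enorm_whitneyAverage_sub_le (hM : 1 ≤ M) (hΩ : volume Ω ≠ ∞) (hw : Measurable w)
    (hwi : IntegrableOn w Ω) (hc : 0 < c) {x : E} (hx : 0 < infDist x Ω)
    (hG : c * infDist x Ω ^ (Module.finrank ℝ E + 1) ≤ ∫ z in Ω, whitneyBump Ω M x z) (a : ℝ) :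
    ‖whitneyAverage Ω M w x - a‖ₑ ^ 2 ≤
      ENNReal.ofReal ((M + 1) / c) ^ 2 *
        (ENNReal.ofReal ((2 * M) ^ Module.finrank ℝ E) * volume (ball (0 : E) 1)) *
        ∫⁻ z in Ω, whitneyKernel Ω (2 * M) x z * ‖w z - a‖ₑ ^ 2 := by
  have hM0 : 0 ≤ M := by linarith
  set G := ∫ z in Ω, whitneyBump Ω M x z with hGdef
  have hG0 : 0 < G := lt_of_lt_of_le (by positivity) hG
  have hrepr : whitneyAverage Ω M w x - a = ∫ z in Ω, (w z - a) * (whitneyBump Ω M x z / G) := by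
    simp only [← mul_div_assoc]
    rw [integral_div, integral_sub_mul_whitneyBump hM0 hΩ hwi, whitneyAverage, ← hGdef]
    field_simp
  rw [hrepr]
  have := sq_enorm_integral_mul_le (L := 2 * M) (B := (M + 1) / c) (m := 1) (by linarith) hw hx
    (h := fun z => whitneyBump Ω M x z / G) (by positivity) zero_le_one a (fun z => ?_)
    (fun z hz => ?_)
  · simpa using this
  · rw [abs_div, abs_of_pos hG0, abs_of_nonneg whitneyBump_nonneg]
    calc whitneyBump Ω M x z / G
        ≤ ((M + 1) * infDist x Ω) / (c * infDist x Ω ^ (Module.finrank ℝ E + 1)) := by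
          gcongr
          exact (whitneyBump_le hM0).trans (by gcongr; linarith)
      _ = _ := by field_simp; ring
  · rw [whitneyBump_eq_zero fun h => hz (whitneyRegion_mono (by linarith) h), zero_div]

lemma sq_enorm_whitneyAverage_sub_whitneyAverage_le (hM : 1 ≤ M) (hΩ : volume Ω ≠ ∞)
    (hw : Measurable w) (hwi : IntegrableOn w Ω) (hc : 0 < c) {x x' : E} (hx : 0 < infDist x Ω)
    (hG : c * infDist x Ω ^ (Module.finrank ℝ E + 1) ≤ ∫ z in Ω, whitneyBump Ω M x z)
    (hG' : ∫ z in Ω, whitneyBump Ω M x' z ≠ 0) (hxx' : dist x x' < infDist x Ω / 2) :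
    ‖whitneyAverage Ω M w x - whitneyAverage Ω M w x'‖ₑ ^ 2 ≤
      ENNReal.ofReal ((M + 1) / c) ^ 2 *
        (ENNReal.ofReal ((2 * M) ^ Module.finrank ℝ E) * volume (ball (0 : E) 1)) *
        ENNReal.ofReal (dist x x' / infDist x Ω) ^ 2 *
        ∫⁻ z in Ω, whitneyKernel Ω (2 * M) x z * ‖w z - whitneyAverage Ω M w x'‖ₑ ^ 2 := by
  have hM0 : 0 ≤ M := by linarith
  set a := whitneyAverage Ω M w x' with ha
  set G := ∫ z in Ω, whitneyBump Ω M x z with hGdef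
  have hG0 : 0 < G := lt_of_lt_of_le (by positivity) hG
  have hzero : ∫ z in Ω, (w z - a) * whitneyBump Ω M x' z = 0 := by
    rw [integral_sub_mul_whitneyBump hM0 hΩ hwi, ha, whitneyAverage, div_mul_cancel₀ _ hG',
      sub_self]
  have hwa : IntegrableOn (fun z => w z - a) Ω := hwi.sub (integrableOn_const hΩ)
  have hrepr : whitneyAverage Ω M w x - a =
      ∫ z in Ω, (w z - a) * ((whitneyBump Ω M x z - whitneyBump Ω M x' z) / G) := by
    simp only [← mul_div_assoc, mul_sub]
    rw [integral_div, integral_sub (integrable_mul_whitneyBump hM0 hwa)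
      (integrable_mul_whitneyBump hM0 hwa), hzero, sub_zero,
      integral_sub_mul_whitneyBump hM0 hΩ hwi, whitneyAverage, ← hGdef]
    field_simp
  rw [hrepr]
  refine sq_enorm_integral_mul_le (L := 2 * M) (B := (M + 1) / c)
    (m := dist x x' / infDist x Ω) (by linarith) hw hx
    (h := fun z => (whitneyBump Ω M x z - whitneyBump Ω M x' z) / G) (by positivity)
    (by positivity) a (fun z => ?_) (fun z hz => ?_)
  · rw [abs_div, abs_of_pos hG0]
    calc |whitneyBump Ω M x z - whitneyBump Ω M x' z| / G
        ≤ ((M + 1) * dist x x') / (c * infDist x Ω ^ (Module.finrank ℝ E + 1)) := by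
          gcongr
          exact abs_whitneyBump_sub_le hM0
      _ = _ := by field_simp; ring
  · rw [whitneyBump_eq_zero fun h => hz (whitneyRegion_mono (by linarith) h),
      whitneyBump_eq_zero fun h => hz (whitneyRegion_subset_of_dist_lt hM hxx' h), sub_self,
      zero_div]

/-- Under the interior corkscrew condition the Whitney bump has mass of the maximal order. -/
lemma InteriorCorkscrew.exists_le_integral_whitneyBump (hΩb : volume Ω ≠ ∞)
    (hne : Ω.Nonempty) (hnu : Ωᶜ.Nonempty) (hκ : 0 < κ) (hκ1 : κ ≤ 1)
    (h : InteriorCorkscrew Ω Set.univ κ ρ) :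
    ∃ M c : ℝ, 1 ≤ M ∧ 0 < c ∧ ∀ x ∈ outerCollar Ω ρ,
      c * infDist x Ω ^ (Module.finrank ℝ E + 1) ≤ ∫ z in Ω, whitneyBump Ω M x z := by
  have hM4 : 4 ≤ 4 / κ := by rw [le_div_iff₀ hκ]; linarith
  refine ⟨4 / κ, (κ / 2) ^ Module.finrank ℝ E * volume.real (ball (0 : E) 1), by linarith,
    mul_pos (by positivity) ?_, ?_⟩
  · exact ENNReal.toReal_pos (measure_ball_pos volume 0 one_pos).ne' measure_ball_lt_top.ne
  rintro x ⟨hx, hxρ⟩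
  set t := infDist x Ω with ht
  have hxc : x ∉ closure Ω := fun hxc => hx.ne' ((mem_closure_iff_infDist_zero hne).1 hxc)
  obtain ⟨q, hq, hqd⟩ := exists_mem_frontier_infDist_compl_eq_dist (s := (closure Ω)ᶜ) hxc
    (by simpa [Set.compl_univ_iff] using (hne.mono subset_closure).ne_empty)
  rw [compl_compl, infDist_closure, ← ht] at hqd
  rw [frontier_compl] at hq
  obtain ⟨z, hz, hzΩ⟩ := h q ⟨frontier_closure_subset hq, trivial⟩ t hx hxρ
  have hlow : ∀ y ∈ ball z (κ / 2 * t), t ≤ whitneyBump Ω (4 / κ) x y := by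
    intro y hy
    rw [mem_ball] at hy
    have h1 : κ / 2 * t ≤ infDist y Ωᶜ := by
      refine (le_infDist hnu).2 fun v hv => ?_
      by_contra! hlt
      refine hv (hzΩ ?_)
      have := dist_triangle v y z
      rw [dist_comm v y] at this
      rw [mem_ball]; linarith
    have h2 : dist x y ≤ 3 * t := by
      have h3 := dist_triangle4 x q z y
      rw [dist_comm q z, dist_comm z y] at h3
      nlinarith
    refine le_max_of_le_right (le_min ?_ ?_)
    · nlinarith
    · have : 4 / κ * (κ / 2 * t) ≤ 4 / κ * infDist y Ωᶜ := by gcongr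
      have h5 : 4 / κ * (κ / 2 * t) = 2 * t := by field_simp; ring
      linarith
  have hballsub : ball z (κ / 2 * t) ⊆ Ω :=
    (ball_subset_ball (by nlinarith)).trans hzΩ
  have hint : IntegrableOn (fun y => whitneyBump Ω (4 / κ) x y) Ω := by
    simpa using integrable_mul_whitneyBump (x := x) (M := 4 / κ) (by positivity)
      (integrableOn_const hΩb (C := (1 : ℝ)))
  calc _ = ∫ y in ball z (κ / 2 * t), t := by
        rw [setIntegral_const, smul_eq_mul]
        simp only [Measure.real]
        rw [Measure.addHaar_ball_of_pos volume z (r := κ / 2 * t) (by positivity),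
          ENNReal.toReal_mul, ENNReal.toReal_ofReal (by positivity)]
        ring
    _ ≤ ∫ y in ball z (κ / 2 * t), whitneyBump Ω (4 / κ) x y :=
        setIntegral_mono_on (integrableOn_const measure_ball_lt_top.ne) (hint.mono_set hballsub)
          measurableSet_ball hlow
    _ ≤ _ := setIntegral_mono_set hint (Eventually.of_forall fun _ => whitneyBump_nonneg)
        (Eventually.of_forall hballsub)

end WhitneyAverage

section WhitneyEstimates

open Metric

variable {E : Type*} [NormedAddCommGroup E] [NormedSpace ℝ E] [FiniteDimensional ℝ E]
  [MeasureSpace E] [BorelSpace E] [(volume : Measure E).IsAddHaarMeasure]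
  {Ω : Set E} {L ρ s γ : ℝ}

lemma norm_le_of_mem_whitneyRegion (hL : 0 ≤ L) {x z : E} (hx : infDist x Ω ≤ ‖x‖)
    (hz : z ∈ whitneyRegion Ω L x) : ‖z‖ ≤ (1 + L) * ‖x‖ := by
  have h1 : ‖z‖ ≤ ‖x‖ + dist x z := by
    rw [dist_comm, dist_eq_norm]
    simpa using norm_add_le x (z - x)
  have h2 := hz.1
  nlinarith

lemma norm_sub_le_of_mem_whitneyRegion (hL : 0 ≤ L) {x y z : E}
    (hxy : infDist x Ω / 2 ≤ dist x y) (hz : z ∈ whitneyRegion Ω L x) :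
    ‖z - y‖ ≤ (2 * L + 1) * ‖x - y‖ := by
  rw [← dist_eq_norm, ← dist_eq_norm]
  have h1 := dist_triangle z x y
  rw [dist_comm z x] at h1
  have h2 := hz.1
  nlinarith

lemma whitneyKernel_of_notMem {x z : E} (h : z ∉ whitneyRegion Ω L x) :
    whitneyKernel Ω L x z = 0 := Set.indicator_of_notMem h _

lemma whitneyKernel_le {x z : E} {r : ℝ} (h : z ∈ whitneyRegion Ω L x → r ≤ infDist x Ω) :
    whitneyKernel Ω L x z ≤ (ENNReal.ofReal r ^ Module.finrank ℝ E)⁻¹ := by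
  by_cases hz : z ∈ whitneyRegion Ω L x
  · rw [whitneyKernel, Set.indicator_of_mem hz]
    gcongr
    exact h hz
  · rw [whitneyKernel_of_notMem hz]; exact zero_le

/-- Schur-type bound for the Whitney kernel. -/
lemma lintegral_whitneyKernel_le (hL : 0 < L) (z : E) :
    ∫⁻ x in outerCollar Ω ρ, whitneyKernel Ω L x z ≤
      ENNReal.ofReal ((L ^ 3) ^ Module.finrank ℝ E) * volume (ball (0 : E) 1) := by
  set δ := infDist z Ωᶜ with hδ
  rcases (infDist_nonneg : 0 ≤ infDist z Ωᶜ).eq_or_lt with h0 | h0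
  · have : ∀ x, whitneyKernel Ω L x z = 0 := fun x =>
      whitneyKernel_of_notMem fun hz => by
        have := hz.2
        rw [← h0, mul_zero] at this
        exact absurd infDist_nonneg this.not_ge
    simp [this]
  have hδ0 : δ ≠ 0 := h0.ne'
  have hpt : ∀ x ∈ outerCollar Ω ρ, whitneyKernel Ω L x z ≤
      (ball z (L ^ 2 * δ)).indicator
        (fun _ => (ENNReal.ofReal (δ / L) ^ Module.finrank ℝ E)⁻¹) x := by
    intro x hx
    by_cases hz : z ∈ whitneyRegion Ω L x
    · have hxΩ : x ∈ Ωᶜ := fun h => hx.1.ne' (infDist_zero_of_mem h)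
      have h1 : δ ≤ dist x z := by rw [dist_comm]; exact infDist_le_dist_of_mem hxΩ
      have h2 := hz.1
      have h3 : infDist x Ω < L * δ := hz.2
      rw [Set.indicator_of_mem]
      · refine whitneyKernel_le fun _ => ?_
        rw [div_le_iff₀ hL]; linarith
      · rw [mem_ball]; nlinarith
    · rw [whitneyKernel_of_notMem hz]; exact zero_le
  calc ∫⁻ x in outerCollar Ω ρ, whitneyKernel Ω L x z
      ≤ ∫⁻ x in outerCollar Ω ρ, (ball z (L ^ 2 * δ)).indicator
        (fun _ => (ENNReal.ofReal (δ / L) ^ Module.finrank ℝ E)⁻¹) x :=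
        setLIntegral_mono' isOpen_outerCollar.measurableSet hpt
    _ ≤ ∫⁻ x, (ball z (L ^ 2 * δ)).indicator
        (fun _ => (ENNReal.ofReal (δ / L) ^ Module.finrank ℝ E)⁻¹) x := setLIntegral_le_lintegral _ _
    _ = (ENNReal.ofReal (δ / L) ^ Module.finrank ℝ E)⁻¹ * volume (ball z (L ^ 2 * δ)) := by
        rw [lintegral_indicator measurableSet_ball, setLIntegral_const]
    _ = _ := by
        rw [Measure.addHaar_ball_of_pos _ _ (by positivity), ← mul_assoc,
          ← ENNReal.ofReal_pow (by positivity), ← ENNReal.ofReal_inv_of_pos (by positivity),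
          ← ENNReal.ofReal_mul (by positivity)]
        congr 2
        rw [← inv_pow, ← mul_pow]
        congr 1
        field_simp

lemma exists_lintegral_near_le (hs1 : s < 1) (hs0 : 0 < s) (hd : 0 < Module.finrank ℝ E)
    (hL : 0 < L) :
    ∃ C : ℝ≥0∞, C ≠ ∞ ∧ ∀ y ∈ outerCollar Ω ρ, ∀ z : E,
      ∫⁻ x in outerCollar Ω ρ, {x | dist x y < infDist x Ω / 2}.indicator
        (fun x => ENNReal.ofReal (dist x y / infDist x Ω) ^ 2 * whitneyKernel Ω L x z *
          ‖x - y‖ₑ ^ (-((Module.finrank ℝ E : ℝ) + 2 * s))) x ≤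
      C * ‖z - y‖ₑ ^ (-((Module.finrank ℝ E : ℝ) + 2 * s)) := by
  set n := Module.finrank ℝ E with hn
  set β : ℝ := (n : ℝ) + 2 * s with hβ
  have hβ0 : 0 ≤ β := by positivity
  obtain ⟨C₁, hC₁, h₁⟩ := exists_lintegral_ball_enorm_rpow_le (E := E) (a := 2 - β) hd
    (by rw [← hn, hβ]; linarith)
  refine ⟨C₁ * ENNReal.ofReal (2 ^ n * 4) * ENNReal.ofReal (2 * L + 1) ^ β,
    ENNReal.mul_ne_top (ENNReal.mul_ne_top hC₁ ENNReal.ofReal_ne_top) (by simp [hβ0]), fun y hy z => ?_⟩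
  set t := infDist y Ω with ht
  have ht0 : 0 < t := hy.1
  have hcomp : ∀ x, dist x y < infDist x Ω / 2 → t / 2 ≤ infDist x Ω ∧ infDist x Ω < 2 * t := by
    intro x hx
    have hd : |infDist x Ω - infDist y Ω| ≤ dist x y := by
      have := (lipschitz_infDist_pt Ω).dist_le_mul x y
      simpa [Real.dist_eq] using this
    obtain ⟨h1, h2⟩ := abs_le.1 hd
    constructor <;> linarith
  by_cases hzy : ‖z - y‖ ≤ (2 * L + 1) * t
  swap
  · have hzero : ∀ x, {x | dist x y < infDist x Ω / 2}.indicator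
        (fun x => ENNReal.ofReal (dist x y / infDist x Ω) ^ 2 * whitneyKernel Ω L x z *
          ‖x - y‖ₑ ^ (-β)) x = 0 := by
      intro x
      refine Set.indicator_apply_eq_zero.2 fun hx => ?_
      rw [whitneyKernel_of_notMem, mul_zero, zero_mul]
      intro hz
      have h1 := dist_triangle z x y
      rw [dist_comm z x] at h1
      have h2 := hz.1
      have h3 := (hcomp x hx).2
      have h4 : dist x y < infDist x Ω / 2 := hx
      rw [← dist_eq_norm] at hzy
      nlinarith
    simp [hzero]
  have hpt : ∀ x, {x | dist x y < infDist x Ω / 2}.indicator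
        (fun x => ENNReal.ofReal (dist x y / infDist x Ω) ^ 2 * whitneyKernel Ω L x z *
          ‖x - y‖ₑ ^ (-β)) x ≤ (ball y t).indicator (fun x =>
          ENNReal.ofReal ((2 / t) ^ 2 * ((t / 2) ^ n)⁻¹) * ‖x - y‖ₑ ^ (2 - β)) x := by
    intro x
    by_cases hx : dist x y < infDist x Ω / 2
    · obtain ⟨h1, h2⟩ := hcomp x hx
      have hxb : x ∈ ball y t := by rw [mem_ball]; linarith
      rw [Set.indicator_of_mem (by exact hx), Set.indicator_of_mem hxb]
      have e1 : ENNReal.ofReal (dist x y / infDist x Ω) ≤ ENNReal.ofReal (2 / t) * ‖x - y‖ₑ := by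
        rw [← ofReal_norm, ← ENNReal.ofReal_mul (by positivity), ← dist_eq_norm]
        refine ENNReal.ofReal_le_ofReal ?_
        rw [div_le_iff₀ (by linarith)]
        calc dist x y = 2 / t * dist x y * (t / 2) := by field_simp
          _ ≤ _ := by gcongr
      have e2 : whitneyKernel Ω L x z ≤ ENNReal.ofReal (((t / 2) ^ n)⁻¹) := by
        rw [ENNReal.ofReal_inv_of_pos (by positivity), ENNReal.ofReal_pow (by positivity)]
        exact whitneyKernel_le fun _ => h1
      have e3 : ‖x - y‖ₑ ^ 2 * ‖x - y‖ₑ ^ (-β) ≤ ‖x - y‖ₑ ^ (2 - β) := by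
        rcases eq_or_ne ‖x - y‖ₑ 0 with h | h
        · simp [h]
        · rw [← ENNReal.rpow_two, ← ENNReal.rpow_add _ _ h (by simp), sub_eq_add_neg (2 : ℝ)]
      calc ENNReal.ofReal (dist x y / infDist x Ω) ^ 2 * whitneyKernel Ω L x z * ‖x - y‖ₑ ^ (-β)
          ≤ (ENNReal.ofReal (2 / t) * ‖x - y‖ₑ) ^ 2 * ENNReal.ofReal (((t / 2) ^ n)⁻¹) *
            ‖x - y‖ₑ ^ (-β) := by
            refine mul_le_mul' (mul_le_mul' ?_ e2) le_rfl
            gcongr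
        _ = ENNReal.ofReal ((2 / t) ^ 2 * ((t / 2) ^ n)⁻¹) *
            (‖x - y‖ₑ ^ 2 * ‖x - y‖ₑ ^ (-β)) := by
            rw [ENNReal.ofReal_mul (by positivity), ENNReal.ofReal_pow (by positivity)]; ring
        _ ≤ _ := by gcongr
    · rw [Set.indicator_of_notMem (by exact hx)]; exact zero_le
  have hreal : (2 / t) ^ 2 * ((t / 2) ^ n)⁻¹ * t ^ ((n : ℝ) + (2 - β)) =
      2 ^ n * 4 * t ^ (-β) := by
    have h1 : t ^ ((n : ℝ) + (2 - β)) = t ^ 2 * t ^ n * t ^ (-β) := by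
      rw [← Real.rpow_two, ← Real.rpow_natCast t n, ← Real.rpow_add ht0, ← Real.rpow_add ht0]
      congr 1; ring
    rw [h1, div_pow, div_pow]
    field_simp
    norm_num
  calc _ ≤ ∫⁻ x in outerCollar Ω ρ, (ball y t).indicator (fun x =>
          ENNReal.ofReal ((2 / t) ^ 2 * ((t / 2) ^ n)⁻¹) * ‖x - y‖ₑ ^ (2 - β)) x :=
        lintegral_mono hpt
    _ ≤ ∫⁻ x, (ball y t).indicator (fun x =>
          ENNReal.ofReal ((2 / t) ^ 2 * ((t / 2) ^ n)⁻¹) * ‖x - y‖ₑ ^ (2 - β)) x :=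
        setLIntegral_le_lintegral _ _
    _ = ENNReal.ofReal ((2 / t) ^ 2 * ((t / 2) ^ n)⁻¹) * ∫⁻ x in ball y t, ‖x - y‖ₑ ^ (2 - β) := by
        rw [lintegral_indicator measurableSet_ball, lintegral_const_mul _ (by fun_prop)]
    _ ≤ ENNReal.ofReal ((2 / t) ^ 2 * ((t / 2) ^ n)⁻¹) *
          (C₁ * ENNReal.ofReal t ^ ((n : ℝ) + (2 - β))) := by
        gcongr
        exact h₁ y t ht0
    _ = C₁ * ENNReal.ofReal (2 ^ n * 4) * ENNReal.ofReal t ^ (-β) := by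
        rw [ENNReal.ofReal_rpow_of_pos ht0, ENNReal.ofReal_rpow_of_pos ht0, mul_left_comm,
          ← ENNReal.ofReal_mul (by positivity), hreal, ENNReal.ofReal_mul (by positivity),
          mul_assoc]
    _ ≤ C₁ * ENNReal.ofReal (2 ^ n * 4) * (ENNReal.ofReal (2 * L + 1) ^ β * ‖z - y‖ₑ ^ (-β)) := by
        refine mul_le_mul' le_rfl ?_
        have := enorm_rpow_neg_le (x := t) (z := z - y) (c := 2 * L + 1) (a := β) (by positivity)
          hβ0 (by rwa [Real.norm_of_nonneg ht0.le])
        rwa [Real.enorm_of_nonneg ht0.le] at this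
    _ = _ := by ring

end WhitneyEstimates

section WeightedEnergy

open Metric

variable {E : Type*} [NormedAddCommGroup E] [NormedSpace ℝ E] [FiniteDimensional ℝ E]
  [MeasureSpace E] [BorelSpace E] [(volume : Measure E).IsAddHaarMeasure]
  {Ω A B D : Set E} {L ρ s γ : ℝ} {f g v w : E → ℝ}

/-- The density `‖x‖ ^ (-γ) ‖y‖ ^ (-γ) ‖x - y‖ ^ (-(d + 2 s))`, with value `∞` at singularities. -/
def pairWeight (s γ : ℝ) (x y : E) : ℝ≥0∞ :=
  ‖x‖ₑ ^ (-γ) * ‖y‖ₑ ^ (-γ) * ‖x - y‖ₑ ^ (-((Module.finrank ℝ E : ℝ) + 2 * s))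

/-- The weighted `L²` mass of `f` on `A`. -/
def weightedMass (γ : ℝ) (A : Set E) (f : E → ℝ) : ℝ≥0∞ :=
  ∫⁻ x in A, ‖f x‖ₑ ^ 2 * (‖x‖ₑ ^ (-γ)) ^ 2

/-- The weighted interaction energy between `f` on `A` and `g` on `B`. -/
def weightedEnergy (s γ : ℝ) (A B : Set E) (f g : E → ℝ) : ℝ≥0∞ :=
  ∫⁻ x in A, ∫⁻ y in B, ‖f x - g y‖ₑ ^ 2 * pairWeight s γ x y

lemma pairWeight_comm (x y : E) : pairWeight s γ x y = pairWeight s γ y x := by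
  rw [pairWeight, pairWeight, mul_comm (‖x‖ₑ ^ (-γ)), enorm_sub_rev]

lemma measurable_pairWeight : Measurable fun p : E × E => pairWeight s γ p.1 p.2 := by
  unfold pairWeight; fun_prop

lemma enorm_sub_sq_mul_pairWeight_comm (a b : ℝ) (x y : E) :
    ‖a - b‖ₑ ^ 2 * pairWeight s γ x y = ‖b - a‖ₑ ^ 2 * pairWeight s γ y x := by
  rw [pairWeight_comm, enorm_sub_rev]

lemma measurable_energy_integrand (hf : Measurable f) (hg : Measurable g) :
    Measurable fun p : E × E => ‖f p.1 - g p.2‖ₑ ^ 2 * pairWeight s γ p.1 p.2 := by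
  have := measurable_pairWeight (E := E) (s := s) (γ := γ)
  fun_prop

lemma measurable_energy_integrand_right (hg : Measurable g) {a : ℝ} {x : E} :
    Measurable fun y => ‖a - g y‖ₑ ^ 2 * pairWeight s γ x y := by
  unfold pairWeight; fun_prop

lemma weightedEnergy_comm (hf : Measurable f) (hg : Measurable g) :
    weightedEnergy s γ A B f g = weightedEnergy s γ B A g f := by
  unfold weightedEnergy
  rw [lintegral_lintegral_swap (measurable_energy_integrand hf hg).aemeasurable]
  simp only [enorm_sub_sq_mul_pairWeight_comm]

/-- A Schur-type inequality for a double integral dominated by a triple integral. -/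
lemma lintegral_lintegral_le_of_le_lintegral {α : Type*} [MeasurableSpace α] {μ : Measure α}
    [SFinite μ] {A B Ω : Set α} (hA : MeasurableSet A) (hB : MeasurableSet B)
    {F G c : α → α → ℝ≥0∞} {J : α → α → α → ℝ≥0∞}
    (hJm : Measurable fun p : α × α × α => J p.1 p.2.1 p.2.2)
    (hG : Measurable fun p : α × α => G p.1 p.2)
    (h : ∀ x ∈ A, ∀ y ∈ B, F x y ≤ ∫⁻ z in Ω, J x y z * G y z ∂μ)
    (hJ : ∀ y ∈ B, ∀ z, ∫⁻ x in A, J x y z ∂μ ≤ c y z) :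
    ∫⁻ x in A, ∫⁻ y in B, F x y ∂μ ∂μ ≤ ∫⁻ y in B, ∫⁻ z in Ω, c y z * G y z ∂μ ∂μ := by
  have hm : Measurable fun p : α × α × α => J p.1 p.2.1 p.2.2 * G p.2.1 p.2.2 :=
    hJm.mul (hG.comp measurable_snd)
  calc ∫⁻ x in A, ∫⁻ y in B, F x y ∂μ ∂μ
      ≤ ∫⁻ x in A, ∫⁻ y in B, ∫⁻ z in Ω, J x y z * G y z ∂μ ∂μ ∂μ :=
        setLIntegral_mono' hA fun x hx => setLIntegral_mono' hB fun y hy => h x hx y hy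
    _ = ∫⁻ y in B, ∫⁻ x in A, ∫⁻ z in Ω, J x y z * G y z ∂μ ∂μ ∂μ := by
        refine lintegral_lintegral_swap (Measurable.aemeasurable ?_)
        refine Measurable.lintegral_prod_right' (f := fun q : (α × α) × α =>
          J q.1.1 q.1.2 q.2 * G q.1.2 q.2) ?_
        exact hm.comp (by fun_prop : Measurable fun q : (α × α) × α => (q.1.1, q.1.2, q.2))
    _ = ∫⁻ y in B, ∫⁻ z in Ω, ∫⁻ x in A, J x y z * G y z ∂μ ∂μ ∂μ := by
        refine lintegral_congr fun y => lintegral_lintegral_swap (Measurable.aemeasurable ?_)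
        exact hm.comp (by fun_prop : Measurable fun q : α × α => (q.1, y, q.2))
    _ ≤ _ := by
        refine setLIntegral_mono' hB fun y hy => lintegral_mono fun z => ?_
        have hJx : Measurable fun x => J x y z :=
          hJm.comp (by fun_prop : Measurable fun x : α => (x, y, z))
        rw [lintegral_mul_const _ hJx]
        exact mul_le_mul' (hJ y hy z) le_rfl

lemma enorm_rpow_le_of_mem_whitneyRegion (hγ : 0 ≤ γ) (hL : 0 ≤ L) {x z : E}
    (hx : infDist x Ω ≤ ‖x‖) (hz : z ∈ whitneyRegion Ω L x) :
    ‖x‖ₑ ^ (-γ) ≤ ENNReal.ofReal (1 + L) ^ γ * ‖z‖ₑ ^ (-γ) :=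
  enorm_rpow_neg_le (by positivity) hγ (norm_le_of_mem_whitneyRegion hL hx hz)

lemma pairWeight_le_of_mem_whitneyRegion (hγ : 0 ≤ γ) (hs : 0 ≤ s) (hL : 0 ≤ L) {x y z : E}
    (hx : infDist x Ω ≤ ‖x‖) (hxy : infDist x Ω / 2 ≤ dist x y) (hz : z ∈ whitneyRegion Ω L x) :
    pairWeight s γ x y ≤ ENNReal.ofReal (1 + L) ^ γ *
      ENNReal.ofReal (2 * L + 1) ^ ((Module.finrank ℝ E : ℝ) + 2 * s) * pairWeight s γ z y := by
  calc pairWeight s γ x y ≤ (ENNReal.ofReal (1 + L) ^ γ * ‖z‖ₑ ^ (-γ)) * ‖y‖ₑ ^ (-γ) *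
        (ENNReal.ofReal (2 * L + 1) ^ ((Module.finrank ℝ E : ℝ) + 2 * s) *
          ‖z - y‖ₑ ^ (-((Module.finrank ℝ E : ℝ) + 2 * s))) := by
        refine mul_le_mul' (mul_le_mul' (enorm_rpow_le_of_mem_whitneyRegion hγ hL hx hz) le_rfl) ?_
        exact enorm_rpow_neg_le (by positivity) (by positivity)
          (norm_sub_le_of_mem_whitneyRegion hL hxy hz)
    _ = _ := by rw [pairWeight]; ring

/-- `v` is controlled on the collar by the averages of `w` against the Whitney kernel. -/
def WhitneyControlled (Ω : Set E) (L ρ : ℝ) (c : ℝ≥0∞) (w v : E → ℝ) : Prop :=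
  (∀ x ∈ outerCollar Ω ρ, ∀ a, ‖v x - a‖ₑ ^ 2 ≤
    c * ∫⁻ z in Ω, whitneyKernel Ω L x z * ‖w z - a‖ₑ ^ 2) ∧
  ∀ x ∈ outerCollar Ω ρ, ∀ y ∈ outerCollar Ω ρ, dist x y < infDist x Ω / 2 →
    ‖v x - v y‖ₑ ^ 2 ≤ c * ENNReal.ofReal (dist x y / infDist x Ω) ^ 2 *
      ∫⁻ z in Ω, whitneyKernel Ω L x z * ‖w z - v y‖ₑ ^ 2

lemma measurable_whitneyKernel_right {x : E} : Measurable fun z => whitneyKernel Ω L x z :=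
  measurable_whitneyKernel.comp (by fun_prop : Measurable fun z : E => (x, z))

lemma measurable_whitneyKernel_left {z : E} : Measurable fun x => whitneyKernel Ω L x z :=
  measurable_whitneyKernel.comp (by fun_prop : Measurable fun x : E => (x, z))

lemma exists_weightedMass_outerCollar_le (hγ : 0 ≤ γ) (hL : 0 < L)
    (hρ : ∀ x ∈ outerCollar Ω ρ, infDist x Ω ≤ ‖x‖) {c : ℝ≥0∞} (hc : c ≠ ∞) :
    ∃ C : ℝ≥0∞, C ≠ ∞ ∧ ∀ w v : E → ℝ, Measurable w → WhitneyControlled Ω L ρ c w v →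
      weightedMass γ (outerCollar Ω ρ) v ≤ C * weightedMass γ Ω w := by
  refine ⟨c * (ENNReal.ofReal (1 + L) ^ γ) ^ 2 *
    (ENNReal.ofReal ((L ^ 3) ^ Module.finrank ℝ E) * volume (ball (0 : E) 1)),
    ENNReal.mul_ne_top (ENNReal.mul_ne_top hc (by simp [hγ]))
      (ENNReal.mul_ne_top ENNReal.ofReal_ne_top measure_ball_lt_top.ne),
    fun w v hw hv => ?_⟩
  set c₂ := ENNReal.ofReal (1 + L) ^ γ
  set D := outerCollar Ω ρ
  have hpt : ∀ x ∈ D, ‖v x‖ₑ ^ 2 * (‖x‖ₑ ^ (-γ)) ^ 2 ≤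
      c * c₂ ^ 2 * ∫⁻ z in Ω, whitneyKernel Ω L x z * (‖w z‖ₑ ^ 2 * (‖z‖ₑ ^ (-γ)) ^ 2) := by
    intro x hx
    have h := hv.1 x hx 0
    simp only [sub_zero] at h
    have hK := measurable_whitneyKernel_right (Ω := Ω) (L := L) (x := x)
    calc ‖v x‖ₑ ^ 2 * (‖x‖ₑ ^ (-γ)) ^ 2
        ≤ (c * ∫⁻ z in Ω, whitneyKernel Ω L x z * ‖w z‖ₑ ^ 2) * (‖x‖ₑ ^ (-γ)) ^ 2 :=
          mul_le_mul' h le_rfl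
      _ = c * ∫⁻ z in Ω, whitneyKernel Ω L x z * ‖w z‖ₑ ^ 2 * (‖x‖ₑ ^ (-γ)) ^ 2 := by
          rw [lintegral_mul_const _ (by fun_prop), mul_assoc]
      _ ≤ c * ∫⁻ z in Ω, c₂ ^ 2 * (whitneyKernel Ω L x z * (‖w z‖ₑ ^ 2 * (‖z‖ₑ ^ (-γ)) ^ 2)) := by
          refine mul_le_mul' le_rfl (lintegral_mono fun z => ?_)
          by_cases hz : z ∈ whitneyRegion Ω L x
          · calc _ ≤ whitneyKernel Ω L x z * ‖w z‖ₑ ^ 2 * (c₂ * ‖z‖ₑ ^ (-γ)) ^ 2 := by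
                  gcongr
                  exact enorm_rpow_le_of_mem_whitneyRegion hγ hL.le (hρ x hx) hz
              _ = _ := by ring
          · simp [whitneyKernel_of_notMem hz]
      _ = _ := by rw [lintegral_const_mul _ (by fun_prop), mul_assoc]
  have hKm := measurable_whitneyKernel (Ω := Ω) (L := L)
  calc weightedMass γ D v
      ≤ ∫⁻ x in D, c * c₂ ^ 2 *
          ∫⁻ z in Ω, whitneyKernel Ω L x z * (‖w z‖ₑ ^ 2 * (‖z‖ₑ ^ (-γ)) ^ 2) :=
        setLIntegral_mono' isOpen_outerCollar.measurableSet hpt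
    _ = c * c₂ ^ 2 * ∫⁻ x in D, ∫⁻ z in Ω,
          whitneyKernel Ω L x z * (‖w z‖ₑ ^ 2 * (‖z‖ₑ ^ (-γ)) ^ 2) := by
        refine lintegral_const_mul _ ?_
        exact Measurable.lintegral_prod_right' (f := fun q : E × E =>
          whitneyKernel Ω L q.1 q.2 * (‖w q.2‖ₑ ^ 2 * (‖q.2‖ₑ ^ (-γ)) ^ 2)) (by fun_prop)
    _ = c * c₂ ^ 2 * ∫⁻ z in Ω, (∫⁻ x in D, whitneyKernel Ω L x z) *
          (‖w z‖ₑ ^ 2 * (‖z‖ₑ ^ (-γ)) ^ 2) := by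
        rw [lintegral_lintegral_swap (Measurable.aemeasurable (by fun_prop))]
        congr 1
        exact lintegral_congr fun z => lintegral_mul_const _ measurable_whitneyKernel_left
    _ ≤ c * c₂ ^ 2 * ∫⁻ z in Ω, (ENNReal.ofReal ((L ^ 3) ^ Module.finrank ℝ E) *
          volume (ball (0 : E) 1)) * (‖w z‖ₑ ^ 2 * (‖z‖ₑ ^ (-γ)) ^ 2) := by
        gcongr with z
        exact lintegral_whitneyKernel_le hL z
    _ = _ := by
        rw [lintegral_const_mul _ (by fun_prop), weightedMass, mul_assoc (c * c₂ ^ 2)]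

lemma exists_far_energy_le (hγ : 0 ≤ γ) (hs : 0 ≤ s) (hL : 0 < L)
    (hρ : ∀ x ∈ outerCollar Ω ρ, infDist x Ω ≤ ‖x‖) {c : ℝ≥0∞} (hc : c ≠ ∞) :
    ∃ C : ℝ≥0∞, C ≠ ∞ ∧ ∀ (w v g : E → ℝ) (B : Set E), Measurable w → Measurable g →
      MeasurableSet B → WhitneyControlled Ω L ρ c w v →
      ∫⁻ x in outerCollar Ω ρ, ∫⁻ y in B, {y | infDist x Ω / 2 ≤ dist x y}.indicator
        (fun y => ‖v x - g y‖ₑ ^ 2 * pairWeight s γ x y) y ≤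
      C * weightedEnergy s γ B Ω g w := by
  have hβ : 0 ≤ (Module.finrank ℝ E : ℝ) + 2 * s := by positivity
  set c₂ := ENNReal.ofReal (1 + L) ^ γ *
    ENNReal.ofReal (2 * L + 1) ^ ((Module.finrank ℝ E : ℝ) + 2 * s) with hc₂
  refine ⟨ENNReal.ofReal ((L ^ 3) ^ Module.finrank ℝ E) * volume (ball (0 : E) 1) * (c * c₂),
    ENNReal.mul_ne_top (ENNReal.mul_ne_top ENNReal.ofReal_ne_top measure_ball_lt_top.ne)
      (ENNReal.mul_ne_top hc (ENNReal.mul_ne_top (by simp [hγ]) (by simp [hβ]))),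
    fun w v g B hw hg hB hv => ?_⟩
  have hKm := measurable_whitneyKernel (Ω := Ω) (L := L)
  have hGm : Measurable fun p : E × E => ‖g p.1 - w p.2‖ₑ ^ 2 * pairWeight s γ p.1 p.2 :=
    measurable_energy_integrand hg hw
  refine (lintegral_lintegral_le_of_le_lintegral (J := fun x _ z => whitneyKernel Ω L x z)
    (G := fun y z => c * c₂ * (‖g y - w z‖ₑ ^ 2 * pairWeight s γ y z))
    (c := fun _ _ => ENNReal.ofReal ((L ^ 3) ^ Module.finrank ℝ E) * volume (ball (0 : E) 1))
    (Ω := Ω) isOpen_outerCollar.measurableSet hB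
    (by fun_prop) (by fun_prop) ?_ fun y _ z => lintegral_whitneyKernel_le hL z).trans (le_of_eq ?_)
  · intro x hx y _
    by_cases hxy : infDist x Ω / 2 ≤ dist x y
    swap
    · rw [Set.indicator_of_notMem (by exact hxy)]; exact zero_le
    rw [Set.indicator_of_mem (by exact hxy)]
    have hK := measurable_whitneyKernel_right (Ω := Ω) (L := L) (x := x)
    calc ‖v x - g y‖ₑ ^ 2 * pairWeight s γ x y
        ≤ (c * ∫⁻ z in Ω, whitneyKernel Ω L x z * ‖w z - g y‖ₑ ^ 2) * pairWeight s γ x y :=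
          mul_le_mul' (hv.1 x hx _) le_rfl
      _ = ∫⁻ z in Ω, c * (whitneyKernel Ω L x z * ‖w z - g y‖ₑ ^ 2) * pairWeight s γ x y := by
          rw [lintegral_mul_const _ (by fun_prop), lintegral_const_mul _ (by fun_prop)]
      _ ≤ _ := by
          refine lintegral_mono fun z => ?_
          by_cases hz : z ∈ whitneyRegion Ω L x
          · calc _ ≤ c * (whitneyKernel Ω L x z * ‖w z - g y‖ₑ ^ 2) * (c₂ * pairWeight s γ z y) := by
                  gcongr
                  exact pairWeight_le_of_mem_whitneyRegion hγ hs hL.le (hρ x hx) hxy hz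
              _ = whitneyKernel Ω L x z * (c * c₂ * (‖w z - g y‖ₑ ^ 2 * pairWeight s γ z y)) := by
                  ring
              _ = _ := by rw [enorm_sub_sq_mul_pairWeight_comm]
          · simp [whitneyKernel_of_notMem hz]
  · rw [weightedEnergy, ← lintegral_const_mul _ hGm.lintegral_prod_right']
    refine lintegral_congr fun y => ?_
    have hGy : Measurable fun z => ‖g y - w z‖ₑ ^ 2 * pairWeight s γ y z :=
      measurable_energy_integrand_right hw
    simp only
    rw [← lintegral_const_mul _ hGy]
    simp only [mul_assoc]

lemma exists_near_energy_le (hγ : 0 ≤ γ) (hs0 : 0 < s) (hs1 : s < 1)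
    (hd : 0 < Module.finrank ℝ E) (hL : 0 < L)
    (hρ : ∀ x ∈ outerCollar Ω ρ, infDist x Ω ≤ ‖x‖) {c : ℝ≥0∞} (hc : c ≠ ∞) :
    ∃ C : ℝ≥0∞, C ≠ ∞ ∧ ∀ w v : E → ℝ, Measurable w → Measurable v →
      WhitneyControlled Ω L ρ c w v →
      ∫⁻ x in outerCollar Ω ρ, ∫⁻ y in outerCollar Ω ρ, {y | dist x y < infDist x Ω / 2}.indicator
        (fun y => ‖v x - v y‖ₑ ^ 2 * pairWeight s γ x y) y ≤
      C * weightedEnergy s γ (outerCollar Ω ρ) Ω v w := by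
  obtain ⟨C₁, hC₁, h₁⟩ := exists_lintegral_near_le (Ω := Ω) (ρ := ρ) hs1 hs0 hd hL
  set c₂ := ENNReal.ofReal (1 + L) ^ γ with hc₂
  set β : ℝ := (Module.finrank ℝ E : ℝ) + 2 * s with hβ
  refine ⟨C₁ * (c * c₂),
    ENNReal.mul_ne_top hC₁ (ENNReal.mul_ne_top hc (by simp [hc₂, hγ])),
    fun w v hw hv hwv => ?_⟩
  have hKm := measurable_whitneyKernel (Ω := Ω) (L := L)
  have hGm : Measurable fun p : E × E => ‖v p.1 - w p.2‖ₑ ^ 2 * pairWeight s γ p.1 p.2 :=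
    measurable_energy_integrand hv hw
  have hid : Measurable fun x : E => infDist x Ω := (continuous_infDist_pt Ω).measurable
  refine (lintegral_lintegral_le_of_le_lintegral
    (J := fun x y z => {x | dist x y < infDist x Ω / 2}.indicator
        (fun x => ENNReal.ofReal (dist x y / infDist x Ω) ^ 2 * whitneyKernel Ω L x z *
          ‖x - y‖ₑ ^ (-β)) x)
    (G := fun y z => c * c₂ * (‖v y - w z‖ₑ ^ 2 * (‖y‖ₑ ^ (-γ) * ‖z‖ₑ ^ (-γ))))
    (c := fun y z => C₁ * ‖z - y‖ₑ ^ (-β))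
    (Ω := Ω) isOpen_outerCollar.measurableSet isOpen_outerCollar.measurableSet
    ?_ (by fun_prop) ?_ h₁).trans (le_of_eq ?_)
  · have : (fun p : E × E × E => {x | dist x p.2.1 < infDist x Ω / 2}.indicator
        (fun x => ENNReal.ofReal (dist x p.2.1 / infDist x Ω) ^ 2 * whitneyKernel Ω L x p.2.2 *
          ‖x - p.2.1‖ₑ ^ (-β)) p.1) =
        {p : E × E × E | dist p.1 p.2.1 < infDist p.1 Ω / 2}.indicator
        (fun p => ENNReal.ofReal (dist p.1 p.2.1 / infDist p.1 Ω) ^ 2 *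
          whitneyKernel Ω L p.1 p.2.2 * ‖p.1 - p.2.1‖ₑ ^ (-β)) := by
      ext p; simp [Set.indicator]
    rw [this]
    exact Measurable.indicator (by fun_prop) (measurableSet_lt (by fun_prop) (by fun_prop))
  · intro x hx y hy
    by_cases hxy : dist x y < infDist x Ω / 2
    swap
    · rw [Set.indicator_of_notMem (by exact hxy)]; exact zero_le
    rw [Set.indicator_of_mem (by exact hxy)]
    have hK := measurable_whitneyKernel_right (Ω := Ω) (L := L) (x := x)
    set r := ENNReal.ofReal (dist x y / infDist x Ω) ^ 2 with hr
    calc ‖v x - v y‖ₑ ^ 2 * pairWeight s γ x y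
        ≤ (c * r * ∫⁻ z in Ω, whitneyKernel Ω L x z * ‖w z - v y‖ₑ ^ 2) * pairWeight s γ x y :=
          mul_le_mul' (hwv.2 x hx y hy hxy) le_rfl
      _ = ∫⁻ z in Ω, c * r * (whitneyKernel Ω L x z * ‖w z - v y‖ₑ ^ 2) * pairWeight s γ x y := by
          rw [lintegral_mul_const _ (by fun_prop), lintegral_const_mul _ (by fun_prop)]
      _ ≤ _ := by
          refine lintegral_mono fun z => ?_
          simp only
          rw [Set.indicator_of_mem (by exact hxy), enorm_sub_rev]
          by_cases hz : z ∈ whitneyRegion Ω L x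
          · calc _ ≤ c * r * (whitneyKernel Ω L x z * ‖v y - w z‖ₑ ^ 2) *
                    ((c₂ * ‖z‖ₑ ^ (-γ)) * ‖y‖ₑ ^ (-γ) * ‖x - y‖ₑ ^ (-β)) := by
                  refine mul_le_mul' le_rfl (mul_le_mul' (mul_le_mul' ?_ le_rfl) le_rfl)
                  exact enorm_rpow_le_of_mem_whitneyRegion hγ hL.le (hρ x hx) hz
              _ = _ := by ring
          · simp [whitneyKernel_of_notMem hz]
  · rw [weightedEnergy, ← lintegral_const_mul _ hGm.lintegral_prod_right']
    refine lintegral_congr fun y => ?_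
    have hGy : Measurable fun z => ‖v y - w z‖ₑ ^ 2 * pairWeight s γ y z :=
      measurable_energy_integrand_right hw
    simp only
    rw [← lintegral_const_mul _ hGy]
    refine lintegral_congr fun z => ?_
    rw [pairWeight, enorm_sub_rev z y]
    ring

lemma exists_energy_outerCollar_le (hγ : 0 ≤ γ) (hs0 : 0 < s) (hs1 : s < 1)
    (hd : 0 < Module.finrank ℝ E) (hL : 0 < L) (hΩ : MeasurableSet Ω)
    (hρ : ∀ x ∈ outerCollar Ω ρ, infDist x Ω ≤ ‖x‖) {c : ℝ≥0∞} (hc : c ≠ ∞) :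
    ∃ C : ℝ≥0∞, C ≠ ∞ ∧ ∀ w v : E → ℝ, Measurable w → Measurable v →
      WhitneyControlled Ω L ρ c w v →
      weightedEnergy s γ (outerCollar Ω ρ) Ω v w ≤ C * weightedEnergy s γ Ω Ω w w ∧
      weightedEnergy s γ (outerCollar Ω ρ) (outerCollar Ω ρ) v v ≤
        C * weightedEnergy s γ Ω Ω w w := by
  obtain ⟨C₁, hC₁, h₁⟩ := exists_far_energy_le (E := E) hγ hs0.le hL hρ hc
  obtain ⟨C₂, hC₂, h₂⟩ := exists_near_energy_le (E := E) hγ hs0 hs1 hd hL hρ hc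
  refine ⟨C₁ + (C₁ + C₂) * C₁, by finiteness, fun w v hw hv hwv => ?_⟩
  set D := outerCollar Ω ρ with hD
  have hDm : MeasurableSet D := isOpen_outerCollar.measurableSet
  have e1 : weightedEnergy s γ D Ω v w ≤ C₁ * weightedEnergy s γ Ω Ω w w := by
    refine le_trans (le_of_eq ?_) (h₁ w v w Ω hw hw hΩ hwv)
    refine lintegral_congr fun x => setLIntegral_congr_fun hΩ fun y hy => ?_
    rw [Set.indicator_of_mem]
    have h3 := infDist_le_dist_of_mem (x := x) hy
    have h4 : 0 ≤ infDist x Ω := infDist_nonneg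
    change infDist x Ω / 2 ≤ dist x y
    linarith
  have hm := measurable_energy_integrand (s := s) (γ := γ) hv hv
  have hid : Measurable fun x : E => infDist x Ω := (continuous_infDist_pt Ω).measurable
  have e2 : weightedEnergy s γ D D v v ≤ (C₁ + C₂) * weightedEnergy s γ D Ω v w := by
    rw [add_mul]
    refine le_trans (le_of_eq ?_) (add_le_add (h₁ w v v D hw hv hDm hwv) (h₂ w v hw hv hwv))
    rw [weightedEnergy, ← lintegral_add_left]
    · refine lintegral_congr fun x => ?_
      rw [← lintegral_add_left]
      · refine lintegral_congr fun y => ?_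
        by_cases hxy : infDist x Ω / 2 ≤ dist x y
        · rw [Set.indicator_of_mem (by exact hxy), Set.indicator_of_notMem (by simpa using hxy),
            add_zero]
        · rw [Set.indicator_of_notMem (by exact hxy), Set.indicator_of_mem (by simpa using hxy),
            zero_add]
      · exact (measurable_energy_integrand_right hv).indicator
          (measurableSet_le (by fun_prop) (by fun_prop))
    · have : (fun p : E × E => {y | infDist p.1 Ω / 2 ≤ dist p.1 y}.indicator
          (fun y => ‖v p.1 - v y‖ₑ ^ 2 * pairWeight s γ p.1 y) p.2) =
          {p : E × E | infDist p.1 Ω / 2 ≤ dist p.1 p.2}.indicator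
          (fun p => ‖v p.1 - v p.2‖ₑ ^ 2 * pairWeight s γ p.1 p.2) := by
        ext p; simp [Set.indicator]
      refine Measurable.lintegral_prod_right' (f := fun p : E × E =>
        {y | infDist p.1 Ω / 2 ≤ dist p.1 y}.indicator
          (fun y => ‖v p.1 - v y‖ₑ ^ 2 * pairWeight s γ p.1 y) p.2) ?_
      rw [this]
      exact hm.indicator (measurableSet_le (by fun_prop) (by fun_prop))
  constructor
  · exact e1.trans (by gcongr; exact le_self_add)
  · calc _ ≤ (C₁ + C₂) * weightedEnergy s γ D Ω v w := e2
      _ ≤ (C₁ + C₂) * (C₁ * weightedEnergy s γ Ω Ω w w) := by gcongr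
      _ = (C₁ + C₂) * C₁ * weightedEnergy s γ Ω Ω w w := by ring
      _ ≤ _ := by gcongr; exact le_add_self

end WeightedEnergy

section Gluing

open Metric

variable {E : Type*} [NormedAddCommGroup E] [NormedSpace ℝ E] [FiniteDimensional ℝ E]
  [MeasureSpace E] [BorelSpace E] [(volume : Measure E).IsAddHaarMeasure]
  {Ω S A B D : Set E} {L ρ s γ : ℝ} {f g v w : E → ℝ}

lemma weightedMass_congr (hA : MeasurableSet A) (h : ∀ x ∈ A, f x = g x) :
    weightedMass γ A f = weightedMass γ A g :=
  setLIntegral_congr_fun hA fun x hx => by simp only [h x hx]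

lemma weightedEnergy_congr (hA : MeasurableSet A) (hB : MeasurableSet B) {f' g' : E → ℝ}
    (h : ∀ x ∈ A, f x = f' x) (h' : ∀ x ∈ B, g x = g' x) :
    weightedEnergy s γ A B f g = weightedEnergy s γ A B f' g' :=
  setLIntegral_congr_fun hA fun x hx => setLIntegral_congr_fun hB fun y hy => by
    simp only [h x hx, h' y hy]

lemma weightedMass_union (hB : MeasurableSet B) (h : Disjoint A B) :
    weightedMass γ (A ∪ B) f = weightedMass γ A f + weightedMass γ B f :=
  lintegral_union hB h

lemma weightedEnergy_union (hB : MeasurableSet B) (h : Disjoint A B)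
    (hf : Measurable f) :
    weightedEnergy s γ (A ∪ B) (A ∪ B) f f =
      weightedEnergy s γ A A f f + 2 * weightedEnergy s γ B A f f +
        weightedEnergy s γ B B f f := by
  have hm := measurable_energy_integrand (s := s) (γ := γ) hf hf
  have h1 : ∀ x, ∫⁻ y in A ∪ B, ‖f x - f y‖ₑ ^ 2 * pairWeight s γ x y =
      (∫⁻ y in A, ‖f x - f y‖ₑ ^ 2 * pairWeight s γ x y) +
        ∫⁻ y in B, ‖f x - f y‖ₑ ^ 2 * pairWeight s γ x y := fun x => lintegral_union hB h
  have h2 : weightedEnergy s γ A B f f = weightedEnergy s γ B A f f := weightedEnergy_comm hf hf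
  unfold weightedEnergy at *
  simp only [h1]
  rw [lintegral_add_left hm.lintegral_prod_right', lintegral_union hB h, lintegral_union hB h, h2]
  ring

lemma enorm_add_sq_le (a b : ℝ) : ‖a + b‖ₑ ^ 2 ≤ 2 * ‖a‖ₑ ^ 2 + 2 * ‖b‖ₑ ^ 2 := by
  have h : (a + b) ^ 2 ≤ 2 * a ^ 2 + 2 * b ^ 2 := by nlinarith [sq_nonneg (a - b)]
  have e : ∀ t : ℝ, ‖t‖ₑ ^ 2 = ENNReal.ofReal (t ^ 2) := fun t => by
    rw [← ofReal_norm, ← ENNReal.ofReal_pow (norm_nonneg _), Real.norm_eq_abs, sq_abs]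
  rw [e, e, e, show (2 : ℝ≥0∞) = ENNReal.ofReal 2 by simp, ← ENNReal.ofReal_mul zero_le_two,
    ← ENNReal.ofReal_mul zero_le_two, ← ENNReal.ofReal_add (by positivity) (by positivity)]
  exact ENNReal.ofReal_le_ofReal h

/-- Multiplication by a Lipschitz cutoff is bounded for the weighted energy norm. -/
lemma exists_cutoff_energy_le (hs0 : 0 < s) (hs1 : s < 1) (hγ0 : 0 < γ)
    (hγ : γ < Module.finrank ℝ E) {K : ℝ} (hK : 1 ≤ K) :
    ∃ C : ℝ≥0∞, C ≠ ∞ ∧ ∀ (χ W : E → ℝ) (S : Set E), Measurable W → MeasurableSet S →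
      (∀ x, 0 ≤ χ x) → (∀ x, χ x ≤ 1) → (∀ x y, |χ x - χ y| ≤ K * dist x y) →
      (∀ᵐ x, x ∉ S → χ x = 0) →
      weightedMass γ Set.univ (fun x => χ x * W x) ≤ weightedMass γ S W ∧
      weightedEnergy s γ Set.univ Set.univ (fun x => χ x * W x) (fun x => χ x * W x) ≤
        2 * weightedEnergy s γ S S W W + C * weightedMass γ S W := by
  obtain ⟨C, hC, h⟩ := exists_lintegral_min_sq_mul_kernel_le (E := E) hs0 hs1 hγ0 hγ
  refine ⟨3 * (ENNReal.ofReal K ^ 2 * C), by finiteness,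
    fun χ W S hW hS hχ0 hχ1 hχL hχS => ⟨?_, ?_⟩⟩
  · have : ∀ᵐ x, ‖χ x * W x‖ₑ ^ 2 * (‖x‖ₑ ^ (-γ)) ^ 2 ≤
        S.indicator (fun x => ‖W x‖ₑ ^ 2 * (‖x‖ₑ ^ (-γ)) ^ 2) x := by
      filter_upwards [hχS] with x hx
      by_cases hxS : x ∈ S
      · rw [Set.indicator_of_mem hxS, enorm_mul]
        have : ‖χ x‖ₑ ≤ 1 := by
          rw [Real.enorm_of_nonneg (hχ0 x)]; simpa using hχ1 x
        gcongr
        exact mul_le_of_le_one_left' this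
      · simp [hx hxS]
    calc weightedMass γ Set.univ (fun x => χ x * W x)
        = ∫⁻ x, ‖χ x * W x‖ₑ ^ 2 * (‖x‖ₑ ^ (-γ)) ^ 2 := by rw [weightedMass, setLIntegral_univ]
      _ ≤ _ := lintegral_mono_ae this
      _ = _ := lintegral_indicator hS _
  set m : E → E → ℝ≥0∞ := fun x y =>
    (min 1 ‖x - y‖ₑ) ^ 2 * ‖x - y‖ₑ ^ (-((Module.finrank ℝ E : ℝ) + 2 * s)) * ‖x‖ₑ ^ (-γ) with hm
  set T : E → E → ℝ≥0∞ := fun x y =>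
    S.indicator (fun y => ‖W y‖ₑ ^ 2 * ‖y‖ₑ ^ (-γ)) y * m x y with hT
  set F : E → E → ℝ≥0∞ := fun x y =>
    S.indicator (fun x => S.indicator (fun y => ‖W x - W y‖ₑ ^ 2 * pairWeight s γ x y) y) x with hF
  have hmm : Measurable fun p : E × E => m p.1 p.2 := by
    simp only [hm]; fun_prop
  have hTm : Measurable fun p : E × E => T p.1 p.2 := by
    have : Measurable (S.indicator fun y => ‖W y‖ₑ ^ 2 * ‖y‖ₑ ^ (-γ)) :=
      Measurable.indicator (by fun_prop) hS
    exact (this.comp measurable_snd).mul hmm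
  have hχq : ∀ x y, ‖χ x - χ y‖ₑ ^ 2 ≤ ENNReal.ofReal K ^ 2 * (min 1 ‖x - y‖ₑ) ^ 2 := by
    intro x y
    rw [← mul_pow]
    gcongr
    rw [mul_min, ← ofReal_norm, ← ofReal_norm, ← ENNReal.ofReal_mul (by positivity), mul_one,
      ← dist_eq_norm x]
    refine le_min (ENNReal.ofReal_le_ofReal ?_) (ENNReal.ofReal_le_ofReal (hχL x y))
    rw [Real.norm_eq_abs]
    refine (abs_le.2 ⟨?_, ?_⟩).trans hK <;> linarith [hχ0 x, hχ1 x, hχ0 y, hχ1 y]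
  have hcross : ∀ x y, y ∈ S → ‖W y‖ₑ ^ 2 * ‖χ x - χ y‖ₑ ^ 2 * pairWeight s γ x y ≤
      ENNReal.ofReal K ^ 2 * T x y := by
    intro x y hy
    simp only [hT, hm, Set.indicator_of_mem hy, pairWeight]
    calc _ ≤ ‖W y‖ₑ ^ 2 * (ENNReal.ofReal K ^ 2 * (min 1 ‖x - y‖ₑ) ^ 2) *
        (‖x‖ₑ ^ (-γ) * ‖y‖ₑ ^ (-γ) * ‖x - y‖ₑ ^ (-((Module.finrank ℝ E : ℝ) + 2 * s))) :=
          mul_le_mul' (mul_le_mul' le_rfl (hχq x y)) le_rfl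
      _ = _ := by ring
  have hpt : ∀ x y, (x ∉ S → χ x = 0) → (y ∉ S → χ y = 0) →
      ‖χ x * W x - χ y * W y‖ₑ ^ 2 * pairWeight s γ x y ≤
        2 * F x y + ENNReal.ofReal K ^ 2 * (2 * T x y + T y x) := by
    intro x y hx hy
    by_cases hyS : y ∈ S
    · by_cases hxS : x ∈ S
      · have h1 : ‖χ x * W x - χ y * W y‖ₑ ^ 2 ≤
            2 * ‖W x - W y‖ₑ ^ 2 + 2 * (‖W y‖ₑ ^ 2 * ‖χ x - χ y‖ₑ ^ 2) := by
          have h2 := enorm_add_sq_le (χ x * (W x - W y)) (W y * (χ x - χ y))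
          have h3 : χ x * (W x - W y) + W y * (χ x - χ y) = χ x * W x - χ y * W y := by ring
          rw [h3, enorm_mul, enorm_mul, mul_pow (‖W y‖ₑ)] at h2
          refine h2.trans ?_
          gcongr
          refine mul_le_of_le_one_left' ?_
          rw [Real.enorm_of_nonneg (hχ0 x)]; simpa using hχ1 x
        calc _ ≤ (2 * ‖W x - W y‖ₑ ^ 2 + 2 * (‖W y‖ₑ ^ 2 * ‖χ x - χ y‖ₑ ^ 2)) *
              pairWeight s γ x y := mul_le_mul' h1 le_rfl
          _ = 2 * F x y + 2 * (‖W y‖ₑ ^ 2 * ‖χ x - χ y‖ₑ ^ 2 * pairWeight s γ x y) := by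
              simp only [hF, Set.indicator_of_mem hyS, Set.indicator_of_mem hxS]; ring
          _ ≤ 2 * F x y + 2 * (ENNReal.ofReal K ^ 2 * T x y) := 
              add_le_add le_rfl (mul_le_mul' le_rfl (hcross x y hyS))
          _ = 2 * F x y + ENNReal.ofReal K ^ 2 * (2 * T x y) := by ring
          _ ≤ _ := by gcongr; exact le_self_add
      · have h1 : ‖χ x * W x - χ y * W y‖ₑ ^ 2 = ‖W y‖ₑ ^ 2 * ‖χ x - χ y‖ₑ ^ 2 := by
          rw [hx hxS, zero_mul, zero_sub, zero_sub, enorm_neg, enorm_neg, enorm_mul]; ring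
        rw [h1]
        refine (hcross x y hyS).trans (le_add_left ?_)
        gcongr
        calc T x y ≤ T x y + (T x y + T y x) := le_self_add
          _ = _ := by ring
    · have h1 : ‖χ x * W x - χ y * W y‖ₑ ^ 2 = ‖W x‖ₑ ^ 2 * ‖χ y - χ x‖ₑ ^ 2 := by
        rw [hy hyS, zero_mul, sub_zero, zero_sub, enorm_neg, enorm_mul]; ring
      by_cases hxS : x ∈ S
      · rw [h1, pairWeight_comm]
        refine (hcross y x hxS).trans (le_add_left ?_)
        gcongr
        exact le_add_self
      · rw [h1, hx hxS, hy hyS]; simp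
  have hTint : ∫⁻ x, ∫⁻ y, T x y ≤ C * weightedMass γ S W := by
    rw [lintegral_lintegral_swap hTm.aemeasurable]
    calc ∫⁻ y, ∫⁻ x, T x y
        = ∫⁻ y, S.indicator (fun y => ‖W y‖ₑ ^ 2 * ‖y‖ₑ ^ (-γ)) y * ∫⁻ x, m x y := by
          refine lintegral_congr fun y => lintegral_const_mul _ ?_
          simp only [hm]; fun_prop
      _ ≤ ∫⁻ y, S.indicator (fun y => ‖W y‖ₑ ^ 2 * ‖y‖ₑ ^ (-γ)) y * (C * ‖y‖ₑ ^ (-γ)) := by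
          gcongr with y
          exact h y
      _ = ∫⁻ y, S.indicator (fun y => C * (‖W y‖ₑ ^ 2 * (‖y‖ₑ ^ (-γ)) ^ 2)) y := by
          refine lintegral_congr fun y => ?_
          by_cases hy : y ∈ S
          · rw [Set.indicator_of_mem hy, Set.indicator_of_mem hy]; ring
          · rw [Set.indicator_of_notMem hy, Set.indicator_of_notMem hy, zero_mul]
      _ = _ := by
          rw [lintegral_indicator hS, lintegral_const_mul _ (by fun_prop), weightedMass]
  have hTint' : ∫⁻ x, ∫⁻ y, T y x ≤ C * weightedMass γ S W := by
    rwa [lintegral_lintegral_swap (f := fun x y => T y x)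
      (hTm.comp measurable_swap).aemeasurable]
  have hFint : ∫⁻ x, ∫⁻ y, F x y = weightedEnergy s γ S S W W := by
    rw [weightedEnergy, ← lintegral_indicator hS]
    refine lintegral_congr fun x => ?_
    by_cases hx : x ∈ S
    · simp only [hF, Set.indicator_of_mem hx]
      rw [lintegral_indicator hS]
    · simp only [hF, Set.indicator_of_notMem hx, lintegral_zero]
  have hFm : Measurable fun p : E × E => F p.1 p.2 := by
    have : (fun p : E × E => F p.1 p.2) = (S ×ˢ S).indicator
        (fun p => ‖W p.1 - W p.2‖ₑ ^ 2 * pairWeight s γ p.1 p.2) := by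
      ext p
      by_cases h1 : p.1 ∈ S <;> by_cases h2 : p.2 ∈ S <;> simp [hF, h1, h2, Set.indicator]
    rw [this]
    exact (measurable_energy_integrand hW hW).indicator (hS.prod hS)
  calc weightedEnergy s γ Set.univ Set.univ (fun x => χ x * W x) (fun x => χ x * W x)
      = ∫⁻ x, ∫⁻ y, ‖χ x * W x - χ y * W y‖ₑ ^ 2 * pairWeight s γ x y := by
        simp only [weightedEnergy, setLIntegral_univ]
    _ ≤ ∫⁻ x, ∫⁻ y, (2 * F x y + ENNReal.ofReal K ^ 2 * (2 * T x y + T y x)) := by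
        refine lintegral_mono_ae ?_
        filter_upwards [hχS] with x hx
        refine lintegral_mono_ae ?_
        filter_upwards [hχS] with y hy using hpt x y hx hy
    _ = ∫⁻ p : E × E, (2 * F p.1 p.2 + ENNReal.ofReal K ^ 2 * (2 * T p.1 p.2 + T p.2 p.1)) := by
        have hTm' : Measurable fun p : E × E => T p.2 p.1 := hTm.comp measurable_swap
        rw [Measure.volume_eq_prod, lintegral_prod _ (Measurable.aemeasurable (by fun_prop))]
    _ = 2 * (∫⁻ x, ∫⁻ y, F x y) + ENNReal.ofReal K ^ 2 *
          (2 * (∫⁻ x, ∫⁻ y, T x y) + ∫⁻ x, ∫⁻ y, T y x) := by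
        have hTm' : Measurable fun p : E × E => T p.2 p.1 := hTm.comp measurable_swap
        rw [lintegral_add_left (by fun_prop), lintegral_const_mul _ hFm,
          lintegral_const_mul _ (by fun_prop), lintegral_add_left (by fun_prop),
          lintegral_const_mul _ hTm, Measure.volume_eq_prod, lintegral_prod _ hFm.aemeasurable,
          lintegral_prod _ hTm.aemeasurable, lintegral_prod _ hTm'.aemeasurable]
    _ ≤ 2 * weightedEnergy s γ S S W W + ENNReal.ofReal K ^ 2 *
          (2 * (C * weightedMass γ S W) + C * weightedMass γ S W) := by
        rw [hFint]
        gcongr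
    _ = _ := by ring

end Gluing

section Extension

open Metric

variable {E : Type*} [NormedAddCommGroup E] [NormedSpace ℝ E] [FiniteDimensional ℝ E]
  [MeasureSpace E] [BorelSpace E] [(volume : Measure E).IsAddHaarMeasure]
  {Ω : Set E} {s γ κ ρ : ℝ} {w : E → ℝ}

lemma integrableOn_of_weightedMass_ne_top (hγ : 0 ≤ γ) (hΩ : MeasurableSet Ω)
    (hb : Bornology.IsBounded Ω) (hw : Measurable w) (h : weightedMass γ Ω w ≠ ∞) :
    IntegrableOn w Ω := by
  obtain ⟨R, hR0, hR⟩ := hb.exists_pos_norm_le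
  refine ⟨hw.aestronglyMeasurable, ?_⟩
  have hpt : ∀ x ∈ Ω, ‖w x‖ₑ ≤
      1 + (ENNReal.ofReal R ^ γ) ^ 2 * (‖w x‖ₑ ^ 2 * (‖x‖ₑ ^ (-γ)) ^ 2) := by
    intro x hx
    have h1 : 1 ≤ ENNReal.ofReal R ^ γ * ‖x‖ₑ ^ (-γ) := by
      have := enorm_rpow_neg_le (x := (1 : ℝ)) (z := x) hR0 hγ (by simpa using hR x hx)
      simpa using this
    calc ‖w x‖ₑ ≤ 1 + ‖w x‖ₑ ^ 2 := by
          rcases le_total ‖w x‖ₑ 1 with h2 | h2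
          · exact h2.trans le_self_add
          · exact (le_self_pow₀ h2 two_ne_zero).trans le_add_self
      _ ≤ 1 + ‖w x‖ₑ ^ 2 * (ENNReal.ofReal R ^ γ * ‖x‖ₑ ^ (-γ)) ^ 2 := by
          gcongr
          exact le_mul_of_one_le_right' (one_le_pow₀ h1)
      _ = _ := by ring
  calc ∫⁻ x in Ω, ‖w x‖ₑ
      ≤ ∫⁻ x in Ω, (1 + (ENNReal.ofReal R ^ γ) ^ 2 * (‖w x‖ₑ ^ 2 * (‖x‖ₑ ^ (-γ)) ^ 2)) :=
        setLIntegral_mono' hΩ hpt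
    _ = volume Ω + (ENNReal.ofReal R ^ γ) ^ 2 * weightedMass γ Ω w := by
        rw [lintegral_add_left measurable_const, setLIntegral_one,
          lintegral_const_mul _ (by fun_prop), weightedMass]
    _ < ∞ := by
        have := hb.measure_lt_top (μ := volume)
        have h3 : (ENNReal.ofReal R ^ γ) ^ 2 ≠ ∞ := by simp [hγ]
        exact ENNReal.add_lt_top.2 ⟨this, (ENNReal.mul_ne_top h3 h).lt_top⟩

lemma exists_outerCollar_infDist_le_norm (Ω : Set E) :
    ∃ ρ : ℝ, 0 < ρ ∧ ∀ x ∈ outerCollar Ω ρ, infDist x Ω ≤ ‖x‖ := by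
  have h1 : ∀ x : E, infDist 0 Ω ≤ infDist x Ω + ‖x‖ := fun x => by
    simpa using infDist_le_infDist_add_dist (s := Ω) (x := (0 : E)) (y := x)
  have h2 : ∀ x : E, infDist x Ω ≤ infDist 0 Ω + ‖x‖ := fun x => by
    simpa using infDist_le_infDist_add_dist (s := Ω) (x := x) (y := (0 : E))
  rcases (infDist_nonneg : 0 ≤ infDist (0 : E) Ω).eq_or_lt with h0 | h0
  · refine ⟨1, one_pos, fun x _ => ?_⟩
    linarith [h2 x]
  · refine ⟨infDist 0 Ω / 2, by positivity, fun x hx => ?_⟩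
    linarith [h1 x, hx.2]

/-- The cutoff equal to `1` on `Ω` and to `0` at distance `ρ` from `Ω`. -/
def collarCutoff (Ω : Set E) (ρ : ℝ) (x : E) : ℝ := max 0 (1 - infDist x Ω / ρ)

lemma abs_collarCutoff_sub_le (hρ : 0 < ρ) (x y : E) :
    |collarCutoff Ω ρ x - collarCutoff Ω ρ y| ≤ ρ⁻¹ * dist x y := by
  have hd : |infDist x Ω - infDist y Ω| ≤ dist x y := by
    have := (lipschitz_infDist_pt Ω).dist_le_mul x y
    simpa [Real.dist_eq] using this
  refine (abs_max_sub_max_le_max _ _ _ _).trans (max_le (by simp; positivity) ?_)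
  calc |1 - infDist x Ω / ρ - (1 - infDist y Ω / ρ)|
      = |ρ⁻¹ * (infDist x Ω - infDist y Ω)| := by rw [← abs_neg]; congr 1; field_simp; ring
    _ = ρ⁻¹ * |infDist x Ω - infDist y Ω| := by rw [abs_mul, abs_of_pos (by positivity)]
    _ ≤ _ := by gcongr

/-- Extension theorem for the weighted energy norm on bounded open sets satisfying the interior
corkscrew condition. -/
theorem InteriorCorkscrew.exists_extension (hs0 : 0 < s) (hs1 : s < 1) (hγ0 : 0 < γ)
    (hγ : γ < Module.finrank ℝ E) (hΩ : IsOpen Ω) (hb : Bornology.IsBounded Ω)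
    (hκ : 0 < κ) (hκ1 : κ ≤ 1) (hρ : 0 < ρ) (h : InteriorCorkscrew Ω Set.univ κ ρ) :
    ∃ C : ℝ≥0∞, C ≠ ∞ ∧ ∀ w : E → ℝ, Measurable w → weightedMass γ Ω w ≠ ∞ →
      ∃ wt : E → ℝ, Measurable wt ∧ (∀ x ∈ Ω, wt x = w x) ∧
        weightedMass γ Set.univ wt + weightedEnergy s γ Set.univ Set.univ wt wt ≤
          C * (weightedMass γ Ω w + weightedEnergy s γ Ω Ω w w) := by
  rcases Ω.eq_empty_or_nonempty with rfl | hne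
  · exact ⟨0, by simp, fun w _ _ => ⟨0, measurable_zero, by simp, by
      simp [weightedMass, weightedEnergy]⟩⟩
  have hd : 0 < Module.finrank ℝ E := by exact_mod_cast hγ0.trans hγ
  have : Nontrivial E := Module.nontrivial_of_finrank_pos (R := ℝ) hd
  have hfr := h.volume_frontier_eq_zero hΩ hκ hκ1 hρ
  have hnu : Ωᶜ.Nonempty := by
    rw [Set.nonempty_compl]
    rintro rfl
    exact NormedSpace.unbounded_univ ℝ E hb
  have hvol : volume Ω ≠ ∞ := hb.measure_lt_top.ne
  obtain ⟨ρ₁, hρ₁, hn⟩ := exists_outerCollar_infDist_le_norm Ω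
  set r := min 1 (min ρ ρ₁) with hr
  have hr0 : 0 < r := by positivity
  have hcol : ∀ x ∈ outerCollar Ω r, infDist x Ω ≤ ‖x‖ := fun x hx =>
    hn x ⟨hx.1, hx.2.trans_le ((min_le_right _ _).trans (min_le_right _ _))⟩
  have hcork : InteriorCorkscrew Ω Set.univ κ r :=
    h.mono subset_rfl le_rfl ((min_le_right _ _).trans (min_le_left _ _))
  obtain ⟨M, c, hM, hc, hG⟩ := hcork.exists_le_integral_whitneyBump hvol hne hnu hκ hκ1
  set c₁ := ENNReal.ofReal ((M + 1) / c) ^ 2 *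
    (ENNReal.ofReal ((2 * M) ^ Module.finrank ℝ E) * volume (ball (0 : E) 1)) with hc₁
  have hc₁t : c₁ ≠ ∞ := ENNReal.mul_ne_top (by simp)
    (ENNReal.mul_ne_top ENNReal.ofReal_ne_top measure_ball_lt_top.ne)
  have hL : 0 < 2 * M := by linarith
  obtain ⟨C₁, hC₁, h₁⟩ := exists_weightedMass_outerCollar_le hγ0.le hL hcol hc₁t
  obtain ⟨C₂, hC₂, h₂⟩ := exists_energy_outerCollar_le hγ0.le hs0 hs1 hd hL hΩ.measurableSet
    hcol hc₁t
  obtain ⟨C₃, hC₃, h₃⟩ := exists_cutoff_energy_le (E := E) (K := r⁻¹) hs0 hs1 hγ0 hγ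
    ((one_le_inv₀ hr0).2 (min_le_left _ _))
  refine ⟨(1 + C₃) * (1 + C₁) + 2 * (1 + 3 * C₂), by finiteness, fun w hw hwm => ?_⟩
  have hwi : IntegrableOn w Ω :=
    integrableOn_of_weightedMass_ne_top hγ0.le hΩ.measurableSet hb hw hwm
  set D := outerCollar Ω r with hD
  have hDm : MeasurableSet D := isOpen_outerCollar.measurableSet
  set v := whitneyAverage Ω M w with hv
  have hvm : Measurable v := measurable_whitneyAverage hw
  have hctrl : WhitneyControlled Ω (2 * M) r c₁ w v := by
    refine ⟨fun x hx a => ?_, fun x hx y hy hxy => ?_⟩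
    · exact sq_enorm_whitneyAverage_sub_le hM hvol hw hwi hc hx.1 (hG x hx) a
    · have hy' : ∫ z in Ω, whitneyBump Ω M y z ≠ 0 :=
        (lt_of_lt_of_le (mul_pos hc (pow_pos hy.1 _)) (hG y hy)).ne'
      exact sq_enorm_whitneyAverage_sub_whitneyAverage_le hM hvol hw hwi hc hx.1 (hG x hx) hy' hxy
  classical
  set W : E → ℝ := Ω.piecewise w v with hW
  have hWm : Measurable W := hw.piecewise hΩ.measurableSet hvm
  have hWΩ : ∀ x ∈ Ω, W x = w x := fun x hx => Set.piecewise_eq_of_mem _ _ _ hx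
  have hWD : ∀ x ∈ D, W x = v x := fun x hx =>
    Set.piecewise_eq_of_notMem _ _ _ fun hxΩ => Set.disjoint_left.1 disjoint_outerCollar hxΩ hx
  have hmass : weightedMass γ (Ω ∪ D) W ≤ (1 + C₁) * weightedMass γ Ω w := by
    rw [weightedMass_union hDm disjoint_outerCollar, weightedMass_congr hΩ.measurableSet hWΩ,
      weightedMass_congr hDm hWD, add_mul, one_mul]
    gcongr
    exact h₁ w v hw hctrl
  have henergy : weightedEnergy s γ (Ω ∪ D) (Ω ∪ D) W W ≤
      (1 + 3 * C₂) * weightedEnergy s γ Ω Ω w w := by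
    obtain ⟨e1, e2⟩ := h₂ w v hw hvm hctrl
    rw [weightedEnergy_union hDm disjoint_outerCollar hWm,
      weightedEnergy_congr hΩ.measurableSet hΩ.measurableSet hWΩ hWΩ,
      weightedEnergy_congr hDm hΩ.measurableSet hWD hWΩ, weightedEnergy_congr hDm hDm hWD hWD]
    calc _ ≤ weightedEnergy s γ Ω Ω w w + 2 * (C₂ * weightedEnergy s γ Ω Ω w w) +
          C₂ * weightedEnergy s γ Ω Ω w w := by gcongr
      _ = _ := by ring
  have hχ0 : ∀ x, 0 ≤ collarCutoff Ω r x := fun x => le_max_left _ _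
  have hχ1 : ∀ x, collarCutoff Ω r x ≤ 1 := fun x =>
    max_le zero_le_one (sub_le_self _ (div_nonneg infDist_nonneg hr0.le))
  have hχS : ∀ᵐ x, x ∉ Ω ∪ D → collarCutoff Ω r x = 0 := by
    have hfr' : ∀ᵐ x, x ∉ frontier Ω := measure_eq_zero_iff_ae_notMem.1 hfr
    filter_upwards [hfr'] with x hx hxS
    have hxΩ : x ∉ Ω := fun h => hxS (Or.inl h)
    have hpos : 0 < infDist x Ω := by
      refine infDist_nonneg.lt_of_ne fun h0 => hx ?_
      rw [hΩ.frontier_eq]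
      exact ⟨(mem_closure_iff_infDist_zero hne).2 h0.symm, hxΩ⟩
    have hge : r ≤ infDist x Ω := by
      by_contra! hlt
      exact hxS (Or.inr ⟨hpos, hlt⟩)
    refine max_eq_left ?_
    rw [sub_nonpos, one_le_div hr0]
    exact hge
  have hχm : Measurable (collarCutoff Ω r) := by
    have : Measurable fun x : E => infDist x Ω := (continuous_infDist_pt Ω).measurable
    unfold collarCutoff
    fun_prop
  obtain ⟨f1, f2⟩ := h₃ (collarCutoff Ω r) W (Ω ∪ D) hWm (hΩ.measurableSet.union hDm) hχ0 hχ1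
    (abs_collarCutoff_sub_le hr0) hχS
  refine ⟨fun x => collarCutoff Ω r x * W x, hχm.mul hWm, fun x hx => ?_, ?_⟩
  · simp only [hWΩ x hx, collarCutoff, infDist_zero_of_mem hx, zero_div, sub_zero,
      max_eq_right zero_le_one, one_mul]
  set P := weightedMass γ Ω w
  set Q := weightedEnergy s γ Ω Ω w w
  calc _ ≤ weightedMass γ (Ω ∪ D) W + (2 * weightedEnergy s γ (Ω ∪ D) (Ω ∪ D) W W +
        C₃ * weightedMass γ (Ω ∪ D) W) := add_le_add f1 f2
    _ ≤ (1 + C₁) * P + (2 * ((1 + 3 * C₂) * Q) + C₃ * ((1 + C₁) * P)) := by gcongr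
    _ = (1 + C₃) * (1 + C₁) * P + 2 * (1 + 3 * C₂) * Q := by ring
    _ ≤ ((1 + C₃) * (1 + C₁) + 2 * (1 + 3 * C₂)) * P +
        ((1 + C₃) * (1 + C₁) + 2 * (1 + 3 * C₂)) * Q := by
        gcongr
        · exact le_self_add
        · exact le_add_self
    _ = _ := (mul_add _ _ _).symm

end Extension

section Conversion

variable {N : ℕ} {s γ : ℝ} {O : Set (EuclideanSpace ℝ (Fin N))}
  {φ : EuclideanSpace ℝ (Fin N) → ℝ}

lemma lintegral_mass_integrand_eq (hN : 0 < N) :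
    ∫⁻ x in O, ‖φ x ^ 2 * ‖x‖ ^ (-(2 * γ))‖ₑ = weightedMass γ O φ := by
  refine lintegral_congr_ae ?_
  filter_upwards [ae_restrict_of_ae (ae_ne_of_finrank_pos (by simpa using hN) 0)] with x hx
  have h : ‖x‖ ^ (-(2 * γ)) = (‖x‖ ^ (-γ)) ^ 2 := by
    rw [← Real.rpow_mul_natCast (norm_nonneg x)]; congr 1; push_cast; ring
  rw [h, enorm_mul, enorm_pow, enorm_pow, enorm_rpow_eq_ofReal hx,
    Real.enorm_of_nonneg (by positivity : 0 ≤ ‖x‖ ^ (-γ))]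

lemma lintegral_energy_integrand_eq (hN : 0 < N) (hφ : Measurable φ) :
    ∫⁻ p, ‖(φ p.1 - φ p.2) ^ 2 *
      (‖p.1‖ ^ (-γ) * ‖p.2‖ ^ (-γ) * ‖p.1 - p.2‖ ^ (-((N : ℝ) + 2 * s)))‖ₑ
      ∂((volume.restrict O).prod (volume.restrict O)) = weightedEnergy s γ O O φ φ := by
  rw [lintegral_prod _ (Measurable.aemeasurable (by fun_prop)), weightedEnergy]
  have h0 : ∀ᵐ x ∂(volume.restrict O), x ≠ (0 : EuclideanSpace ℝ (Fin N)) :=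
    ae_restrict_of_ae (ae_ne_of_finrank_pos (by simpa using hN) 0)
  refine lintegral_congr_ae ?_
  filter_upwards [h0] with x hx
  refine lintegral_congr_ae ?_
  filter_upwards [h0] with y hy
  rcases eq_or_ne x y with rfl | hxy
  · simp
  · rw [pairWeight, enorm_mul, enorm_mul, enorm_mul, enorm_pow, enorm_rpow_eq_ofReal hx,
      enorm_rpow_eq_ofReal hy, enorm_rpow_eq_ofReal (sub_ne_zero.2 hxy), finrank_euclideanSpace_fin,
      Real.enorm_of_nonneg (by positivity : 0 ≤ ‖x‖ ^ (-γ)),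
      Real.enorm_of_nonneg (by positivity : 0 ≤ ‖y‖ ^ (-γ)),
      Real.enorm_of_nonneg (by positivity : 0 ≤ ‖x - y‖ ^ (-((N : ℝ) + 2 * s)))]

lemma ynormFinite_iff (hN : 0 < N) (hφ : Measurable φ) :
    YnormFinite N s γ O φ ↔ weightedMass γ O φ ≠ ∞ ∧ weightedEnergy s γ O O φ φ ≠ ∞ := by
  rw [← lintegral_mass_integrand_eq hN, ← lintegral_energy_integrand_eq hN hφ, YnormFinite,
    ← lt_top_iff_ne_top, ← lt_top_iff_ne_top]
  refine and_congr (and_iff_right ?_) (and_iff_right ?_)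
  · exact Measurable.aestronglyMeasurable (by fun_prop)
  · exact Measurable.aestronglyMeasurable (by fun_prop)

lemma integral_eq_toReal_lintegral_enorm_of_nonneg {α : Type*} [MeasurableSpace α] {μ : Measure α}
    {f : α → ℝ} (hf : AEStronglyMeasurable f μ) (h : ∀ a, 0 ≤ f a) :
    ∫ a, f a ∂μ = (∫⁻ a, ‖f a‖ₑ ∂μ).toReal := by
  rw [← integral_norm_eq_lintegral_enorm hf]
  simp only [Real.norm_of_nonneg (h _)]

lemma ynormSq_eq_toReal (hN : 0 < N) (hφ : Measurable φ) (h : YnormFinite N s γ O φ) :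
    YnormSq N s γ O φ = (weightedMass γ O φ + weightedEnergy s γ O O φ φ).toReal := by
  obtain ⟨h1, h2⟩ := (ynormFinite_iff hN hφ).1 h
  have e := integral_prod _ h.2
  rw [YnormSq, ENNReal.toReal_add h1 h2, ← e, ← lintegral_mass_integrand_eq hN,
    ← lintegral_energy_integrand_eq hN hφ,
    integral_eq_toReal_lintegral_enorm_of_nonneg h.1.aestronglyMeasurable fun x => by positivity,
    integral_eq_toReal_lintegral_enorm_of_nonneg h.2.aestronglyMeasurable fun x => by positivity]

end Conversion

end

/-- **Extension lemma**: for a smooth bounded (`C^{1,1}`) domain `Ω`, there is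
`C = C(N,s,Ω,γ) > 0` such that every `w` with `‖w‖_{Y^{s,γ}(Ω)} < ∞` admits an extension
`w̃ : ℝ^N → ℝ` with `w̃ = w` on `Ω` and `‖w̃‖_{Y^{s,γ}(ℝ^N)} ≤ C ‖w‖_{Y^{s,γ}(Ω)}`. -/
theorem Ynorm_extension (N : ℕ) (s γ : ℝ) (hs0 : 0 < s) (hs1 : s < 1)
    (hN : 2 * s < (N : ℝ)) (hγ0 : 0 < γ) (hγ : γ < ((N : ℝ) - 2 * s) / 2)
    (Ω : Set (EuclideanSpace ℝ (Fin N))) (hΩ : IsC11Domain Ω) :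
    ∃ C : ℝ, 0 < C ∧ ∀ w : EuclideanSpace ℝ (Fin N) → ℝ, Measurable w →
      YnormFinite N s γ Ω w →
      ∃ wt : EuclideanSpace ℝ (Fin N) → ℝ,
        (∀ x ∈ Ω, wt x = w x) ∧ YnormFinite N s γ Set.univ wt ∧
          Real.sqrt (YnormSq N s γ Set.univ wt) ≤ C * Real.sqrt (YnormSq N s γ Ω w) := by
  have hN0 : 0 < N := by
    have : (0 : ℝ) < N := by linarith
    exact_mod_cast this
  obtain ⟨κ, ρ, hκ, hκ1, hρ, hcork⟩ := hΩ.exists_interiorCorkscrew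
  obtain ⟨C, hC, hext⟩ := hcork.exists_extension hs0 hs1 hγ0
    (by rw [finrank_euclideanSpace_fin]; linarith) hΩ.1 hΩ.2.1 hκ hκ1 hρ
  refine ⟨Real.sqrt C.toReal + 1, by positivity, fun w hw hwf => ?_⟩
  obtain ⟨h1, h2⟩ := (ynormFinite_iff hN0 hw).1 hwf
  obtain ⟨wt, hwt, heq, hle⟩ := hext w hw h1
  have hCT : C * (weightedMass γ Ω w + weightedEnergy s γ Ω Ω w w) ≠ ⊤ :=
    ENNReal.mul_ne_top hC (ENNReal.add_ne_top.2 ⟨h1, h2⟩)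
  have hfin : YnormFinite N s γ Set.univ wt :=
    (ynormFinite_iff hN0 hwt).2 (ENNReal.add_ne_top.1 (ne_top_of_le_ne_top hCT hle))
  refine ⟨wt, heq, hfin, ?_⟩
  rw [ynormSq_eq_toReal hN0 hwt hfin, ynormSq_eq_toReal hN0 hw hwf]
  calc _ ≤ Real.sqrt (C * (weightedMass γ Ω w + weightedEnergy s γ Ω Ω w w)).toReal :=
        Real.sqrt_le_sqrt (ENNReal.toReal_mono hCT hle)
    _ = Real.sqrt C.toReal * Real.sqrt (weightedMass γ Ω w + weightedEnergy s γ Ω Ω w w).toReal := by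
        rw [ENNReal.toReal_mul, Real.sqrt_mul ENNReal.toReal_nonneg]
    _ ≤ _ := by gcongr; linarith

end
end

section
/- Let 0<s<1, let N be an integer with N>2s, and let 0 < γ < (N-2s)/2. There exists a constant C = C(N,s,γ) > 0 such that for all φ ∈ C_c^∞(ℝ^N), C ∫_{ℝ^N} φ(x)² |x|^{-(2s+2γ)} dx ≤ ∫_{ℝ^N} ∫_{ℝ^N} (φ(x)-φ(y))² |x|^{-γ} |y|^{-γ} |x-y|^{-(N+2s)} dx dy. -/
open MeasureTheory Real Filter

noncomputable section

lemma hardy_kernel_pointwise {d s γ L p q : ℝ} (hd : 0 ≤ d) (hs : 0 < s) (hγ : 0 < γ) (hL : 1 < L)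
    {E : Type*} [NormedAddCommGroup E]
    {x y : E} (hy₁ : L * ‖x‖ ≤ ‖y‖) (hy₂ : ‖y‖ < 2 * (L * ‖x‖)) :
    ‖x‖ ^ (-(2 * s + 2 * γ + d)) * p ^ 2 ≤
      2 * (q ^ 2 * ‖x‖ ^ (-(2 * s + 2 * γ + d))) +
        2 * ((2 * L) ^ γ * (3 * L) ^ (d + 2 * s)) *
          ((p - q) ^ 2 * (‖x‖ ^ (-γ) * ‖y‖ ^ (-γ) * ‖x - y‖ ^ (-(d + 2 * s)))) := by
  have hx : 0 < ‖x‖ := by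
    by_contra! h
    have : ‖x‖ = 0 := le_antisymm h (norm_nonneg _)
    simp only [this] at hy₁ hy₂; linarith
  have hy : 0 < ‖y‖ := lt_of_lt_of_le (by positivity) hy₁
  have hxy : 0 < ‖x - y‖ := by
    rw [norm_sub_rev]
    have := norm_sub_norm_le y x
    nlinarith
  have hxy' : ‖x - y‖ ≤ 3 * L * ‖x‖ := by
    have := norm_sub_le x y
    nlinarith
  have h1 : ‖x‖ ^ (-γ) ≤ (2 * L) ^ γ * ‖y‖ ^ (-γ) := by
    rw [rpow_neg hx.le, rpow_neg hy.le, ← div_eq_mul_inv, le_div_iff₀ (by positivity),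
      inv_mul_le_iff₀ (by positivity), ← mul_rpow hx.le (by positivity)]
    exact rpow_le_rpow hy.le (by linarith) hγ.le
  have h2 : ‖x‖ ^ (-(d + 2 * s)) ≤ (3 * L) ^ (d + 2 * s) * ‖x - y‖ ^ (-(d + 2 * s)) := by
    rw [rpow_neg hx.le, rpow_neg hxy.le, ← div_eq_mul_inv, le_div_iff₀ (by positivity),
      inv_mul_le_iff₀ (by positivity), ← mul_rpow hx.le (by positivity)]
    exact rpow_le_rpow hxy.le (by linarith) (by positivity)
  have h3 : ‖x‖ ^ (-(2 * s + 2 * γ + d)) ≤ ((2 * L) ^ γ * (3 * L) ^ (d + 2 * s)) *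
      (‖x‖ ^ (-γ) * ‖y‖ ^ (-γ) * ‖x - y‖ ^ (-(d + 2 * s))) := by
    calc
      _ = ‖x‖ ^ (-γ) * ‖x‖ ^ (-γ) * ‖x‖ ^ (-(d + 2 * s)) := by
        rw [← rpow_add hx, ← rpow_add hx]; congr 1; ring
      _ ≤ ‖x‖ ^ (-γ) * ((2 * L) ^ γ * ‖y‖ ^ (-γ)) *
          ((3 * L) ^ (d + 2 * s) * ‖x - y‖ ^ (-(d + 2 * s))) := by gcongr
      _ = _ := by ring
  have h4 : p ^ 2 ≤ 2 * q ^ 2 + 2 * (p - q) ^ 2 := by nlinarith [sq_nonneg (p - 2 * q)]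
  calc
    _ ≤ ‖x‖ ^ (-(2 * s + 2 * γ + d)) * (2 * q ^ 2 + 2 * (p - q) ^ 2) := by gcongr
    _ = 2 * (q ^ 2 * ‖x‖ ^ (-(2 * s + 2 * γ + d))) +
        2 * (p - q) ^ 2 * ‖x‖ ^ (-(2 * s + 2 * γ + d)) := by ring
    _ ≤ 2 * (q ^ 2 * ‖x‖ ^ (-(2 * s + 2 * γ + d))) +
        2 * (p - q) ^ 2 * (((2 * L) ^ γ * (3 * L) ^ (d + 2 * s)) *
      (‖x‖ ^ (-γ) * ‖y‖ ^ (-γ) * ‖x - y‖ ^ (-(d + 2 * s)))) := by gcongr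
    _ = _ := by ring

lemma exists_dilation_factor {a d : ℝ} (h : a < d) :
    ∃ L : ℝ, 1 < L ∧ L ^ (-d) * (2 * (2 ^ (a + d) * L ^ a)) ≤ 1 / 2 := by
  have h1 := (tendsto_rpow_neg_atTop (sub_pos.2 h)).const_mul (2 * (2 : ℝ) ^ (a + d))
  rw [mul_zero] at h1
  obtain ⟨L, hL, hL'⟩ := ((h1.eventually_le_const (by norm_num : (0 : ℝ) < 1 / 2)).and
    (eventually_gt_atTop 1)).exists
  refine ⟨L, hL', le_trans (le_of_eq ?_) hL⟩
  have : L ^ (-(d - a)) = L ^ (-d) * L ^ a := by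
    rw [← rpow_add (by linarith)]; congr 1; ring
  rw [this]; ring

/-- Majorant of the difference quotient of a bounded Lipschitz function. -/
def differenceKernel {E : Type*} [NormedAddCommGroup E] (d s Λ M : ℝ) (z : E) : ENNReal :=
  (Metric.ball (0 : E) 1).indicator
      (fun z => ENNReal.ofReal Λ * ENNReal.ofReal (‖z‖ ^ (-(d + 2 * s - 2)))) z +
    (Metric.ball (0 : E) 1)ᶜ.indicator
      (fun z => ENNReal.ofReal M * ENNReal.ofReal (‖z‖ ^ (-(d + 2 * s)))) z

lemma ofReal_sq_mul_le_differenceKernel {d s Λ M t : ℝ} {E : Type*}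
    [NormedAddCommGroup E] {z : E}
    (hΛ : 0 ≤ Λ) (hM : 0 ≤ M) (h1 : t ^ 2 ≤ Λ * ‖z‖ ^ 2) (h2 : t ^ 2 ≤ M) :
    ENNReal.ofReal (t ^ 2 * ‖z‖ ^ (-(d + 2 * s))) ≤ differenceKernel d s Λ M z := by
  rcases eq_or_ne z 0 with rfl | hz
  · have : t ^ 2 = 0 := le_antisymm (by simpa using h1) (sq_nonneg t)
    simp [this]
  have hz' : 0 < ‖z‖ := norm_pos_iff.2 hz
  unfold differenceKernel
  by_cases hz1 : z ∈ Metric.ball (0 : E) 1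
  · rw [Set.indicator_of_mem hz1, Set.indicator_of_notMem (by simpa using hz1), add_zero,
      ← ENNReal.ofReal_mul hΛ]
    refine ENNReal.ofReal_le_ofReal ?_
    calc
      _ ≤ Λ * ‖z‖ ^ 2 * ‖z‖ ^ (-(d + 2 * s)) := by gcongr
      _ = _ := by
        rw [mul_assoc, ← rpow_natCast ‖z‖ 2, ← rpow_add hz']
        congr 2; push_cast; ring
  · rw [Set.indicator_of_notMem hz1, Set.indicator_of_mem (by simpa using hz1), zero_add,
      ← ENNReal.ofReal_mul hM]
    gcongr

section NormPowers

variable {E : Type*} [NormedAddCommGroup E] [NormedSpace ℝ E] [FiniteDimensional ℝ E]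
  [MeasurableSpace E] [BorelSpace E] (μ : Measure E) [μ.IsAddHaarMeasure]

lemma setLIntegral_annulus_norm_rpow_le {a L : ℝ} (ha : 0 ≤ a) (hL : 0 < L) (y : E) :
    ∫⁻ x in {x : E | L * ‖x‖ ≤ ‖y‖ ∧ ‖y‖ < 2 * (L * ‖x‖)},
        ENNReal.ofReal (‖x‖ ^ (-(a + Module.finrank ℝ E))) ∂μ ≤
      ENNReal.ofReal (2 ^ (a + Module.finrank ℝ E) * L ^ a) * ENNReal.ofReal (‖y‖ ^ (-a)) *
        μ (Metric.ball 0 1) := by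
  set d := Module.finrank ℝ E
  rcases eq_or_ne y 0 with rfl | hy
  · have : {x : E | L * ‖x‖ ≤ ‖(0 : E)‖ ∧ ‖(0 : E)‖ < 2 * (L * ‖x‖)} = ∅ := by
      ext x
      simp only [norm_zero, Set.mem_ofPred_eq, Set.mem_empty_iff_false, iff_false]
      rintro ⟨h1, h2⟩
      linarith
    rw [this]; simp
  have hy' : 0 < ‖y‖ := norm_pos_iff.2 hy
  have hc : 0 < ‖y‖ / (2 * L) := by positivity
  calc
    _ ≤ ∫⁻ x in {x : E | L * ‖x‖ ≤ ‖y‖ ∧ ‖y‖ < 2 * (L * ‖x‖)},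
        ENNReal.ofReal ((‖y‖ / (2 * L)) ^ (-(a + d))) ∂μ := by
      refine setLIntegral_mono measurable_const fun x hx => ENNReal.ofReal_le_ofReal ?_
      refine rpow_le_rpow_of_nonpos hc ?_ (neg_nonpos.2 (by positivity))
      rw [div_le_iff₀ (by positivity)]
      linarith [hx.2]
    _ = ENNReal.ofReal ((‖y‖ / (2 * L)) ^ (-(a + d))) *
        μ {x : E | L * ‖x‖ ≤ ‖y‖ ∧ ‖y‖ < 2 * (L * ‖x‖)} := by simp
    _ ≤ ENNReal.ofReal ((‖y‖ / (2 * L)) ^ (-(a + d))) * μ (Metric.closedBall 0 (‖y‖ / L)) := by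
      gcongr
      intro x hx
      simp only [Metric.mem_closedBall, dist_zero_right]
      rw [le_div_iff₀ hL]
      linarith [hx.1]
    _ = _ := by
      rw [Measure.addHaar_closedBall μ _ (by positivity), ← mul_assoc,
        ← ENNReal.ofReal_mul (by positivity), ← ENNReal.ofReal_mul (by positivity)]
      congr 2
      rw [rpow_neg hc.le, rpow_neg hy'.le, div_rpow hy'.le (by positivity),
        mul_rpow (by norm_num) hL.le, rpow_add hL, rpow_add hy', rpow_natCast L, rpow_natCast ‖y‖,
        div_pow]
      field_simp
      exact mul_comm _ _

variable [Nontrivial E]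

lemma setLIntegral_ball_norm_rpow_lt_top {b : ℝ} (hb : b < Module.finrank ℝ E) {r : ℝ}
    (hr : 0 < r) : ∫⁻ x in Metric.ball (0 : E) r, ENNReal.ofReal (‖x‖ ^ (-b)) ∂μ < ⊤ := by
  have hd : 1 ≤ Module.finrank ℝ E := Module.finrank_pos
  refine Integrable.lintegral_lt_top ?_
  refine (integrableOn_fun_norm_addHaar μ (f := fun t : ℝ => t ^ (-b))).2 ?_
  refine ((intervalIntegral.integrableOn_Ioo_rpow_iff
    (s := (Module.finrank ℝ E : ℝ) - 1 - b) hr).2 (by linarith)).congr_fun ?_ measurableSet_Ioo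
  intro t ht
  simp only [smul_eq_mul]
  rw [← rpow_natCast, ← rpow_add ht.1, Nat.cast_sub hd]
  congr 1; push_cast; ring

lemma setLIntegral_compl_ball_norm_rpow_lt_top {b : ℝ} (hb : Module.finrank ℝ E < b) {r : ℝ}
    (hr : 0 < r) : ∫⁻ x in (Metric.ball (0 : E) r)ᶜ, ENNReal.ofReal (‖x‖ ^ (-b)) ∂μ < ⊤ := by
  have hd : 1 ≤ Module.finrank ℝ E := Module.finrank_pos
  refine Integrable.lintegral_lt_top ?_
  rw [← IntegrableOn, ← integrable_indicator_iff Metric.isOpen_ball.measurableSet.compl]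
  have key := (integrable_fun_norm_addHaar μ (E := E)
    (f := (Set.Ici r).indicator fun t : ℝ => t ^ (-b))).2 ?_
  · refine key.congr (.of_forall fun x => ?_)
    simp [Set.indicator]
  · have h1 : IntegrableOn (fun t : ℝ => t ^ ((Module.finrank ℝ E : ℝ) - 1 - b)) (Set.Ici r) := by
      rw [integrableOn_Ici_iff_integrableOn_Ioi]
      exact integrableOn_Ioi_rpow_of_lt (by linarith) hr
    refine ((integrable_indicator_iff measurableSet_Ici).2 h1).integrableOn.congr_fun
      ?_ measurableSet_Ioi
    intro t ht
    by_cases h : t ∈ Set.Ici r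
    · simp only [h, Set.indicator_of_mem, smul_eq_mul]
      rw [← rpow_natCast, ← rpow_add ht, Nat.cast_sub hd]
      congr 1; push_cast; ring
    · simp [h]

lemma ofReal_pow_mul_measure_ball_le_measure_annulus {r : ℝ} (hr : 0 ≤ r) :
    ENNReal.ofReal (r ^ Module.finrank ℝ E) * μ (Metric.ball 0 1) ≤
      μ {y : E | r ≤ ‖y‖ ∧ ‖y‖ < 2 * r} := by
  have hd : 1 ≤ Module.finrank ℝ E := Module.finrank_pos
  have hset : {y : E | r ≤ ‖y‖ ∧ ‖y‖ < 2 * r} = Metric.ball 0 (2 * r) \ Metric.ball 0 r := by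
    ext y; simp [and_comm]
  rw [hset]
  refine le_trans ?_ le_measure_sdiff
  refine ENNReal.le_sub_of_add_le_right measure_ball_lt_top.ne ?_
  rw [Measure.addHaar_ball μ _ hr, Measure.addHaar_ball μ _ (by positivity : 0 ≤ 2 * r), ← add_mul,
    ← ENNReal.ofReal_add (by positivity) (by positivity)]
  gcongr
  rw [mul_pow]
  have : (2 : ℝ) ^ 1 ≤ 2 ^ Module.finrank ℝ E := pow_le_pow_right₀ (by norm_num) hd
  nlinarith [pow_nonneg hr (Module.finrank ℝ E)]

theorem exists_lintegral_hardy {s γ : ℝ} (hs : 0 < s) (hγ : 0 < γ)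
    (h : 2 * s + 2 * γ < Module.finrank ℝ E) :
    ∃ C : ℝ, 0 < C ∧ ∀ φ : E → ℝ, Measurable φ →
      ∫⁻ x, ENNReal.ofReal (φ x ^ 2 * ‖x‖ ^ (-(2 * s + 2 * γ))) ∂μ ≠ ⊤ →
      ∫⁻ x, ENNReal.ofReal (φ x ^ 2 * ‖x‖ ^ (-(2 * s + 2 * γ))) ∂μ ≤
        ENNReal.ofReal C * ∫⁻ x, ∫⁻ y, ENNReal.ofReal ((φ x - φ y) ^ 2 *
          (‖x‖ ^ (-γ) * ‖y‖ ^ (-γ) * ‖x - y‖ ^ (-((Module.finrank ℝ E : ℝ) + 2 * s)))) ∂μ ∂μ := by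
  obtain ⟨L, hL, hLc⟩ := exists_dilation_factor h
  have hL0 : 0 < L := by linarith
  have hd : (0 : ℝ) ≤ Module.finrank ℝ E := Nat.cast_nonneg _
  have hω0 : μ (Metric.ball (0 : E) 1) ≠ 0 := (Metric.measure_ball_pos μ 0 one_pos).ne'
  have hωt : μ (Metric.ball (0 : E) 1) ≠ ⊤ := measure_ball_lt_top.ne
  set ω := μ (Metric.ball (0 : E) 1) with hω
  generalize hdd : (Module.finrank ℝ E : ℝ) = d at *
  have scale (b : ℝ) {t : ℝ} (ht : 0 < t) :
      t ^ (-b) = L ^ (-d) * (t ^ (-(b + d)) * (L * t) ^ d) := by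
    rw [mul_rpow hL0.le ht.le, rpow_neg hL0.le, rpow_neg ht.le, rpow_neg ht.le, rpow_add ht]
    field_simp
  set a := 2 * s + 2 * γ with ha
  have ha0 : 0 < a := by positivity
  set M := 2 * ((2 * L) ^ γ * (3 * L) ^ (d + 2 * s)) with hM
  have hM0 : 0 < M := by positivity
  have hωr : 0 < ω.toReal := ENNReal.toReal_pos hω0 hωt
  refine ⟨ω.toReal⁻¹ * (2 * (L ^ (-d) * M)), by positivity, fun φ hφ hfin => ?_⟩
  set I := ∫⁻ x, ENNReal.ofReal (φ x ^ 2 * ‖x‖ ^ (-a)) ∂μ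
  set F : E → E → ENNReal := fun x y => ENNReal.ofReal ((φ x - φ y) ^ 2 *
    (‖x‖ ^ (-γ) * ‖y‖ ^ (-γ) * ‖x - y‖ ^ (-(d + 2 * s)))) with hF
  set R := ∫⁻ x, ∫⁻ y, F x y ∂μ ∂μ with hR
  set S : Set (E × E) := {p | L * ‖p.1‖ ≤ ‖p.2‖ ∧ ‖p.2‖ < 2 * (L * ‖p.1‖)} with hS
  have hSm : MeasurableSet S := by
    have h₁ : Measurable fun p : E × E => L * ‖p.1‖ := by fun_prop
    exact (measurableSet_le h₁ measurable_snd.norm).inter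
      (measurableSet_lt measurable_snd.norm (h₁.const_mul 2))
  set K : E → E → ENNReal := fun x y =>
    S.indicator (fun p => ENNReal.ofReal (‖p.1‖ ^ (-(a + d)))) (x, y) with hK
  have hKm : Measurable (Function.uncurry K) :=
    Measurable.indicator (by fun_prop) hSm
  have hKx (x : E) : Measurable fun y => K x y := hKm.comp measurable_prodMk_left
  have hKy (y : E) : Measurable fun x => K x y := hKm.comp measurable_prodMk_right
  have hm : Measurable (Function.uncurry fun x y => ENNReal.ofReal (φ y ^ 2) * K x y) :=
    Measurable.mul (by fun_prop) hKm
  have lower (x : E) : ω * ENNReal.ofReal (φ x ^ 2 * ‖x‖ ^ (-a)) ≤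
      ENNReal.ofReal (L ^ (-d)) * ∫⁻ y, K x y * ENNReal.ofReal (φ x ^ 2) ∂μ := by
    rcases eq_or_ne x 0 with rfl | hx
    · simp [zero_rpow (neg_ne_zero.2 ha0.ne')]
    have hx' : 0 < ‖x‖ := norm_pos_iff.2 hx
    have hint : ∫⁻ y, K x y ∂μ = ENNReal.ofReal (‖x‖ ^ (-(a + d))) *
        μ {y : E | L * ‖x‖ ≤ ‖y‖ ∧ ‖y‖ < 2 * (L * ‖x‖)} := by
      exact lintegral_indicator_const (μ := μ)
        (hSm.preimage (measurable_prodMk_left (x := x))) (ENNReal.ofReal (‖x‖ ^ (-(a + d))))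
    rw [lintegral_mul_const _ (hKx x), hint]
    have := ofReal_pow_mul_measure_ball_le_measure_annulus μ (r := L * ‖x‖) (by positivity)
    calc
      _ = ENNReal.ofReal (L ^ (-d)) * (ENNReal.ofReal (‖x‖ ^ (-(a + d))) *
          (ENNReal.ofReal ((L * ‖x‖) ^ Module.finrank ℝ E) * ω) * ENNReal.ofReal (φ x ^ 2)) := by
        have : φ x ^ 2 * ‖x‖ ^ (-a) = L ^ (-d) * (‖x‖ ^ (-(a + d)) *
            ((L * ‖x‖) ^ Module.finrank ℝ E) * φ x ^ 2) := by
          rw [← rpow_natCast (L * ‖x‖), hdd, scale a hx']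
          ring
        rw [this, ENNReal.ofReal_mul (by positivity), ENNReal.ofReal_mul (by positivity),
          ENNReal.ofReal_mul (by positivity)]
        ring
      _ ≤ _ := by gcongr
  have pointwise (x y : E) : K x y * ENNReal.ofReal (φ x ^ 2) ≤
      2 * (ENNReal.ofReal (φ y ^ 2) * K x y) + ENNReal.ofReal M * F x y := by
    by_cases hxy : (x, y) ∈ S
    · simp only [hK, Set.indicator_of_mem hxy, hF]
      rw [← ENNReal.ofReal_mul (by positivity), ← ENNReal.ofReal_mul (by positivity),
        ← ENNReal.ofReal_mul (by positivity), show (2 : ENNReal) = ENNReal.ofReal 2 by simp,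
        ← ENNReal.ofReal_mul (by positivity), ← ENNReal.ofReal_add (by positivity) (by positivity)]
      exact ENNReal.ofReal_le_ofReal (hardy_kernel_pointwise hd hs hγ hL hxy.1 hxy.2)
    · simp [hK, Set.indicator_of_notMem hxy]
  have upper : ∫⁻ x, ∫⁻ y, ENNReal.ofReal (φ y ^ 2) * K x y ∂μ ∂μ ≤
      ENNReal.ofReal (2 ^ (a + d) * L ^ a) * (ω * I) := by
    rw [lintegral_lintegral_swap hm.aemeasurable, ← lintegral_const_mul' _ _ hωt,
      ← lintegral_const_mul' _ _ ENNReal.ofReal_ne_top]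
    refine lintegral_mono fun y => ?_
    have hint : ∫⁻ x, K x y ∂μ = ∫⁻ x in {x : E | L * ‖x‖ ≤ ‖y‖ ∧ ‖y‖ < 2 * (L * ‖x‖)},
        ENNReal.ofReal (‖x‖ ^ (-(a + d))) ∂μ := by
      exact lintegral_indicator (hSm.preimage measurable_prodMk_right) _
    have := setLIntegral_annulus_norm_rpow_le μ ha0.le hL0 y
    rw [hdd, ← hω] at this
    dsimp only
    rw [lintegral_const_mul _ (hKy y), hint,
      ENNReal.ofReal_mul (p := φ y ^ 2) (by positivity)]
    calc
      _ ≤ ENNReal.ofReal (φ y ^ 2) * _ := mul_le_mul_right this _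
      _ = _ := by ring
  have main : ω * I ≤ 2⁻¹ * (ω * I) + ENNReal.ofReal (L ^ (-d) * M) * R := by
    calc
      ω * I = ∫⁻ x, ω * ENNReal.ofReal (φ x ^ 2 * ‖x‖ ^ (-a)) ∂μ :=
        (lintegral_const_mul' _ _ hωt).symm
      _ ≤ ∫⁻ x, ENNReal.ofReal (L ^ (-d)) * ∫⁻ y, (2 * (ENNReal.ofReal (φ y ^ 2) * K x y) +
          ENNReal.ofReal M * F x y) ∂μ ∂μ := by
        refine lintegral_mono fun x => (lower x).trans ?_
        gcongr with y
        exact pointwise x y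
      _ = ENNReal.ofReal (L ^ (-d)) *
          (2 * ∫⁻ x, ∫⁻ y, ENNReal.ofReal (φ y ^ 2) * K x y ∂μ ∂μ + ENNReal.ofReal M * R) := by
        have hsum (x : E) : ∫⁻ y, (2 * (ENNReal.ofReal (φ y ^ 2) * K x y) +
            ENNReal.ofReal M * F x y) ∂μ =
            2 * ∫⁻ y, ENNReal.ofReal (φ y ^ 2) * K x y ∂μ + ENNReal.ofReal M * ∫⁻ y, F x y ∂μ := by
          have hm₀ : Measurable fun y => ENNReal.ofReal (φ y ^ 2) * K x y :=
            hm.comp measurable_prodMk_left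
          rw [lintegral_add_left (hm₀.const_mul 2),
            lintegral_const_mul' _ _ ENNReal.ofNat_ne_top,
            lintegral_const_mul' _ _ ENNReal.ofReal_ne_top]
        simp_rw [hsum]
        have hm₁ : Measurable fun x => ∫⁻ y, ENNReal.ofReal (φ y ^ 2) * K x y ∂μ :=
          hm.lintegral_prod_right'
        rw [lintegral_const_mul' _ _ ENNReal.ofReal_ne_top, lintegral_add_left (hm₁.const_mul 2),
          lintegral_const_mul' _ _ ENNReal.ofNat_ne_top,
          lintegral_const_mul' _ _ ENNReal.ofReal_ne_top]
      _ ≤ ENNReal.ofReal (L ^ (-d)) *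
          (2 * (ENNReal.ofReal (2 ^ (a + d) * L ^ a) * (ω * I)) + ENNReal.ofReal M * R) := by
        gcongr
      _ = ENNReal.ofReal (L ^ (-d) * (2 * (2 ^ (a + d) * L ^ a))) * (ω * I) +
          ENNReal.ofReal (L ^ (-d) * M) * R := by
        rw [ENNReal.ofReal_mul (p := L ^ (-d)) (by positivity),
          ENNReal.ofReal_mul (p := L ^ (-d)) (by positivity),
          ENNReal.ofReal_mul (p := 2) (q := 2 ^ (a + d) * L ^ a) two_pos.le, ENNReal.ofReal_ofNat]
        ring
      _ ≤ _ := by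
        gcongr
        refine (ENNReal.ofReal_le_ofReal hLc).trans (le_of_eq ?_)
        rw [one_div, ENNReal.ofReal_inv_of_pos two_pos, ENNReal.ofReal_ofNat]
  have hωI : ω * I ≠ ⊤ := ENNReal.mul_ne_top hωt hfin
  have half : 2⁻¹ * (ω * I) ≤ ENNReal.ofReal (L ^ (-d) * M) * R := by
    have hsplit : ω * I = 2⁻¹ * (ω * I) + 2⁻¹ * (ω * I) := by
      rw [← add_mul, ENNReal.inv_two_add_inv_two, one_mul]
    exact (ENNReal.add_le_add_iff_left (ENNReal.mul_ne_top (by simp) hωI)).1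
      (hsplit.symm.trans_le main)
  rw [ENNReal.ofReal_mul (by positivity), ENNReal.ofReal_inv_of_pos hωr, ENNReal.ofReal_toReal hωt,
    ENNReal.ofReal_mul two_pos.le, ENNReal.ofReal_ofNat]
  calc
    I = ω⁻¹ * (2 * (2⁻¹ * (ω * I))) := by
      rw [← mul_assoc 2, ENNReal.mul_inv_cancel (by simp) (by simp), one_mul, ← mul_assoc,
        ENNReal.inv_mul_cancel hω0 hωt, one_mul]
    _ ≤ ω⁻¹ * (2 * (ENNReal.ofReal (L ^ (-d) * M) * R)) := by gcongr
    _ = _ := by ring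

lemma lintegral_sq_mul_norm_rpow_lt_top {b M r : ℝ} (hb : b < Module.finrank ℝ E) (hr : 0 < r)
    {φ : E → ℝ} (hM : ∀ x, φ x ^ 2 ≤ M) (hsupp : ∀ x, r ≤ ‖x‖ → φ x = 0) :
    ∫⁻ x, ENNReal.ofReal (φ x ^ 2 * ‖x‖ ^ (-b)) ∂μ < ⊤ := by
  calc
    _ ≤ ∫⁻ x, (Metric.ball (0 : E) r).indicator
        (fun x => ENNReal.ofReal M * ENNReal.ofReal (‖x‖ ^ (-b))) x ∂μ := by
      refine lintegral_mono fun x => ?_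
      by_cases hx : ‖x‖ < r
      · have hx' : x ∈ Metric.ball (0 : E) r := by simpa using hx
        rw [Set.indicator_of_mem hx', ← ENNReal.ofReal_mul ((sq_nonneg _).trans (hM x))]
        exact ENNReal.ofReal_le_ofReal (mul_le_mul_of_nonneg_right (hM x) (by positivity))
      · simp [hsupp x (not_lt.1 hx)]
    _ = ENNReal.ofReal M * ∫⁻ x in Metric.ball (0 : E) r, ENNReal.ofReal (‖x‖ ^ (-b)) ∂μ := by
      rw [lintegral_indicator measurableSet_ball, lintegral_const_mul' _ _ ENNReal.ofReal_ne_top]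
    _ < ⊤ := ENNReal.mul_lt_top ENNReal.ofReal_lt_top (setLIntegral_ball_norm_rpow_lt_top μ hb hr)

lemma lintegral_differenceKernel_lt_top {s : ℝ} (hs0 : 0 < s) (hs1 : s < 1) (Λ M : ℝ) :
    ∫⁻ z : E, differenceKernel (Module.finrank ℝ E) s Λ M z ∂μ < ⊤ := by
  unfold differenceKernel
  rw [lintegral_add_left (Measurable.indicator (by fun_prop) measurableSet_ball),
    lintegral_indicator measurableSet_ball, lintegral_indicator measurableSet_ball.compl,
    lintegral_const_mul' _ _ ENNReal.ofReal_ne_top, lintegral_const_mul' _ _ ENNReal.ofReal_ne_top]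
  exact ENNReal.add_lt_top.2
    ⟨ENNReal.mul_lt_top ENNReal.ofReal_lt_top
      (setLIntegral_ball_norm_rpow_lt_top μ (by linarith) one_pos),
    ENNReal.mul_lt_top ENNReal.ofReal_lt_top
      (setLIntegral_compl_ball_norm_rpow_lt_top μ (by linarith) one_pos)⟩

lemma lintegral_difference_norm_rpow_lt_top {s γ Λ M r : ℝ} (hs0 : 0 < s) (hs1 : s < 1)
    (hγ0 : 0 ≤ γ) (hγ : 2 * γ < Module.finrank ℝ E) (hΛ : 0 ≤ Λ) (hM : 0 ≤ M) (hr : 0 < r)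
    {φ : E → ℝ} (h1 : ∀ x y, (φ x - φ y) ^ 2 ≤ Λ * ‖x - y‖ ^ 2)
    (h2 : ∀ x y, (φ x - φ y) ^ 2 ≤ M) (hsupp : ∀ x, r ≤ ‖x‖ → φ x = 0) :
    ∫⁻ x, ∫⁻ y, ENNReal.ofReal ((φ x - φ y) ^ 2 *
      (‖x‖ ^ (-(2 * γ)) * ‖x - y‖ ^ (-((Module.finrank ℝ E : ℝ) + 2 * s)))) ∂μ ∂μ < ⊤ := by
  have hd : (0 : ℝ) ≤ Module.finrank ℝ E := Nat.cast_nonneg _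
  have hk := lintegral_differenceKernel_lt_top μ hs0 hs1 Λ M
  have hfar := setLIntegral_compl_ball_norm_rpow_lt_top μ
    (b := (Module.finrank ℝ E : ℝ) + 2 * s + 2 * γ) (by linarith) (r := 2 * r) (by positivity)
  have hnear := setLIntegral_ball_norm_rpow_lt_top μ hγ (r := 2 * r) (by positivity)
  generalize (Module.finrank ℝ E : ℝ) = d at *
  set k : E → ENNReal := differenceKernel d s Λ M
  have near (x y : E) : ENNReal.ofReal ((φ x - φ y) ^ 2 *
      (‖x‖ ^ (-(2 * γ)) * ‖x - y‖ ^ (-(d + 2 * s)))) ≤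
      ENNReal.ofReal (‖x‖ ^ (-(2 * γ))) * k (x - y) := by
    rw [mul_left_comm, ENNReal.ofReal_mul (by positivity)]
    gcongr
    exact ofReal_sq_mul_le_differenceKernel hΛ hM (h1 x y) (h2 x y)
  have far (x y : E) (hx : 2 * r ≤ ‖x‖) : ENNReal.ofReal ((φ x - φ y) ^ 2 *
      (‖x‖ ^ (-(2 * γ)) * ‖x - y‖ ^ (-(d + 2 * s)))) ≤
      (Metric.ball (0 : E) r).indicator (fun _ => ENNReal.ofReal (M * 2 ^ (d + 2 * s)) *
        ENNReal.ofReal (‖x‖ ^ (-(d + 2 * s + 2 * γ)))) y := by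
    by_cases hy : y ∈ Metric.ball (0 : E) r
    · rw [Set.indicator_of_mem hy, ← ENNReal.ofReal_mul (by positivity)]
      refine ENNReal.ofReal_le_ofReal ?_
      have hx0 : 0 < ‖x‖ := by linarith
      have hy' : ‖y‖ < r := by simpa using hy
      have hxy : ‖x‖ / 2 ≤ ‖x - y‖ := by
        have := norm_sub_norm_le x y
        linarith
      calc
        _ ≤ M * (‖x‖ ^ (-(2 * γ)) * (‖x‖ / 2) ^ (-(d + 2 * s))) := by
          refine mul_le_mul (h2 x y) (mul_le_mul_of_nonneg_left ?_ (by positivity))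
            (by positivity) hM
          exact rpow_le_rpow_of_nonpos (by positivity) hxy (by linarith)
        _ = _ := by
          have : ‖x‖ ^ (-(d + 2 * s + 2 * γ)) = ‖x‖ ^ (-(2 * γ)) * ‖x‖ ^ (-(d + 2 * s)) := by
            rw [← rpow_add hx0]; congr 1; ring
          rw [this, div_rpow hx0.le (by norm_num), rpow_neg (by norm_num : (0 : ℝ) ≤ 2),
            div_inv_eq_mul]
          ring
    · have hy' : r ≤ ‖y‖ := by simpa using hy
      simp [hsupp x (by linarith), hsupp y hy']
  have inner (x : E) : ∫⁻ y, ENNReal.ofReal ((φ x - φ y) ^ 2 *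
      (‖x‖ ^ (-(2 * γ)) * ‖x - y‖ ^ (-(d + 2 * s)))) ∂μ ≤
      (Metric.ball (0 : E) (2 * r)).indicator
        (fun x => ENNReal.ofReal (‖x‖ ^ (-(2 * γ))) * ∫⁻ z, k z ∂μ) x +
      (Metric.ball (0 : E) (2 * r))ᶜ.indicator
        (fun x => ENNReal.ofReal (M * 2 ^ (d + 2 * s)) *
          ENNReal.ofReal (‖x‖ ^ (-(d + 2 * s + 2 * γ))) * μ (Metric.ball 0 r)) x := by
    by_cases hx : x ∈ Metric.ball (0 : E) (2 * r)
    · rw [Set.indicator_of_mem hx, Set.indicator_of_notMem (by simpa using hx), add_zero]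
      refine (lintegral_mono (near x)).trans (le_of_eq ?_)
      rw [lintegral_const_mul' _ _ ENNReal.ofReal_ne_top, lintegral_sub_left_eq_self k x]
    · rw [Set.indicator_of_notMem hx, Set.indicator_of_mem (by simpa using hx), zero_add]
      refine (lintegral_mono fun y => far x y (by simpa using hx)).trans (le_of_eq ?_)
      rw [lintegral_indicator_const measurableSet_ball]
  refine (lintegral_mono inner).trans_lt ?_
  rw [lintegral_add_left (Measurable.indicator (by fun_prop) measurableSet_ball),
    lintegral_indicator measurableSet_ball, lintegral_indicator measurableSet_ball.compl,
    lintegral_mul_const' _ _ hk.ne, lintegral_mul_const' _ _ measure_ball_lt_top.ne,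
    lintegral_const_mul' _ _ ENNReal.ofReal_ne_top]
  exact ENNReal.add_lt_top.2 ⟨ENNReal.mul_lt_top hnear hk,
    ENNReal.mul_lt_top (ENNReal.mul_lt_top ENNReal.ofReal_lt_top hfar) measure_ball_lt_top⟩

theorem lintegral_weighted_gagliardo_lt_top {s γ Λ M r : ℝ} (hs0 : 0 < s) (hs1 : s < 1)
    (hγ0 : 0 ≤ γ) (hγ : 2 * γ < Module.finrank ℝ E) (hΛ : 0 ≤ Λ) (hM : 0 ≤ M) (hr : 0 < r)
    {φ : E → ℝ} (hφ : Measurable φ) (h1 : ∀ x y, (φ x - φ y) ^ 2 ≤ Λ * ‖x - y‖ ^ 2)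
    (h2 : ∀ x y, (φ x - φ y) ^ 2 ≤ M) (hsupp : ∀ x, r ≤ ‖x‖ → φ x = 0) :
    ∫⁻ x, ∫⁻ y, ENNReal.ofReal ((φ x - φ y) ^ 2 *
      (‖x‖ ^ (-γ) * ‖y‖ ^ (-γ) * ‖x - y‖ ^ (-((Module.finrank ℝ E : ℝ) + 2 * s)))) ∂μ ∂μ < ⊤ := by
  have hfin := lintegral_difference_norm_rpow_lt_top μ hs0 hs1 hγ0 hγ hΛ hM hr h1 h2 hsupp
  generalize (Module.finrank ℝ E : ℝ) = d at *
  set H : E → E → ENNReal := fun x y => ENNReal.ofReal ((φ x - φ y) ^ 2 *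
    (‖x‖ ^ (-(2 * γ)) * ‖x - y‖ ^ (-(d + 2 * s)))) with hH
  have hHm : Measurable (Function.uncurry H) := by
    simp only [hH, Function.uncurry_def]; fun_prop
  have hHm' : Measurable (Function.uncurry fun x y => H y x) := hHm.comp measurable_swap
  have hsq (x : E) : ‖x‖ ^ (-(2 * γ)) = (‖x‖ ^ (-γ)) ^ 2 := by
    rw [← rpow_natCast, ← rpow_mul (norm_nonneg x)]; congr 1; push_cast; ring
  have real_pointwise (x y : E) : (φ x - φ y) ^ 2 *
      (‖x‖ ^ (-γ) * ‖y‖ ^ (-γ) * ‖x - y‖ ^ (-(d + 2 * s))) ≤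
      (φ x - φ y) ^ 2 * (‖x‖ ^ (-(2 * γ)) * ‖x - y‖ ^ (-(d + 2 * s))) +
      (φ y - φ x) ^ 2 * (‖y‖ ^ (-(2 * γ)) * ‖y - x‖ ^ (-(d + 2 * s))) := by
    rw [norm_sub_rev y x, hsq, hsq, ← neg_sub (φ x) (φ y), neg_sq, ← mul_add, ← add_mul]
    have hx : 0 ≤ ‖x‖ ^ (-γ) := by positivity
    have hy : 0 ≤ ‖y‖ ^ (-γ) := by positivity
    have hxy : ‖x‖ ^ (-γ) * ‖y‖ ^ (-γ) ≤ (‖x‖ ^ (-γ)) ^ 2 + (‖y‖ ^ (-γ)) ^ 2 := by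
      nlinarith [sq_nonneg (‖x‖ ^ (-γ) - ‖y‖ ^ (-γ))]
    gcongr
  have pointwise (x y : E) : ENNReal.ofReal ((φ x - φ y) ^ 2 *
      (‖x‖ ^ (-γ) * ‖y‖ ^ (-γ) * ‖x - y‖ ^ (-(d + 2 * s)))) ≤ H x y + H y x :=
    (ENNReal.ofReal_le_ofReal (real_pointwise x y)).trans ENNReal.ofReal_add_le
  change ∫⁻ x, ∫⁻ y, H x y ∂μ ∂μ < ⊤ at hfin
  clear_value H
  calc
    _ ≤ ∫⁻ x, ∫⁻ y, (H x y + H y x) ∂μ ∂μ := by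
      gcongr with x y
      exact pointwise x y
    _ = ∫⁻ x, ∫⁻ y, H x y ∂μ ∂μ + ∫⁻ x, ∫⁻ y, H y x ∂μ ∂μ := by
      have hm : Measurable fun x => ∫⁻ y, H x y ∂μ := hHm.lintegral_prod_right'
      have hmx (x : E) : Measurable fun y => H x y := hHm.comp measurable_prodMk_left
      rw [← lintegral_add_left hm]
      simp_rw [lintegral_add_left (hmx _)]
    _ < ⊤ := by
      rw [lintegral_lintegral_swap hHm'.aemeasurable]
      exact ENNReal.add_lt_top.2 ⟨hfin, hfin⟩

end NormPowers

/-- **Weighted fractional Hardy inequality on `ℝ^N`**: for `0 < s < 1`, `N > 2s`,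
`0 < γ < (N-2s)/2`, there is `C = C(N,s,γ) > 0` such that for all `φ ∈ C_c^∞(ℝ^N)`,
`C ∫ φ² |x|^{-(2s+2γ)} dx ≤ ∫∫ (φ(x)-φ(y))² |x|^{-γ}|y|^{-γ}|x-y|^{-(N+2s)} dx dy`. -/
theorem weighted_hardy_Rn (N : ℕ) (s γ : ℝ) (hs0 : 0 < s) (hs1 : s < 1)
    (hN : 2 * s < (N : ℝ)) (hγ0 : 0 < γ) (hγ : γ < ((N : ℝ) - 2 * s) / 2) :
    ∃ C : ℝ, 0 < C ∧ ∀ φ : EuclideanSpace ℝ (Fin N) → ℝ,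
      ContDiff ℝ (⊤ : ℕ∞) φ → HasCompactSupport φ →
      C * ∫ x : EuclideanSpace ℝ (Fin N), φ x ^ 2 * ‖x‖ ^ (-(2 * s + 2 * γ)) ≤
        ∫ x : EuclideanSpace ℝ (Fin N), ∫ y : EuclideanSpace ℝ (Fin N),
          (φ x - φ y) ^ 2 * (‖x‖ ^ (-γ) * ‖y‖ ^ (-γ) * ‖x - y‖ ^ (-((N : ℝ) + 2 * s))) := by
  have hN0 : 0 < N := by
    have : (0 : ℝ) < N := by linarith
    exact_mod_cast this
  have : Nonempty (Fin N) := ⟨⟨0, hN0⟩⟩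
  have hdim : Module.finrank ℝ (EuclideanSpace ℝ (Fin N)) = N := by simp
  obtain ⟨C, hC, hardy⟩ := exists_lintegral_hardy
    (volume : Measure (EuclideanSpace ℝ (Fin N))) hs0 hγ0 (by rw [hdim]; linarith)
  refine ⟨C⁻¹, inv_pos.2 hC, fun φ hφ hφc => ?_⟩
  have hφm : Measurable φ := hφ.continuous.measurable
  obtain ⟨K, hK⟩ := ContDiff.lipschitzWith_of_hasCompactSupport hφc hφ (by simp)
  obtain ⟨B, hB⟩ := hφc.exists_bound_of_continuous hφ.continuous
  obtain ⟨r, hr, hsupp⟩ := hφc.exists_pos_le_norm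
  have h1 (x y) : (φ x - φ y) ^ 2 ≤ (K : ℝ) ^ 2 * ‖x - y‖ ^ 2 := by
    have := hK.norm_sub_le x y
    rw [← mul_pow, ← sq_abs]
    exact pow_le_pow_left₀ (abs_nonneg _) this 2
  have h2 (x y) : (φ x - φ y) ^ 2 ≤ (2 * B) ^ 2 := by
    have := abs_sub (φ x) (φ y)
    rw [← sq_abs]
    exact pow_le_pow_left₀ (abs_nonneg _)
      (this.trans (by linarith [hB x, hB y, Real.norm_eq_abs (φ x), Real.norm_eq_abs (φ y)])) 2
  have h3 (x) : φ x ^ 2 ≤ B ^ 2 := by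
    rw [← sq_abs]
    exact pow_le_pow_left₀ (abs_nonneg _) (hB x) 2
  have hI := lintegral_sq_mul_norm_rpow_lt_top volume (b := 2 * s + 2 * γ)
    (by rw [hdim]; linarith) hr h3 hsupp
  have hR := lintegral_weighted_gagliardo_lt_top volume hs0 hs1 hγ0.le (by rw [hdim]; linarith)
    (sq_nonneg _) (sq_nonneg _) hr hφm h1 h2 hsupp
  have hle := hardy φ hφm hI.ne
  rw [hdim] at hR hle
  have hLm : Measurable fun x => φ x ^ 2 * ‖x‖ ^ (-(2 * s + 2 * γ)) := by fun_prop
  have hFm : Measurable (Function.uncurry fun x y => (φ x - φ y) ^ 2 *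
      (‖x‖ ^ (-γ) * ‖y‖ ^ (-γ) * ‖x - y‖ ^ (-((N : ℝ) + 2 * s)))) := by
    simp only [Function.uncurry_def]; fun_prop
  have hL : ∫ x, φ x ^ 2 * ‖x‖ ^ (-(2 * s + 2 * γ)) =
      (∫⁻ x, ENNReal.ofReal (φ x ^ 2 * ‖x‖ ^ (-(2 * s + 2 * γ)))).toReal :=
    integral_eq_lintegral_of_nonneg_ae (.of_forall fun x => by positivity)
      hLm.aestronglyMeasurable
  have hinner (x) : ∫ y, (φ x - φ y) ^ 2 *
      (‖x‖ ^ (-γ) * ‖y‖ ^ (-γ) * ‖x - y‖ ^ (-((N : ℝ) + 2 * s))) =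
      (∫⁻ y, ENNReal.ofReal ((φ x - φ y) ^ 2 *
        (‖x‖ ^ (-γ) * ‖y‖ ^ (-γ) * ‖x - y‖ ^ (-((N : ℝ) + 2 * s))))).toReal :=
    integral_eq_lintegral_of_nonneg_ae (.of_forall fun y => by positivity)
      (hFm.comp measurable_prodMk_left).aestronglyMeasurable
  have hGm : Measurable fun x => ∫⁻ y, ENNReal.ofReal ((φ x - φ y) ^ 2 *
      (‖x‖ ^ (-γ) * ‖y‖ ^ (-γ) * ‖x - y‖ ^ (-((N : ℝ) + 2 * s)))) :=
    hFm.ennreal_ofReal.lintegral_prod_right'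
  simp_rw [hinner]
  rw [hL, integral_toReal hGm.aemeasurable (ae_lt_top hGm hR.ne), inv_mul_le_iff₀ hC]
  refine (ENNReal.toReal_mono (ENNReal.mul_ne_top ENNReal.ofReal_ne_top hR.ne) hle).trans ?_
  rw [ENNReal.toReal_mul, ENNReal.toReal_ofReal hC.le]

end
end

section
/- Let 0<s<1, let N be an integer with N>2s, let 0 < γ < (N-2s)/2, and let Ω ⊂ ℝ^N be a bounded open set with C^{1,1} boundary. There exists a constant C = C(Ω,N,s,γ) > 0 such that for every measurable φ : Ω → ℝ with ‖φ‖_{Y^{s,γ}(Ω)} < ∞, C ∫_Ω φ(x)² |x|^{-(2s+2γ)} dx ≤ ∫_Ω ∫_Ω (φ(x)-φ(y))² dν + ∫_Ω φ(x)² dμ. -/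
open MeasureTheory Real Filter

noncomputable section

/-- Near a point of its closure, a `C^{1,1}` domain contains balls of radius comparable to the
distance of their centre to that point. -/
lemma IsC11Domain.exists_ball_subset {N : ℕ} {Ω : Set (EuclideanSpace ℝ (Fin N))}
    (hΩ : IsC11Domain Ω) (h0 : (0 : EuclideanSpace ℝ (Fin N)) ∈ closure Ω) :
    ∃ (v : EuclideanSpace ℝ (Fin N)) (δ R : ℝ), 0 < δ ∧ 0 < R ∧ ∀ t : ℝ, 0 < t → t ≤ R →
      Metric.ball (t • v) (t * δ) ⊆ Ω ∩ Metric.ball 0 t := by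
  obtain ⟨hopen, -, hbd⟩ := hΩ
  by_cases hmem : (0 : EuclideanSpace ℝ (Fin N)) ∈ Ω
  · obtain ⟨R, hR, hsub⟩ := Metric.isOpen_iff.1 hopen 0 hmem
    refine ⟨0, 1, R, one_pos, hR, fun t ht htR => ?_⟩
    rw [smul_zero, mul_one]
    exact Set.subset_inter ((Metric.ball_subset_ball htR).trans hsub) subset_rfl
  have hfr : (0 : EuclideanSpace ℝ (Fin N)) ∈ frontier Ω := by
    rw [hopen.frontier_eq]
    exact ⟨h0, hmem⟩
  obtain ⟨r, hr, ψ, -, hψ, -, hgrad, hloc⟩ := hbd 0 hfr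
  have hψ_iff : ∀ x ∈ Metric.ball (0 : EuclideanSpace ℝ (Fin N)) r, x ∈ Ω ↔ ψ x < 0 := by
    intro x hx
    have := Set.ext_iff.1 hloc x
    simp only [Set.mem_inter_iff, Set.mem_ofPred_eq] at this
    tauto
  have h0ball : (0 : EuclideanSpace ℝ (Fin N)) ∈ Metric.ball (0 : EuclideanSpace ℝ (Fin N)) r :=
    Metric.mem_ball_self hr
  have hψ0 : ψ 0 = 0 := by
    refine le_antisymm ?_ (not_lt.1 fun h => hmem ((hψ_iff 0 h0ball).2 h))
    have hcl : (0 : EuclideanSpace ℝ (Fin N)) ∈ closure (Ω ∩ Metric.ball 0 r) := by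
      have := Metric.isOpen_ball.inter_closure (s := Metric.ball (0 : EuclideanSpace ℝ (Fin N)) r)
        (t := Ω) ⟨h0ball, h0⟩
      rwa [Set.inter_comm] at this
    have hclosed : IsClosed {x | ψ x ≤ 0} := isClosed_le hψ.continuous continuous_const
    refine closure_minimal ?_ hclosed hcl
    rintro x ⟨hxΩ, hxr⟩
    exact ((hψ_iff x hxr).1 hxΩ).le
  set l := fderiv ℝ ψ 0 with hl
  have hl0 : l ≠ 0 := hgrad 0 h0ball hψ0
  obtain ⟨w, hw⟩ : ∃ w, l w < 0 := by
    obtain ⟨w, hw⟩ : ∃ w, l w ≠ 0 := by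
      by_contra! h
      exact hl0 (ContinuousLinearMap.ext h)
    rcases lt_or_gt_of_ne hw with h | h
    · exact ⟨w, h⟩
    · exact ⟨-w, by simpa using h⟩
  have hw_norm : 0 < ‖w‖ := norm_pos_iff.2 fun h => by simp [h] at hw
  set v := (1 / (2 * ‖w‖)) • w with hv
  have hv_norm : ‖v‖ = 1 / 2 := by
    rw [hv, norm_smul, Real.norm_of_nonneg (by positivity)]
    field_simp
  obtain ⟨m, hm, hlv⟩ : ∃ m, 0 < m ∧ l v = -m := by
    refine ⟨-l v, ?_, by ring⟩
    rw [hv, map_smul, smul_eq_mul, ← mul_neg]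
    exact mul_pos (by positivity) (by linarith)
  have hder : HasFDerivAt ψ l 0 := (hψ.differentiable one_ne_zero).differentiableAt.hasFDerivAt
  obtain ⟨ρ, hρ, hlin⟩ := Metric.eventually_nhds_iff_ball.1
    ((hasFDerivAt_iff_isLittleO_nhds_zero.1 hder).def (c := m / 4) (by positivity))
  refine ⟨v, min (1 / 2) (m / (2 * (‖l‖ + 1))), min r ρ, by positivity, by positivity,
    fun t ht htR x hx => ?_⟩
  have hxv : ‖x - t • v‖ < t * min (1 / 2) (m / (2 * (‖l‖ + 1))) := by
    simpa [dist_eq_norm] using hx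
  have hx1 : ‖x - t • v‖ < t * (1 / 2) :=
    hxv.trans_le (mul_le_mul_of_nonneg_left (min_le_left _ _) ht.le)
  have hx2 : ‖x - t • v‖ ≤ t * (m / (2 * (‖l‖ + 1))) :=
    hxv.le.trans (mul_le_mul_of_nonneg_left (min_le_right _ _) ht.le)
  have hxt : ‖x‖ < t := by
    have h1 := norm_add_le (x - t • v) (t • v)
    rw [sub_add_cancel, norm_smul, hv_norm, Real.norm_of_nonneg ht.le] at h1
    linarith
  have hxr : x ∈ Metric.ball (0 : EuclideanSpace ℝ (Fin N)) r := by
    simpa using hxt.trans_le (htR.trans (min_le_left _ _))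
  have hxρ : x ∈ Metric.ball (0 : EuclideanSpace ℝ (Fin N)) ρ := by
    simpa using hxt.trans_le (htR.trans (min_le_right _ _))
  refine ⟨(hψ_iff x hxr).2 ?_, by simpa using hxt⟩
  have h1 := hlin x hxρ
  rw [zero_add, hψ0, sub_zero, Real.norm_eq_abs] at h1
  have h2 := (abs_le.1 h1).2
  have h3 : l x = l (x - t • v) - t * m := by
    rw [map_sub, map_smul, hlv, smul_eq_mul]
    ring
  have h4 : l (x - t • v) ≤ t * m / 2 := by
    calc l (x - t • v) ≤ ‖l‖ * ‖x - t • v‖ := (le_abs_self _).trans (l.le_opNorm _)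
      _ ≤ (‖l‖ + 1) * (t * (m / (2 * (‖l‖ + 1)))) := by gcongr; linarith
      _ = t * m / 2 := by field_simp
  have h5 : m / 4 * ‖x‖ ≤ m / 4 * t := by gcongr
  nlinarith [mul_pos hm ht]

/-- Near a point of its closure, a `C^{1,1}` domain has positive lower volume density. -/
lemma IsC11Domain.exists_le_volume_inter_ball {N : ℕ} {Ω : Set (EuclideanSpace ℝ (Fin N))}
    (hΩ : IsC11Domain Ω) (h0 : (0 : EuclideanSpace ℝ (Fin N)) ∈ closure Ω) :
    ∃ c R : ℝ, 0 < c ∧ 0 < R ∧ ∀ t : ℝ, 0 < t → t ≤ R →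
      ENNReal.ofReal (c * t ^ N) ≤ volume (Ω ∩ Metric.ball 0 t) := by
  obtain ⟨v, δ, R, hδ, hR, hsub⟩ := hΩ.exists_ball_subset h0
  have hω : 0 < (volume (Metric.ball (0 : EuclideanSpace ℝ (Fin N)) 1)).toReal :=
    ENNReal.toReal_pos (Metric.measure_ball_pos _ _ one_pos).ne' measure_ball_lt_top.ne
  refine ⟨δ ^ N * (volume (Metric.ball (0 : EuclideanSpace ℝ (Fin N)) 1)).toReal, R,
    by positivity, hR, fun t ht htR => le_trans (le_of_eq ?_) (measure_mono (hsub t ht htR))⟩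
  rw [Measure.addHaar_ball_of_pos _ (t • v) (show 0 < t * δ by positivity), finrank_euclideanSpace_fin,
    show δ ^ N * (volume (Metric.ball (0 : EuclideanSpace ℝ (Fin N)) 1)).toReal * t ^ N =
      (t * δ) ^ N * (volume (Metric.ball (0 : EuclideanSpace ℝ (Fin N)) 1)).toReal by ring,
    ENNReal.ofReal_mul (by positivity), ENNReal.ofReal_toReal measure_ball_lt_top.ne]

lemma measure_mul_setLIntegral_sq_le {α : Type*} [MeasurableSpace α] (μ : Measure α) [SFinite μ]
    (A B : Set α) {u : α → ℝ} (hu : Measurable u) :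
    μ B * ∫⁻ x in A, ENNReal.ofReal (u x ^ 2) ∂μ ≤
      2 * (μ A * ∫⁻ y in B, ENNReal.ofReal (u y ^ 2) ∂μ) +
        2 * ∫⁻ x in A, ∫⁻ y in B, ENNReal.ofReal ((u x - u y) ^ 2) ∂μ ∂μ := by
  have hpt : ∀ x y, ENNReal.ofReal (u x ^ 2) ≤
      2 * ENNReal.ofReal (u y ^ 2) + 2 * ENNReal.ofReal ((u x - u y) ^ 2) := by
    intro x y
    rw [show (2 : ENNReal) = ENNReal.ofReal 2 by simp, ← ENNReal.ofReal_mul zero_le_two,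
      ← ENNReal.ofReal_mul zero_le_two, ← ENNReal.ofReal_add (by positivity) (by positivity)]
    exact ENNReal.ofReal_le_ofReal (by nlinarith [sq_nonneg (u x - 2 * u y)])
  calc μ B * ∫⁻ x in A, ENNReal.ofReal (u x ^ 2) ∂μ
      = ∫⁻ x in A, ∫⁻ _ in B, ENNReal.ofReal (u x ^ 2) ∂μ ∂μ := by
        simp only [setLIntegral_const]
        rw [lintegral_mul_const _ (by fun_prop), mul_comm]
    _ ≤ ∫⁻ x in A, ∫⁻ y in B, (2 * ENNReal.ofReal (u y ^ 2) +
          2 * ENNReal.ofReal ((u x - u y) ^ 2)) ∂μ ∂μ :=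
        lintegral_mono fun x => lintegral_mono fun y => hpt x y
    _ = ∫⁻ x in A, (2 * ∫⁻ y in B, ENNReal.ofReal (u y ^ 2) ∂μ +
          2 * ∫⁻ y in B, ENNReal.ofReal ((u x - u y) ^ 2) ∂μ) ∂μ := by
        refine lintegral_congr fun x => ?_
        rw [lintegral_add_left (by fun_prop), lintegral_const_mul _ (by fun_prop),
          lintegral_const_mul _ (by fun_prop)]
    _ = _ := by
        rw [lintegral_add_left measurable_const, setLIntegral_const, lintegral_const_mul _
          (Measurable.lintegral_prod_right (by fun_prop))]
        ring

lemma tsum_le_of_two_mul_succ_le {H E : ℕ → ENNReal}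
    (h : ∀ k, 2 * H (k + 1) ≤ H k + E k) : ∑' k, H k ≤ 2 * H 0 + ∑' k, E k := by
  have hsum : ∀ n, ∑ k ∈ Finset.range (n + 1), H k + H n ≤
      2 * H 0 + ∑ k ∈ Finset.range n, E k := by
    intro n
    induction n with
    | zero => simp [two_mul]
    | succ n ih =>
      calc ∑ k ∈ Finset.range (n + 1 + 1), H k + H (n + 1)
          = ∑ k ∈ Finset.range (n + 1), H k + 2 * H (n + 1) := by
            rw [Finset.sum_range_succ]
            ring
        _ ≤ ∑ k ∈ Finset.range (n + 1), H k + (H n + E n) := by gcongr; exact h n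
        _ ≤ 2 * H 0 + ∑ k ∈ Finset.range n, E k + E n := by
            rw [← add_assoc]
            gcongr
        _ = _ := by rw [Finset.sum_range_succ, add_assoc]
  rw [ENNReal.tsum_eq_iSup_nat]
  refine iSup_le fun n => ?_
  calc ∑ k ∈ Finset.range n, H k ≤ ∑ k ∈ Finset.range (n + 1), H k :=
        Finset.sum_le_sum_of_subset (Finset.range_mono n.le_succ)
    _ ≤ _ := le_self_add
    _ ≤ _ := hsum n
    _ ≤ _ := by gcongr; exact ENNReal.sum_le_tsum _

lemma setLIntegral_sq_sub_le_kernel {N : ℕ} {s γ r : ℝ} (hs : 0 < s) (hγ : 0 < γ) (hr : 0 < r)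
    {A B : Set (EuclideanSpace ℝ (Fin N))} (hA : MeasurableSet A) (hB : MeasurableSet B)
    (hA0 : ∀ x ∈ A, 0 < ‖x‖ ∧ ‖x‖ ≤ r) (hB0 : ∀ x ∈ B, 0 < ‖x‖ ∧ ‖x‖ ≤ r) (hAB : Disjoint A B)
    (φ : EuclideanSpace ℝ (Fin N) → ℝ) :
    ∫⁻ x in A, ∫⁻ y in B, ENNReal.ofReal ((φ x - φ y) ^ 2) ≤
      ENNReal.ofReal (2 ^ ((N : ℝ) + 2 * s) * r ^ ((N : ℝ) + (2 * s + 2 * γ))) *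
        ∫⁻ x in A, ∫⁻ y in B, ENNReal.ofReal ((φ x - φ y) ^ 2 *
          (‖x‖ ^ (-γ) * ‖y‖ ^ (-γ) * ‖x - y‖ ^ (-((N : ℝ) + 2 * s)))) := by
  rw [← lintegral_const_mul' _ _ ENNReal.ofReal_ne_top]
  refine setLIntegral_mono' hA fun x hx => ?_
  rw [← lintegral_const_mul' _ _ ENNReal.ofReal_ne_top]
  refine setLIntegral_mono' hB fun y hy => ?_
  rw [← ENNReal.ofReal_mul (by positivity)]
  refine ENNReal.ofReal_le_ofReal ?_
  obtain ⟨hx0, hxr⟩ := hA0 x hx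
  obtain ⟨hy0, hyr⟩ := hB0 y hy
  have hxy0 : 0 < ‖x - y‖ := norm_pos_iff.2 (sub_ne_zero.2 (hAB.ne_of_mem hx hy))
  have hxyr : ‖x - y‖ ≤ 2 * r := (norm_sub_le x y).trans (by linarith)
  have h1 : r ^ (-γ) ≤ ‖x‖ ^ (-γ) := rpow_le_rpow_of_nonpos hx0 hxr (by linarith)
  have h2 : r ^ (-γ) ≤ ‖y‖ ^ (-γ) := rpow_le_rpow_of_nonpos hy0 hyr (by linarith)
  have h3 : (2 * r) ^ (-((N : ℝ) + 2 * s)) ≤ ‖x - y‖ ^ (-((N : ℝ) + 2 * s)) :=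
    rpow_le_rpow_of_nonpos hxy0 hxyr (by have := N.cast_nonneg (α := ℝ); linarith)
  have hone : 2 ^ ((N : ℝ) + 2 * s) * r ^ ((N : ℝ) + (2 * s + 2 * γ)) *
      (r ^ (-γ) * r ^ (-γ) * (2 * r) ^ (-((N : ℝ) + 2 * s))) = 1 := by
    rw [mul_rpow zero_le_two hr.le, rpow_neg zero_le_two]
    have : r ^ ((N : ℝ) + (2 * s + 2 * γ)) *
        (r ^ (-γ) * r ^ (-γ) * r ^ (-((N : ℝ) + 2 * s))) = 1 := by
      rw [← rpow_add hr, ← rpow_add hr, ← rpow_add hr]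
      ring_nf
      exact rpow_zero r
    calc _ = (2 : ℝ) ^ ((N : ℝ) + 2 * s) * (2 ^ ((N : ℝ) + 2 * s))⁻¹ *
          (r ^ ((N : ℝ) + (2 * s + 2 * γ)) *
            (r ^ (-γ) * r ^ (-γ) * r ^ (-((N : ℝ) + 2 * s)))) := by ring
      _ = 1 := by rw [this, mul_inv_cancel₀ (by positivity), mul_one]
  calc (φ x - φ y) ^ 2
      = (φ x - φ y) ^ 2 * (2 ^ ((N : ℝ) + 2 * s) * r ^ ((N : ℝ) + (2 * s + 2 * γ)) *
        (r ^ (-γ) * r ^ (-γ) * (2 * r) ^ (-((N : ℝ) + 2 * s)))) := by rw [hone, mul_one]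
    _ ≤ (φ x - φ y) ^ 2 * (2 ^ ((N : ℝ) + 2 * s) * r ^ ((N : ℝ) + (2 * s + 2 * γ)) *
        (‖x‖ ^ (-γ) * ‖y‖ ^ (-γ) * ‖x - y‖ ^ (-((N : ℝ) + 2 * s)))) := by gcongr
    _ = _ := by ring

/-- Comparison of the weighted `L²` masses on two consecutive shells. -/
lemma two_mul_shell_le {N : ℕ} {s γ c q ω r : ℝ} (hs : 0 < s) (hγ : 0 < γ) (hc : 0 < c)
    (hq : 0 < q) (hω : 0 ≤ ω) (hr : 0 < r)
    (hqω : 4 * ω * q ^ ((N : ℝ) - (2 * s + 2 * γ)) ≤ c)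
    {A B : Set (EuclideanSpace ℝ (Fin N))} (hA : MeasurableSet A) (hB : MeasurableSet B)
    (hA0 : ∀ x ∈ A, 0 < ‖x‖ ∧ ‖x‖ ≤ r) (hB0 : ∀ x ∈ B, 0 < ‖x‖ ∧ ‖x‖ ≤ r) (hAB : Disjoint A B)
    (hAvol : volume A ≤ ENNReal.ofReal (ω * (q * r) ^ N))
    (hBvol : ENNReal.ofReal (c * r ^ N) ≤ volume B)
    {φ : EuclideanSpace ℝ (Fin N) → ℝ} (hφ : Measurable φ) :
    2 * (ENNReal.ofReal ((q * r) ^ (-(2 * s + 2 * γ))) * ∫⁻ x in A, ENNReal.ofReal (φ x ^ 2)) ≤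
      ENNReal.ofReal (r ^ (-(2 * s + 2 * γ))) * (∫⁻ x in B, ENNReal.ofReal (φ x ^ 2)) +
      ENNReal.ofReal (4 / c * 2 ^ ((N : ℝ) + 2 * s) * q ^ (-(2 * s + 2 * γ))) *
        ∫⁻ x in A, ∫⁻ y in B, ENNReal.ofReal ((φ x - φ y) ^ 2 *
          (‖x‖ ^ (-γ) * ‖y‖ ^ (-γ) * ‖x - y‖ ^ (-((N : ℝ) + 2 * s)))) := by
  set a := 2 * s + 2 * γ with ha
  have hstep := measure_mul_setLIntegral_sq_le volume A B hφ
  have hker := setLIntegral_sq_sub_le_kernel hs hγ hr hA hB hA0 hB0 hAB φ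
  rw [← ha] at hker
  set D := ∫⁻ x in A, ∫⁻ y in B, ENNReal.ofReal ((φ x - φ y) ^ 2 *
          (‖x‖ ^ (-γ) * ‖y‖ ^ (-γ) * ‖x - y‖ ^ (-((N : ℝ) + 2 * s))))
  set GA := ∫⁻ x in A, ENNReal.ofReal (φ x ^ 2)
  set GB := ∫⁻ x in B, ENNReal.ofReal (φ x ^ 2)
  have hmul : ENNReal.ofReal (c * r ^ N) * GA ≤ ENNReal.ofReal (2 * (ω * (q * r) ^ N)) * GB +
      ENNReal.ofReal (2 * (2 ^ ((N : ℝ) + 2 * s) * r ^ ((N : ℝ) + a))) * D := by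
    rw [ENNReal.ofReal_mul (p := 2) zero_le_two, ENNReal.ofReal_mul (p := 2) zero_le_two,
      ENNReal.ofReal_ofNat, mul_assoc, mul_assoc]
    calc ENNReal.ofReal (c * r ^ N) * GA ≤ volume B * GA := by gcongr
      _ ≤ _ := hstep
      _ ≤ _ := by gcongr
  calc 2 * (ENNReal.ofReal ((q * r) ^ (-a)) * GA)
      = ENNReal.ofReal (2 * (q * r) ^ (-a) / (c * r ^ N)) *
          (ENNReal.ofReal (c * r ^ N) * GA) := by
        rw [← mul_assoc, ← mul_assoc, ← ENNReal.ofReal_mul (by positivity),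
          div_mul_cancel₀ _ (by positivity), ENNReal.ofReal_mul zero_le_two, ENNReal.ofReal_ofNat]
    _ ≤ ENNReal.ofReal (2 * (q * r) ^ (-a) / (c * r ^ N)) *
          (ENNReal.ofReal (2 * (ω * (q * r) ^ N)) * GB +
      ENNReal.ofReal (2 * (2 ^ ((N : ℝ) + 2 * s) * r ^ ((N : ℝ) + a))) * D) := by gcongr
    _ = ENNReal.ofReal (2 * (q * r) ^ (-a) / (c * r ^ N) * (2 * (ω * (q * r) ^ N))) * GB +
        ENNReal.ofReal (2 * (q * r) ^ (-a) / (c * r ^ N) *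
          (2 * (2 ^ ((N : ℝ) + 2 * s) * r ^ ((N : ℝ) + a)))) * D := by
        have assoc : ∀ p q X, 0 ≤ p →
            ENNReal.ofReal p * (ENNReal.ofReal q * X) = ENNReal.ofReal (p * q) * X := by
          intro p q X hp
          rw [← mul_assoc, ← ENNReal.ofReal_mul hp]
        rw [mul_add, assoc _ _ _ (by positivity), assoc _ _ _ (by positivity)]
    _ ≤ _ := by
        refine add_le_add (mul_le_mul' (ENNReal.ofReal_le_ofReal ?_) le_rfl)
          (mul_le_mul' (ENNReal.ofReal_le_ofReal ?_) le_rfl)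
        · rw [mul_rpow hq.le hr.le, mul_pow]
          have h1 : q ^ ((N : ℝ) - a) = q ^ (-a) * q ^ N := by
            rw [← rpow_natCast q N, ← rpow_add hq]
            ring_nf
          rw [h1] at hqω
          have h2 : 2 * (q ^ (-a) * r ^ (-a)) / (c * r ^ N) * (2 * (ω * (q ^ N * r ^ N))) =
              (4 * ω * (q ^ (-a) * q ^ N)) / c * r ^ (-a) := by
            field_simp
            ring
          rw [h2]
          exact mul_le_of_le_one_left (by positivity) ((div_le_one hc).2 hqω)
        · refine le_of_eq ?_
          have h1 : r ^ ((N : ℝ) + a) * r ^ (-a) = r ^ N := by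
            rw [← rpow_add hr, add_neg_cancel_right, rpow_natCast]
          rw [mul_rpow hq.le hr.le]
          calc _ = 4 / c * 2 ^ ((N : ℝ) + 2 * s) * q ^ (-a) *
                (r ^ ((N : ℝ) + a) * r ^ (-a) / r ^ N) := by
                field_simp
                ring
            _ = _ := by rw [h1, div_self (by positivity), mul_one]

/-- The weighted Hardy inequality near the origin, for an open set with positive lower volume
density there. -/
lemma exists_hardy_ball {N : ℕ} {s γ c R : ℝ} (hs : 0 < s) (hγ : 0 < γ)
    (hN : 2 * s + 2 * γ < N) (hc : 0 < c) (hR : 0 < R) {Ω : Set (EuclideanSpace ℝ (Fin N))}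
    (hΩ : MeasurableSet Ω)
    (hvol : ∀ t : ℝ, 0 < t → t ≤ R →
      ENNReal.ofReal (c * t ^ N) ≤ volume (Ω ∩ Metric.ball 0 t)) :
    ∃ C₁ C₂ : ℝ, 0 ≤ C₁ ∧ 0 ≤ C₂ ∧ ∀ φ : EuclideanSpace ℝ (Fin N) → ℝ, Measurable φ →
      ∫⁻ x in Ω ∩ Metric.ball 0 R, ENNReal.ofReal (φ x ^ 2 * ‖x‖ ^ (-(2 * s + 2 * γ))) ≤
        ENNReal.ofReal C₁ * (∫⁻ x in Ω, ENNReal.ofReal (φ x ^ 2 * ‖x‖ ^ (-(2 * γ)))) +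
        ENNReal.ofReal C₂ * ∫⁻ x in Ω, ∫⁻ y in Ω, ENNReal.ofReal ((φ x - φ y) ^ 2 *
          (‖x‖ ^ (-γ) * ‖y‖ ^ (-γ) * ‖x - y‖ ^ (-((N : ℝ) + 2 * s)))) := by
  set a := 2 * s + 2 * γ with ha
  have ha0 : 0 < a := by positivity
  set ω := (volume (Metric.ball (0 : EuclideanSpace ℝ (Fin N)) 1)).toReal with hωdef
  have hω : 0 < ω :=
    ENNReal.toReal_pos (Metric.measure_ball_pos _ _ one_pos).ne' measure_ball_lt_top.ne
  have hball : ∀ t : ℝ, 0 < t →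
      volume (Metric.ball (0 : EuclideanSpace ℝ (Fin N)) t) = ENNReal.ofReal (ω * t ^ N) := by
    intro t ht
    rw [Measure.addHaar_ball_of_pos _ _ ht, finrank_euclideanSpace_fin, mul_comm ω,
      ENNReal.ofReal_mul (by positivity), hωdef, ENNReal.ofReal_toReal measure_ball_lt_top.ne]
  have hNa : 0 < (N : ℝ) - a := by linarith
  obtain ⟨q, hq, hq1, hqω⟩ : ∃ q : ℝ, 0 < q ∧ q < 1 ∧ 4 * ω * q ^ ((N : ℝ) - a) ≤ c / 2 := by
    refine ⟨min (1 / 2) ((c / (8 * ω)) ^ ((N : ℝ) - a)⁻¹), by positivity,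
      (min_le_left _ _).trans_lt (by norm_num), ?_⟩
    calc _ ≤ 4 * ω * ((c / (8 * ω)) ^ ((N : ℝ) - a)⁻¹) ^ ((N : ℝ) - a) := by
          gcongr
          exact min_le_right _ _
      _ = c / 2 := by
          rw [rpow_inv_rpow (by positivity) hNa.ne']
          field_simp
          norm_num
  have hqN : ω * q ^ N ≤ c / 2 := by
    have : q ^ N ≤ q ^ ((N : ℝ) - a) := by
      rw [← rpow_natCast]
      exact rpow_le_rpow_of_exponent_ge hq hq1.le (by linarith)
    nlinarith [mul_le_mul_of_nonneg_left this hω.le, pow_pos hq N, rpow_pos_of_pos hq ((N : ℝ) - a)]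
  set r : ℕ → ℝ := fun k => q ^ k * R with hrdef
  have hr0 : ∀ k, 0 < r k := fun k => by positivity
  have hrs : ∀ k, r (k + 1) = q * r k := fun k => by simp only [hrdef]; ring
  have hranti : Antitone r := antitone_nat_of_succ_le fun k => by
    rw [hrs]
    exact mul_le_of_le_one_left (hr0 k).le hq1.le
  have hrR : ∀ k, r k ≤ R := fun k => by simpa [hrdef] using hranti (Nat.zero_le k)
  set A : ℕ → Set (EuclideanSpace ℝ (Fin N)) :=
    fun k => Ω ∩ (Metric.ball 0 (r k) \ Metric.ball 0 (r (k + 1))) with hAdef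
  have hAmem : ∀ k x, x ∈ A k ↔ x ∈ Ω ∧ ‖x‖ < r k ∧ r (k + 1) ≤ ‖x‖ := by
    intro k x
    simp [hAdef]
  have hAm : ∀ k, MeasurableSet (A k) := fun k =>
    hΩ.inter (measurableSet_ball.diff measurableSet_ball)
  have hAdisj : Pairwise (Function.onFun Disjoint A) := by
    refine (pairwise_disjoint_on A).2 fun i j hij => Set.disjoint_left.2 fun x hi hj => ?_
    have h1 := ((hAmem i x).1 hi).2.2
    have h2 := ((hAmem j x).1 hj).2.1
    exact absurd (h1.trans_lt h2) (not_lt.2 (hranti hij))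
  have hAΩ : ∀ k, A k ⊆ Ω := fun k => Set.inter_subset_left
  have hApos : ∀ k, ∀ x ∈ A k, 0 < ‖x‖ := fun k x hx =>
    (hr0 (k + 1)).trans_le ((hAmem k x).1 hx).2.2
  have hAlow : ∀ k, ENNReal.ofReal (c / 2 * r k ^ N) ≤ volume (A k) := by
    intro k
    have h1 : ENNReal.ofReal (c * r k ^ N) ≤ volume (A k) + ENNReal.ofReal (c / 2 * r k ^ N) := by
      calc _ ≤ volume (Ω ∩ Metric.ball 0 (r k)) := hvol _ (hr0 k) (hrR k)
        _ ≤ volume (A k ∪ Metric.ball 0 (r (k + 1))) := by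
            refine measure_mono fun x hx => ?_
            by_cases h : x ∈ Metric.ball (0 : EuclideanSpace ℝ (Fin N)) (r (k + 1))
            · exact Or.inr h
            · exact Or.inl ⟨hx.1, hx.2, h⟩
        _ ≤ volume (A k) + volume (Metric.ball 0 (r (k + 1))) := measure_union_le _ _
        _ ≤ _ := by
            rw [hball _ (hr0 _), hrs, mul_pow, ← mul_assoc]
            have := pow_pos (hr0 k) N
            gcongr
    rw [show c * r k ^ N = c / 2 * r k ^ N + c / 2 * r k ^ N by ring,
      ENNReal.ofReal_add (by have := hr0 k; positivity) (by have := hr0 k; positivity)] at h1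
    exact (ENNReal.add_le_add_iff_right ENNReal.ofReal_ne_top).1 h1
  have hAup : ∀ k, volume (A (k + 1)) ≤ ENNReal.ofReal (ω * (q * r k) ^ N) := by
    intro k
    rw [← hrs, ← hball _ (hr0 _)]
    exact measure_mono fun x hx => hx.2.1
  set C := 4 / (c / 2) * 2 ^ ((N : ℝ) + 2 * s) * q ^ (-a) with hC
  refine ⟨q ^ (-a) * (2 * (R ^ (-a) * R ^ (2 * γ))), q ^ (-a) * C, by positivity, by positivity,
    fun φ hφ => ?_⟩
  set K : EuclideanSpace ℝ (Fin N) → EuclideanSpace ℝ (Fin N) → ENNReal :=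
    fun x y => ENNReal.ofReal ((φ x - φ y) ^ 2 *
          (‖x‖ ^ (-γ) * ‖y‖ ^ (-γ) * ‖x - y‖ ^ (-((N : ℝ) + 2 * s)))) with hK
  set H : ℕ → ENNReal :=
    fun k => ENNReal.ofReal (r k ^ (-a)) * ∫⁻ x in A k, ENNReal.ofReal (φ x ^ 2) with hH
  have hrec : ∀ k, 2 * H (k + 1) ≤
      H k + ENNReal.ofReal C * ∫⁻ x in A (k + 1), ∫⁻ y in A k, K x y := by
    intro k
    simp only [hH]
    rw [hrs k]
    exact two_mul_shell_le hs hγ (by positivity) hq hω.le (hr0 k) hqω (hAm _) (hAm _)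
      (fun x hx => ⟨hApos _ x hx, ((hAmem _ x).1 hx).2.1.le.trans (hranti k.le_succ)⟩)
      (fun x hx => ⟨hApos _ x hx, ((hAmem _ x).1 hx).2.1.le⟩)
      (hAdisj k.succ_ne_self) (hAup k) (hAlow k) hφ
  have hEsum : ∑' k, ENNReal.ofReal C * ∫⁻ x in A (k + 1), ∫⁻ y in A k, K x y ≤
      ENNReal.ofReal C * ∫⁻ x in Ω, ∫⁻ y in Ω, K x y := by
    rw [ENNReal.tsum_mul_left]
    gcongr
    calc ∑' k, ∫⁻ x in A (k + 1), ∫⁻ y in A k, K x y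
        ≤ ∑' k, ∫⁻ x in A (k + 1), ∫⁻ y in Ω, K x y :=
          ENNReal.tsum_le_tsum fun k => lintegral_mono fun x => lintegral_mono_set (hAΩ k)
      _ = ∫⁻ x in ⋃ k, A (k + 1), ∫⁻ y in Ω, K x y :=
          (lintegral_iUnion (fun k => hAm (k + 1))
            (hAdisj.comp_of_injective (add_left_injective 1)) _).symm
      _ ≤ _ := lintegral_mono_set (Set.iUnion_subset fun k => hAΩ (k + 1))
  have hH0 : H 0 ≤ ENNReal.ofReal (R ^ (-a) * R ^ (2 * γ)) *
      ∫⁻ x in Ω, ENNReal.ofReal (φ x ^ 2 * ‖x‖ ^ (-(2 * γ))) := by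
    simp only [hH]
    rw [show r 0 = R by simp [hrdef], ENNReal.ofReal_mul (by positivity), mul_assoc]
    gcongr
    rw [← lintegral_const_mul' _ _ ENNReal.ofReal_ne_top]
    refine (setLIntegral_mono' (hAm 0) fun x hx => ?_).trans (lintegral_mono_set (hAΩ 0))
    rw [← ENNReal.ofReal_mul (by positivity)]
    refine ENNReal.ofReal_le_ofReal ?_
    have hx0 := hApos 0 x hx
    have h1 : R ^ (-(2 * γ)) ≤ ‖x‖ ^ (-(2 * γ)) :=
      rpow_le_rpow_of_nonpos hx0 (((hAmem 0 x).1 hx).2.1.le.trans (hrR 0)) (by linarith)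
    calc φ x ^ 2 = R ^ (2 * γ) * (φ x ^ 2 * R ^ (-(2 * γ))) := by
          rw [rpow_neg hR.le]
          field_simp
      _ ≤ _ := by gcongr
  have hcover : Ω ∩ Metric.ball 0 R ⊆ {0} ∪ ⋃ k, A k := by
    rintro x ⟨hxΩ, hxR⟩
    by_cases hx : x = 0
    · exact Or.inl hx
    right
    have hx0 : 0 < ‖x‖ := norm_pos_iff.2 hx
    have hxR' : ‖x‖ < R := by simpa using hxR
    obtain ⟨n, hn1, hn2⟩ := exists_nat_pow_near_of_lt_one (div_pos hx0 hR)
      ((div_le_one hR).2 hxR'.le) hq hq1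
    rw [lt_div_iff₀ hR] at hn1
    rw [div_le_iff₀ hR] at hn2
    rcases hn2.lt_or_eq with hlt | heq
    · exact Set.mem_iUnion.2 ⟨n, (hAmem n x).2 ⟨hxΩ, hlt, hn1.le⟩⟩
    · cases n with
      | zero => simp [heq] at hxR'
      | succ m =>
        refine Set.mem_iUnion.2 ⟨m, (hAmem m x).2 ⟨hxΩ, ?_, heq.ge⟩⟩
        calc ‖x‖ = q * r m := by rw [heq, ← hrs]
          _ < r m := mul_lt_of_lt_one_left (hr0 m) hq1
  have hpiece : ∀ k, ∫⁻ x in A k, ENNReal.ofReal (φ x ^ 2 * ‖x‖ ^ (-a)) ≤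
      ENNReal.ofReal (q ^ (-a)) * H k := by
    intro k
    simp only [hH]
    rw [← mul_assoc, ← ENNReal.ofReal_mul (by positivity), ← mul_rpow hq.le (hr0 k).le, ← hrs,
      ← lintegral_const_mul' _ _ ENNReal.ofReal_ne_top]
    refine setLIntegral_mono' (hAm k) fun x hx => ?_
    have := hr0 (k + 1)
    rw [← ENNReal.ofReal_mul (by positivity), mul_comm]
    exact ENNReal.ofReal_le_ofReal (mul_le_mul_of_nonneg_right
      (rpow_le_rpow_of_nonpos this ((hAmem k x).1 hx).2.2 (by linarith)) (sq_nonneg _))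
  calc ∫⁻ x in Ω ∩ Metric.ball 0 R, ENNReal.ofReal (φ x ^ 2 * ‖x‖ ^ (-a))
      ≤ ∫⁻ x in {0} ∪ ⋃ k, A k, ENNReal.ofReal (φ x ^ 2 * ‖x‖ ^ (-a)) := lintegral_mono_set hcover
    _ ≤ (∫⁻ x in {0}, ENNReal.ofReal (φ x ^ 2 * ‖x‖ ^ (-a))) +
          ∫⁻ x in ⋃ k, A k, ENNReal.ofReal (φ x ^ 2 * ‖x‖ ^ (-a)) := lintegral_union_le _ _ _
    _ = ∑' k, ∫⁻ x in A k, ENNReal.ofReal (φ x ^ 2 * ‖x‖ ^ (-a)) := by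
        rw [lintegral_iUnion hAm hAdisj, setLIntegral_congr_fun (measurableSet_singleton _)
          (g := fun _ => 0), lintegral_zero, zero_add]
        rintro x rfl
        simp [zero_rpow (neg_ne_zero.2 ha0.ne')]
    _ ≤ ENNReal.ofReal (q ^ (-a)) * ∑' k, H k := by
        rw [← ENNReal.tsum_mul_left]
        exact ENNReal.tsum_le_tsum hpiece
    _ ≤ ENNReal.ofReal (q ^ (-a)) * (2 * H 0 + _) := by
        gcongr
        exact tsum_le_of_two_mul_succ_le hrec
    _ ≤ ENNReal.ofReal (q ^ (-a)) * (2 * (ENNReal.ofReal (R ^ (-a) * R ^ (2 * γ)) *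
          ∫⁻ x in Ω, ENNReal.ofReal (φ x ^ 2 * ‖x‖ ^ (-(2 * γ)))) +
          ENNReal.ofReal C * ∫⁻ x in Ω, ∫⁻ y in Ω, K x y) := by gcongr
    _ = _ := by
        rw [mul_add, ENNReal.ofReal_mul (p := q ^ (-a)) (by positivity),
          ENNReal.ofReal_mul (p := q ^ (-a)) (by positivity),
          ENNReal.ofReal_mul (p := 2) zero_le_two, ENNReal.ofReal_ofNat]
        ring

lemma setLIntegral_diff_ball_le {N : ℕ} {s γ R : ℝ} (hs : 0 < s) (hR : 0 < R)
    {Ω : Set (EuclideanSpace ℝ (Fin N))} (hΩ : MeasurableSet Ω)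
    (φ : EuclideanSpace ℝ (Fin N) → ℝ) :
    ∫⁻ x in Ω \ Metric.ball 0 R, ENNReal.ofReal (φ x ^ 2 * ‖x‖ ^ (-(2 * s + 2 * γ))) ≤
      ENNReal.ofReal (R ^ (-(2 * s))) *
        ∫⁻ x in Ω, ENNReal.ofReal (φ x ^ 2 * ‖x‖ ^ (-(2 * γ))) := by
  rw [← lintegral_const_mul' _ _ ENNReal.ofReal_ne_top]
  refine (setLIntegral_mono' (hΩ.diff measurableSet_ball) fun x hx => ?_).trans
    (lintegral_mono_set Set.sdiff_subset)
  have hxR : R ≤ ‖x‖ := by simpa using hx.2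
  rw [← ENNReal.ofReal_mul (by positivity)]
  refine ENNReal.ofReal_le_ofReal ?_
  have h1 : ‖x‖ ^ (-(2 * s)) ≤ R ^ (-(2 * s)) := rpow_le_rpow_of_nonpos hR hxR (by linarith)
  rw [neg_add, rpow_add (hR.trans_le hxR)]
  calc φ x ^ 2 * (‖x‖ ^ (-(2 * s)) * ‖x‖ ^ (-(2 * γ)))
      ≤ φ x ^ 2 * (R ^ (-(2 * s)) * ‖x‖ ^ (-(2 * γ))) := by gcongr
    _ = _ := by ring

/-- **Weighted Hardy inequality with nonzero boundary values**: for `0 < s < 1`, `N > 2s`,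
`0 < γ < (N-2s)/2` and a bounded `C^{1,1}` domain `Ω`, there exists `C = C(Ω,N,s,γ) > 0` such
that for every `φ` with `‖φ‖_{Y^{s,γ}(Ω)} < ∞`,
`C ∫_Ω φ² |x|^{-(2s+2γ)} dx ≤ ∫_Ω ∫_Ω (φ(x)-φ(y))² dν + ∫_Ω φ² dμ`. -/
theorem weighted_hardy_nonzero_boundary (N : ℕ) (s γ : ℝ) (hs0 : 0 < s) (hs1 : s < 1)
    (hN : 2 * s < (N : ℝ)) (hγ0 : 0 < γ) (hγ : γ < ((N : ℝ) - 2 * s) / 2)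
    (Ω : Set (EuclideanSpace ℝ (Fin N))) (hΩ : IsC11Domain Ω) :
    ∃ C : ℝ, 0 < C ∧ ∀ φ : EuclideanSpace ℝ (Fin N) → ℝ, Measurable φ →
      YnormFinite N s γ Ω φ →
      C * ∫ x in Ω, φ x ^ 2 * ‖x‖ ^ (-(2 * s + 2 * γ)) ≤
        (∫ x in Ω, ∫ y in Ω,
          (φ x - φ y) ^ 2 * (‖x‖ ^ (-γ) * ‖y‖ ^ (-γ) * ‖x - y‖ ^ (-((N : ℝ) + 2 * s)))) +
          ∫ x in Ω, φ x ^ 2 * ‖x‖ ^ (-(2 * γ)) := by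
  have hΩm : MeasurableSet Ω := hΩ.1.measurableSet
  obtain ⟨R, C₁, C₂, hR, hC₁, hC₂, hnear⟩ : ∃ R C₁ C₂ : ℝ, 0 < R ∧ 0 ≤ C₁ ∧ 0 ≤ C₂ ∧
      ∀ φ : EuclideanSpace ℝ (Fin N) → ℝ, Measurable φ →
      ∫⁻ x in Ω ∩ Metric.ball 0 R, ENNReal.ofReal (φ x ^ 2 * ‖x‖ ^ (-(2 * s + 2 * γ))) ≤
        ENNReal.ofReal C₁ * (∫⁻ x in Ω, ENNReal.ofReal (φ x ^ 2 * ‖x‖ ^ (-(2 * γ)))) +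
        ENNReal.ofReal C₂ * ∫⁻ x in Ω, ∫⁻ y in Ω, ENNReal.ofReal ((φ x - φ y) ^ 2 *
          (‖x‖ ^ (-γ) * ‖y‖ ^ (-γ) * ‖x - y‖ ^ (-((N : ℝ) + 2 * s)))) := by
    by_cases h0 : (0 : EuclideanSpace ℝ (Fin N)) ∈ closure Ω
    · obtain ⟨c, R, hc, hR, hvol⟩ := hΩ.exists_le_volume_inter_ball h0
      exact ⟨R, (exists_hardy_ball hs0 hγ0 (by linarith) hc hR hΩm hvol).imp fun _ ⟨C₂, h⟩ =>
        ⟨C₂, hR, h⟩⟩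
    · obtain ⟨R, hR, hsub⟩ := Metric.isOpen_iff.1 isClosed_closure.isOpen_compl _ h0
      have hempty : Ω ∩ Metric.ball 0 R = ∅ := by
        refine Set.eq_empty_of_forall_notMem fun x hx => hsub hx.2 (subset_closure hx.1)
      exact ⟨R, 0, 0, hR, le_rfl, le_rfl, fun φ _ => by simp [hempty]⟩
  have hC : 0 < C₁ + R ^ (-(2 * s)) + C₂ := by positivity
  refine ⟨(C₁ + R ^ (-(2 * s)) + C₂)⁻¹, by positivity, fun φ hφ hfin => ?_⟩
  obtain ⟨hμ, hν⟩ := hfin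
  rw [inv_mul_le_iff₀ hC]
  have hμ_eq := ofReal_integral_eq_lintegral_ofReal hμ (ae_of_all _ fun x => by positivity)
  have hν_eq := ofReal_integral_eq_lintegral_ofReal hν (ae_of_all _ fun p => by positivity)
  rw [lintegral_prod _ (by fun_prop), integral_prod _ hν] at hν_eq
  have hIμ : 0 ≤ ∫ x in Ω, φ x ^ 2 * ‖x‖ ^ (-(2 * γ)) := integral_nonneg fun x => by positivity
  have hIν : 0 ≤ ∫ x in Ω, ∫ y in Ω,
      (φ x - φ y) ^ 2 * (‖x‖ ^ (-γ) * ‖y‖ ^ (-γ) * ‖x - y‖ ^ (-((N : ℝ) + 2 * s))) :=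
    integral_nonneg fun x => integral_nonneg fun y => by positivity
  have hnear' := hnear φ hφ
  have hfar := setLIntegral_diff_ball_le (γ := γ) hs0 hR hΩm φ
  simp only at hν_eq hμ_eq
  rw [← hμ_eq, ← hν_eq, ← ENNReal.ofReal_mul hC₁, ← ENNReal.ofReal_mul hC₂,
    ← ENNReal.ofReal_add (by positivity) (by positivity)] at hnear'
  rw [← hμ_eq, ← ENNReal.ofReal_mul (by positivity)] at hfar
  have hall := add_le_add hnear' hfar
  rw [lintegral_inter_add_sdiff _ _ measurableSet_ball,
    ← ENNReal.ofReal_add (by positivity) (by positivity)] at hall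
  rw [integral_eq_lintegral_of_nonneg_ae (ae_of_all _ fun x => by positivity)
    (Measurable.aestronglyMeasurable (by fun_prop))]
  refine (ENNReal.toReal_le_of_le_ofReal (by positivity) hall).trans ?_
  have hRs : 0 < R ^ (-(2 * s)) := by positivity
  nlinarith [mul_nonneg hC₂ hIμ, mul_nonneg hC₁ hIν, mul_nonneg hRs.le hIν]

end
end
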